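/- Fix ε > 0. There exists N (depending only on ε) such that for all n ≥ N the following holds: let S ⊆ ℝ^n be a Borel measurable set symmetric about the origin with Lebesgue measure V, let k be a positive integer with k ≤ (n/2)^{1/2 − ε}, and suppose 8V ≤ √(n/2) − k. Let P(S,k) be the μ_n-measure of the set of lattices L ∈ X_n having at most k nonzero vectors up to sign in S. Then (1 − (√(n/2) − k)^{−1/2})·P_{V/2}(k) − E ≤ P(S,k) ≤ (1 + (√(n/2) − k)^{−1/2})·P_{V/2}(k) + E, where E = (12/k!)·√(n/2)·(0.999)^n·(V/2+1)^{√(n/2)}. -/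

import Mathlib

open MeasureTheory Matrix
open scoped Nat Classical

noncomputable section

abbrev SLR (n : ℕ) := Matrix.SpecialLinearGroup (Fin n) ℝ

instance (n : ℕ) : MeasurableSpace (SLR n) :=
  MeasurableSpace.comap (fun g : SLR n => (g : Matrix (Fin n) (Fin n) ℝ))
    (inferInstanceAs (MeasurableSpace (Fin n → Fin n → ℝ)))

/-- The image of SL_n(ℤ) in SL_n(ℝ), as a subgroup. -/
def SLZ (n : ℕ) : Subgroup (SLR n) :=
  (Matrix.SpecialLinearGroup.map (Int.castRingHom ℝ)).range

/-- The space of lattices `X_n = SL_n(ℤ) \ SL_n(ℝ)` (space of right cosets). -/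
def LatSpace (n : ℕ) := Quotient (QuotientGroup.rightRel (SLZ n))

instance (n : ℕ) : MeasurableSpace (LatSpace n) :=
  inferInstanceAs (MeasurableSpace (Quotient _))

/-- The coset of `g`. -/
def latMk (n : ℕ) (g : SLR n) : LatSpace n :=
  Quotient.mk (QuotientGroup.rightRel (SLZ n)) g

/-- Right translation action of `SL_n(ℝ)` on `X_n`. -/
def rTranslate (n : ℕ) (a : SLR n) (x : LatSpace n) : LatSpace n :=
  Quotient.lift (fun g => latMk n (g * a))
    (fun g g' hgg' => Quotient.sound (QuotientGroup.rightRel_apply.mpr (by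
      have h : g' * g⁻¹ ∈ SLZ n := QuotientGroup.rightRel_apply.mp hgg'
      simpa [_root_.mul_inv_rev, mul_assoc] using h))) x

/-- The lattice `ℤ^n g` associated to `g ∈ SL_n(ℝ)`. -/
def latticeOf (n : ℕ) (g : SLR n) : Set (Fin n → ℝ) :=
  Set.range (fun m : Fin n → ℤ =>
    Matrix.vecMul (fun i => (m i : ℝ)) (g : Matrix (Fin n) (Fin n) ℝ))

/-- `S'`: the set of points of `S` whose first nonzero coordinate is positive. -/
def posHalf (n : ℕ) (S : Set (Fin n → ℝ)) : Set (Fin n → ℝ) :=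
  {x ∈ S | ∃ i : Fin n, 0 < x i ∧ ∀ j < i, x j = 0}

/-- `A` has at least `k` elements. -/
def hasAtLeast {α : Type*} (A : Set α) (k : ℕ) : Prop :=
  ∃ t : Finset α, ↑t ⊆ A ∧ t.card = k

/-- `ρ_{S',h}(L)`: the number of `h`-element subsets of `L ∩ S'`. -/
def rhoSub (n : ℕ) (S : Set (Fin n → ℝ)) (h : ℕ) (g : SLR n) : ℕ :=
  Nat.card {t : Finset (Fin n → ℝ) // ↑t ⊆ latticeOf n g ∩ posHalf n S ∧ t.card = h}

end

section Lift

variable {n : ℕ}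

instance countable_SLZ : Countable (SLZ n) := by
  have : Countable (Matrix.SpecialLinearGroup (Fin n) ℤ) := by
    have : Countable (Matrix (Fin n) (Fin n) ℤ) := inferInstanceAs (Countable (Fin n → Fin n → ℤ))
    exact Subtype.countable
  exact Set.countable_coe_iff.mpr (Set.countable_range _)

/-- The matrix of an element of `SL_n(ℝ)`. -/
def toMat (g : SLR n) : Matrix (Fin n) (Fin n) ℝ := (g : Matrix (Fin n) (Fin n) ℝ)

lemma toMat_mul (g h : SLR n) : toMat (g * h) = toMat g * toMat h := Matrix.SpecialLinearGroup.coe_mul g h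

lemma toMat_one : toMat (1 : SLR n) = 1 := Matrix.SpecialLinearGroup.coe_one

lemma toMat_inv (g : SLR n) : toMat g⁻¹ = adjugate (toMat g) := Matrix.SpecialLinearGroup.coe_inv g

lemma det_toMat (g : SLR n) : (toMat g).det = 1 := g.2

lemma measurable_toMat : Measurable (β := Fin n → Fin n → ℝ) (toMat (n := n)) :=
  fun s hs => ⟨s, hs, rfl⟩

lemma measurable_SLR_entry (i j : Fin n) : Measurable fun g : SLR n => toMat g i j := by
  have h := measurable_toMat (n := n)
  exact (measurable_pi_apply j).comp ((measurable_pi_apply i).comp h)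

lemma measurable_SLR_of_entry {α : Type*} [MeasurableSpace α] {f : α → SLR n}
    (hf : ∀ i j, Measurable fun x => toMat (f x) i j) : Measurable f := by
  refine measurable_comap_iff.mpr ?_
  exact measurable_pi_iff.mpr fun i => measurable_pi_iff.mpr fun j => hf i j

lemma measurable_SLR_mul {α : Type*} [MeasurableSpace α] {f g : α → SLR n}
    (hf : Measurable f) (hg : Measurable g) : Measurable fun x => f x * g x := by
  refine measurable_SLR_of_entry fun i j => ?_
  simp only [toMat_mul, Matrix.mul_apply]
  exact Finset.measurable_sum _ fun k _ =>
    ((measurable_SLR_entry i k).comp hf).mul ((measurable_SLR_entry k j).comp hg)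

lemma measurable_SLR_inv_entry (i j : Fin n) : Measurable fun g : SLR n => toMat g⁻¹ i j := by
  simp only [toMat_inv]
  have h := measurable_toMat (n := n)
  have hc : Continuous fun A : Fin n → Fin n → ℝ => (Matrix.adjugate (Matrix.of A)) i j := by
    have : Continuous fun A : Fin n → Fin n → ℝ => Matrix.of A := continuous_id
    exact this.matrix_adjugate.matrix_elem i j
  exact hc.measurable.comp h

/-- Cells covering `SL_n(ℝ)` that contain at most one point of every `SL_n(ℤ)`-orbit. -/
def slCell (n : ℕ) (p : ℕ × (Fin n → Fin n → ℤ)) : Set (SLR n) :=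
  {g | (∀ i j, |toMat g⁻¹ i j| ≤ p.1) ∧
    ∀ i j, ⌊toMat g i j * ((n + 1) * (p.1 + 1) : ℝ)⌋ = p.2 i j}

lemma measurableSet_slCell (p : ℕ × (Fin n → Fin n → ℤ)) : MeasurableSet (slCell n p) := by
  have h1 : MeasurableSet {g : SLR n | ∀ i j, |toMat g⁻¹ i j| ≤ p.1} := by
    simp only [Set.ofPred_forall]
    exact MeasurableSet.iInter fun i => MeasurableSet.iInter fun j =>
      measurableSet_le (measurable_SLR_inv_entry i j).abs measurable_const
  have h2 : MeasurableSet {g : SLR n |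
      ∀ i j, ⌊toMat g i j * ((n + 1) * (p.1 + 1) : ℝ)⌋ = p.2 i j} := by
    simp only [Set.ofPred_forall]
    exact MeasurableSet.iInter fun i => MeasurableSet.iInter fun j =>
      (Int.measurable_floor.comp ((measurable_SLR_entry i j).mul_const _))
        (measurableSet_singleton _)
  exact h1.inter h2

lemma exists_mem_slCell (g : SLR n) : ∃ p, g ∈ slCell n p := by
  obtain ⟨R, hR⟩ := exists_nat_ge (∑ i, ∑ j, |toMat g⁻¹ i j|)
  refine ⟨(R, fun i j => ⌊toMat g i j * ((n + 1) * (R + 1) : ℝ)⌋), fun i j => ?_, fun i j => rfl⟩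
  refine le_trans ?_ hR
  refine le_trans ?_ (Finset.single_le_sum (f := fun i => ∑ j, |toMat g⁻¹ i j|)
    (fun i _ => Finset.sum_nonneg fun j _ => abs_nonneg _) (Finset.mem_univ i))
  exact Finset.single_le_sum (f := fun j => |toMat g⁻¹ i j|)
    (fun j _ => abs_nonneg _) (Finset.mem_univ j)

lemma eq_one_of_mem_slCell {p : ℕ × (Fin n → Fin n → ℤ)} {g γ : SLR n} (hγ : γ ∈ SLZ n)
    (hg : g ∈ slCell n p) (hg' : γ * g ∈ slCell n p) : γ = 1 := by
  obtain ⟨z, rfl⟩ := hγ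
  set γ := (Matrix.SpecialLinearGroup.map (Int.castRingHom ℝ)) z with hγ
  have hK : (0 : ℝ) < (n + 1) * (p.1 + 1) := by positivity
  have hd : ∀ i j, |toMat (γ * g) i j - toMat g i j| < 1 / ((n + 1) * (p.1 + 1) : ℝ) := by
    intro i j
    have := Int.abs_sub_lt_one_of_floor_eq_floor ((hg'.2 i j).trans (hg.2 i j).symm)
    rw [← sub_mul, abs_mul, abs_of_pos hK] at this
    rwa [lt_div_iff₀ hK]
  have he : toMat γ - 1 = (toMat (γ * g) - toMat g) * toMat g⁻¹ := by
    have h1 : toMat g * toMat g⁻¹ = 1 := by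
      rw [← toMat_mul, mul_inv_cancel, toMat_one]
    rw [toMat_mul, sub_mul, Matrix.mul_assoc, h1, Matrix.mul_one]
  ext i j
  have hlt : |(toMat γ - 1) i j| < 1 := by
    rw [he, Matrix.mul_apply]
    refine (Finset.abs_sum_le_sum_abs _ _).trans_lt ?_
    have : ∀ k ∈ Finset.univ, |(toMat (γ * g) - toMat g) i k * toMat g⁻¹ k j| ≤ 1 / (n + 1 : ℝ) := by
      intro k _
      rw [abs_mul]
      calc _ ≤ 1 / ((n + 1) * (p.1 + 1) : ℝ) * (p.1 + 1) := by
            refine mul_le_mul (hd i k).le ((hg.1 k j).trans (by linarith)) (abs_nonneg _)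
              (by positivity)
        _ = _ := by field_simp
    refine (Finset.sum_le_sum this).trans_lt ?_
    rw [Finset.sum_const, Finset.card_univ, Fintype.card_fin, nsmul_eq_mul, mul_one_div,
      div_lt_one (by positivity)]
    linarith
  have h_entry : (toMat γ - 1) i j = ((z.1 - 1 : Matrix (Fin n) (Fin n) ℤ) i j : ℤ) := by
    simp only [Matrix.sub_apply, hγ, Int.cast_sub]
    congr 1
    by_cases h : i = j <;> simp [Matrix.one_apply, h]
  rw [h_entry, ← Int.cast_abs] at hlt
  have h0 : |(z.1 - 1 : Matrix (Fin n) (Fin n) ℤ) i j| < 1 := by exact_mod_cast hlt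
  have h0 := Int.abs_lt_one_iff.mp h0
  rw [h0, Int.cast_zero, Matrix.sub_apply, sub_eq_zero] at h_entry
  exact h_entry

lemma exists_measurable_section (n : ℕ) :
    ∃ r : SLR n → SLR n, Measurable r ∧ (∀ g, ∃ γ ∈ SLZ n, r g = γ * g) ∧
      ∀ γ ∈ SLZ n, ∀ g, r (γ * g) = r g := by
  obtain ⟨c, hc⟩ := exists_surjective_nat (ℕ × (Fin n → Fin n → ℤ))
  let B : ℕ → Set (SLR n) := fun i => slCell n (c i)
  have hB : ∀ i, MeasurableSet (B i) := fun i => measurableSet_slCell _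
  let O : ℕ → Set (SLR n) := fun i => {g | ∃ γ : SLZ n, γ.1 * g ∈ B i}
  have hO : ∀ i, MeasurableSet (O i) := by
    intro i
    simp only [O, Set.ofPred_exists]
    exact MeasurableSet.iUnion fun γ => measurable_SLR_mul measurable_const measurable_id (hB i)
  have hOinv : ∀ i, ∀ γ ∈ SLZ n, ∀ g, γ * g ∈ O i ↔ g ∈ O i := by
    intro i γ hγ g
    constructor
    · rintro ⟨δ, hδ⟩
      exact ⟨⟨δ.1 * γ, (SLZ n).mul_mem δ.2 hγ⟩, by simpa [mul_assoc] using hδ⟩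
    · rintro ⟨δ, hδ⟩
      exact ⟨⟨δ.1 * γ⁻¹, (SLZ n).mul_mem δ.2 ((SLZ n).inv_mem hγ)⟩, by
        simpa [mul_assoc] using hδ⟩
  let D : Set (SLR n) := ⋃ i, (B i ∩ ⋂ j ∈ Set.Iio i, (O j)ᶜ)
  have hD : MeasurableSet D := MeasurableSet.iUnion fun i => (hB i).inter
    (MeasurableSet.biInter (Set.to_countable _) fun j _ => (hO j).compl)
  have hsub : ∀ i g, g ∈ B i → g ∈ O i := fun i g hg => ⟨1, by simpa using hg⟩
  have hex : ∀ g, ∃ γ ∈ SLZ n, γ * g ∈ D := by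
    intro g
    have h : ∃ i, g ∈ O i := by
      obtain ⟨p, hp⟩ := exists_mem_slCell g
      obtain ⟨i, rfl⟩ := hc p
      exact ⟨i, hsub i g hp⟩
    obtain ⟨γ, hγ⟩ := Nat.find_spec h
    refine ⟨γ.1, γ.2, Set.mem_iUnion.mpr ⟨Nat.find h, hγ, ?_⟩⟩
    simp only [Set.mem_iInter, Set.mem_Iio, Set.mem_compl_iff]
    intro j hj hj'
    exact Nat.find_min h hj ((hOinv j γ.1 γ.2 g).mp hj')
  have huniq : ∀ g ∈ D, ∀ γ ∈ SLZ n, γ * g ∈ D → γ = 1 := by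
    intro g hg γ hγ hg'
    obtain ⟨i, hi, hi'⟩ := Set.mem_iUnion.mp hg
    obtain ⟨j, hj, hj'⟩ := Set.mem_iUnion.mp hg'
    simp only [Set.mem_iInter, Set.mem_Iio, Set.mem_compl_iff] at hi' hj'
    have hij : i = j := by
      rcases lt_trichotomy i j with h | h | h
      · exact absurd ((hOinv i γ hγ g).mpr (hsub i g hi)) (hj' i h)
      · exact h
      · exact absurd ((hOinv j γ hγ g).mp (hsub j _ hj)) (hi' j h)
    subst hij
    exact eq_one_of_mem_slCell hγ hi hj
  choose t ht htD using hex
  have heq : ∀ g, ∀ γ ∈ SLZ n, γ * g ∈ D → t g * g = γ * g := by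
    intro g γ hγ h
    have := huniq (γ * g) h (t g * γ⁻¹) ((SLZ n).mul_mem (ht g) ((SLZ n).inv_mem hγ))
      (by simpa [mul_assoc] using htD g)
    rw [mul_inv_eq_one] at this
    rw [this]
  refine ⟨fun g => t g * g, ?_, fun g => ⟨t g, ht g, rfl⟩, ?_⟩
  · intro C hC
    have : (fun g => t g * g) ⁻¹' C = ⋃ γ : SLZ n, {g | γ.1 * g ∈ D ∩ C} := by
      ext g
      simp only [Set.mem_preimage, Set.mem_iUnion, Set.mem_ofPred_eq]
      constructor
      · intro h
        exact ⟨⟨t g, ht g⟩, htD g, h⟩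
      · rintro ⟨γ, h1, h2⟩
        rw [heq g γ.1 γ.2 h1]
        exact h2
    rw [this]
    exact MeasurableSet.iUnion fun γ =>
      measurable_SLR_mul measurable_const measurable_id (hD.inter hC)
  · intro γ hγ g
    have := heq g (t (γ * g) * γ) ((SLZ n).mul_mem (ht _) hγ)
      (by simpa [mul_assoc] using htD (γ * g))
    simpa [mul_assoc] using this.symm

/-- A probability measure on `SL_n(ℝ)` representing an invariant probability measure on the
space of lattices. -/
structure IsLatticeLift (P : Measure (SLR n)) : Prop where
  prob : IsProbabilityMeasure P
  lintegral_mul_right : ∀ F : SLR n → ENNReal, Measurable F →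
    (∀ γ ∈ SLZ n, ∀ g, F (γ * g) = F g) → ∀ a, ∫⁻ g, F (g * a) ∂P = ∫⁻ g, F g ∂P

lemma exists_latticeLift (μ : Measure (LatSpace n)) (hμ : IsProbabilityMeasure μ)
    (hinv : ∀ a : SLR n, μ.map (rTranslate n a) = μ) :
    ∃ P : Measure (SLR n), IsLatticeLift P ∧
      ∀ A, MeasurableSet A → P (latMk n ⁻¹' A) = μ A := by
  obtain ⟨r, hr, hr1, hr2⟩ := exists_measurable_section n
  have hmk : Measurable (latMk n) := measurable_quotient_mk''
  have hrel : ∀ g γ : SLR n, γ ∈ SLZ n → latMk n (γ * g) = latMk n g := by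
    intro g γ hγ
    refine Quotient.sound (QuotientGroup.rightRel_apply.mpr ?_)
    simpa using hγ
  let s : LatSpace n → SLR n := Quotient.lift r (by
    intro a b hab
    have h : b * a⁻¹ ∈ SLZ n := QuotientGroup.rightRel_apply.mp hab
    have := hr2 _ h a
    simpa using this.symm)
  have hs : Measurable s := measurable_from_quotient.mpr hr
  have hsmk : ∀ g, s (latMk n g) = r g := fun g => rfl
  have hmks : ∀ x, latMk n (s x) = x := by
    intro x
    obtain ⟨g, rfl⟩ := Quotient.exists_rep x
    obtain ⟨γ, hγ, h⟩ := hr1 g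
    change latMk n (r g) = latMk n g
    rw [h, hrel g γ hγ]
  refine ⟨μ.map s, ⟨Measure.isProbabilityMeasure_map hs.aemeasurable, ?_⟩, ?_⟩
  · intro F hF hFinv a
    let Fb : LatSpace n → ENNReal := Quotient.lift F (by
      intro a b hab
      have h : b * a⁻¹ ∈ SLZ n := QuotientGroup.rightRel_apply.mp hab
      have := hFinv _ h a
      simpa using this.symm)
    have hFb : Measurable Fb := measurable_from_quotient.mpr hF
    have hT : Measurable (rTranslate n a) := measurable_from_quotient.mpr
      (hmk.comp (measurable_SLR_mul measurable_id measurable_const))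
    have h1 : ∀ x, F (s x * a) = Fb (rTranslate n a x) := by
      intro x
      conv_rhs => rw [← hmks x]
      rfl
    have h2 : ∀ x, F (s x) = Fb x := by
      intro x
      conv_rhs => rw [← hmks x]
      rfl
    have hFa : Measurable fun g => F (g * a) :=
      hF.comp (measurable_SLR_mul measurable_id measurable_const)
    rw [lintegral_map hFa hs,
      lintegral_map hF hs]
    simp_rw [h1, h2]
    rw [← lintegral_map hFb hT, hinv a]
  · intro A hA
    rw [Measure.map_apply hs (hmk hA)]
    congr 1
    ext x
    simp [hmks]

end Lift

section Shear

variable {n : ℕ} {ι : Type*} [Fintype ι]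

/-- The action of `SL_n(ℝ)` on tuples of row vectors. -/
def ract (X : ι → Fin n → ℝ) (g : SLR n) : ι → Fin n → ℝ := fun i => vecMul (X i) (toMat g)

/-- An integral tuple viewed as a real one. -/
def castZ (m : ι → Fin n → ℤ) : ι → Fin n → ℝ := fun i c => m i c

lemma ract_ract (X : ι → Fin n → ℝ) (g a : SLR n) : ract (ract X g) a = ract X (g * a) := by
  ext1 i
  simp only [ract, toMat_mul, vecMul_vecMul]

/-- The vector whose coordinate `c` is the sum of the `w k` with `e k = c`. -/
def pushVec (e : ι → Fin n) (w : ι → ℝ) : Fin n → ℝ := fun c => ∑ k, if e k = c then w k else 0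

lemma dotProduct_pushVec (e : ι → Fin n) (w : ι → ℝ) (x : Fin n → ℝ) :
    x ⬝ᵥ pushVec e w = ∑ k, x (e k) * w k := by
  simp only [dotProduct, pushVec, Finset.mul_sum]
  rw [Finset.sum_comm]
  refine Finset.sum_congr rfl fun k _ => ?_
  simp

/-- The matrix of a shear along column `j` followed by a diagonal scaling. -/
noncomputable def shearMat (e : ι → Fin n) (j : Fin n) (T : ℕ) (w : ι → ℝ) : Matrix (Fin n) (Fin n) ℝ :=
  (1 + replicateCol Unit (pushVec e w) * replicateRow Unit (Pi.single j (1 : ℝ))) *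
    diagonal (fun c => if c = j then (T : ℝ) ^ (n - 1) else (T : ℝ)⁻¹)

lemma det_shearMat {e : ι → Fin n} {j : Fin n} (hj : ∀ k, e k ≠ j) {T : ℕ} (hT : 0 < T)
    (w : ι → ℝ) : (shearMat e j T w).det = 1 := by
  have hT' : (T : ℝ) ≠ 0 := by positivity
  rw [shearMat, det_mul, det_one_add_replicateCol_mul_replicateRow, det_diagonal]
  have h0 : pushVec e w j = 0 := by
    simp [pushVec, hj]
  rw [single_one_dotProduct, h0, add_zero, one_mul, Finset.prod_ite]
  simp only [Finset.prod_const]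
  rw [Finset.filter_eq' , if_pos (Finset.mem_univ j), Finset.card_singleton, pow_one,
    Finset.filter_ne', Finset.card_erase_of_mem (Finset.mem_univ j), Finset.card_univ,
    Fintype.card_fin, inv_pow, mul_inv_cancel₀ (pow_ne_zero _ hT')]

/-- `shearMat` as an element of `SL_n(ℝ)`. -/
noncomputable def shear {e : ι → Fin n} {j : Fin n} (hj : ∀ k, e k ≠ j) {T : ℕ} (hT : 0 < T)
    (w : ι → ℝ) : SLR n := ⟨shearMat e j T w, det_shearMat hj hT w⟩

/-- Replace column `j` of a tuple of row vectors. -/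
def setCol (j : Fin n) (X : ι → Fin n → ℝ) (s : ι → ℝ) : ι → Fin n → ℝ :=
  fun i => Function.update (X i) j (s i)

/-- The square submatrix formed by the columns `e k`. -/
def colMat (e : ι → Fin n) (X : ι → Fin n → ℝ) : Matrix ι ι ℝ := Matrix.of fun i k => X i (e k)

lemma ract_shear {e : ι → Fin n} {j : Fin n} (hj : ∀ k, e k ≠ j) {T : ℕ} (hT : 0 < T)
    (w : ι → ℝ) (X : ι → Fin n → ℝ) :
    ract X (shear hj hT w) = setCol j ((T : ℝ)⁻¹ • X)
      ((T : ℝ) ^ (n - 1) • ((fun i => X i j) + colMat e X *ᵥ w)) := by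
  ext i c
  have h : toMat (shear hj hT w) = shearMat e j T w := rfl
  simp only [ract, h, shearMat]
  rw [← vecMul_vecMul, vecMul_diagonal, vecMul_add, vecMul_one, ← vecMul_vecMul]
  have h1 : (X i ᵥ* replicateCol Unit (pushVec e w)) ᵥ* replicateRow Unit (Pi.single j 1)
      = (∑ k, X i (e k) * w k) • (Pi.single j 1 : Fin n → ℝ) := by
    ext c
    rw [← dotProduct_pushVec]
    simp [vecMul, dotProduct, replicateCol, replicateRow]
  rw [h1]
  by_cases hc : c = j
  · subst hc
    simp [setCol, colMat, mulVec, dotProduct]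
    ring
  · simp [setCol, hc]
    ring

lemma measurable_shear {e : ι → Fin n} {j : Fin n} (hj : ∀ k, e k ≠ j) {T : ℕ} (hT : 0 < T) :
    Measurable fun w => shear hj hT w := by
  refine measurable_SLR_of_entry fun a b => ?_
  have h : ∀ w, toMat (shear hj hT w) = shearMat e j T w := fun w => rfl
  simp only [h, shearMat, mul_diagonal]
  refine Measurable.mul_const ?_ _
  simp only [Matrix.add_apply, Matrix.mul_apply, replicateCol_apply, replicateRow_apply, pushVec]
  refine measurable_const.add ?_
  refine Finset.measurable_sum _ fun _ _ => Measurable.mul_const ?_ _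
  refine Finset.measurable_sum _ fun k _ => ?_
  split_ifs
  · exact measurable_pi_apply k
  · exact measurable_const

end Shear

section ChangeOfVariables

variable {n : ℕ} {ι : Type*} [Fintype ι]

lemma lintegral_floor {T : ℝ} (hT : 0 < T) (H : (ι → Fin n → ℤ) → ENNReal) :
    ∫⁻ y : ι → Fin n → ℝ, H (fun i c => ⌊T * y i c⌋) =
      ENNReal.ofReal ((T⁻¹ ^ n) ^ Fintype.card ι) * ∑' m, H m := by
  have hfl : Measurable fun (y : ι → Fin n → ℝ) (i : ι) (c : Fin n) => ⌊T * y i c⌋ := by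
    refine measurable_pi_iff.mpr fun i => measurable_pi_iff.mpr fun c => ?_
    have h : Measurable fun y : ι → Fin n → ℝ => T * y i c := by fun_prop
    exact Int.measurable_floor.comp h
  have hH : Measurable H := measurable_of_countable H
  rw [← lintegral_map hH hfl, lintegral_countable', ← ENNReal.tsum_mul_left]
  refine tsum_congr fun m => ?_
  rw [mul_comm]
  congr 1
  rw [Measure.map_apply hfl (measurableSet_singleton m)]
  have : (fun (y : ι → Fin n → ℝ) (i : ι) (c : Fin n) => ⌊T * y i c⌋) ⁻¹' {m} =
      Set.pi Set.univ fun i => Set.pi Set.univ fun c => Set.Ico (m i c / T : ℝ) ((m i c + 1) / T) := by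
    ext y
    simp only [Set.mem_preimage, Set.mem_singleton_iff, funext_iff, Set.mem_pi, Set.mem_univ,
      forall_true_left, Set.mem_Ico, Int.floor_eq_iff, div_le_iff₀ hT, lt_div_iff₀ hT, mul_comm T]
  rw [this, volume_pi_pi]
  simp only [volume_pi_pi, Real.volume_Ico]
  have h2 : ∀ i c, ((m i c : ℝ) + 1) / T - m i c / T = T⁻¹ := by
    intro i c; field_simp; ring
  simp only [h2, Finset.prod_const, Finset.card_univ, Fintype.card_fin]
  rw [← ENNReal.ofReal_pow (by positivity), ← ENNReal.ofReal_pow (by positivity)]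

lemma lintegral_affine {B : Matrix ι ι ℝ} (hB : B.det ≠ 0) (c : ι → ℝ) {h : (ι → ℝ) → ENNReal}
    (hh : Measurable h) :
    ∫⁻ w, h (c + B *ᵥ w) = ENNReal.ofReal |B.det|⁻¹ * ∫⁻ s, h s := by
  have hL : Measurable (toLin' B) := (LinearMap.continuous_of_finiteDimensional _).measurable
  have h1 := lintegral_map (μ := volume) (f := fun s => h (c + s)) (g := toLin' B)
    (hh.comp (measurable_const_add c)) hL
  simp only [toLin'_apply] at h1
  rw [← h1, Real.map_matrix_volume_pi_eq_smul_volume_pi hB, lintegral_smul_measure,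
    lintegral_add_left_eq_self, abs_inv, smul_eq_mul]

/-- Density arising from averaging `f` over shears along column `j`. -/
noncomputable def shearDensity (e : ι → Fin n) (j : Fin n) (f : (ι → Fin n → ℝ) → ℝ)
    (ψ : (ι → ℝ) → ℝ) (σ : ℝ) (Y : ι → Fin n → ℝ) (s : ι → ℝ) : ℝ :=
  |(colMat e Y).det|⁻¹ * (f (setCol j Y s) * ψ ((colMat e Y)⁻¹ *ᵥ (σ • s - fun i => Y i j)))

lemma continuous_setCol (j : Fin n) :
    Continuous fun p : (ι → Fin n → ℝ) × (ι → ℝ) => setCol j p.1 p.2 := by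
  refine continuous_pi fun i => ?_
  exact ((continuous_apply i).comp continuous_fst).update j ((continuous_apply i).comp continuous_snd)

lemma continuous_colMat (e : ι → Fin n) : Continuous fun Y : ι → Fin n → ℝ => colMat e Y := by
  refine continuous_matrix fun i k => ?_
  exact (continuous_apply (e k)).comp (continuous_apply i)

lemma colMat_setCol {e : ι → Fin n} {j : Fin n} (hj : ∀ k, e k ≠ j) (Y : ι → Fin n → ℝ)
    (s : ι → ℝ) : colMat e (setCol j Y s) = colMat e Y := by
  ext i k
  simp [colMat, setCol, hj k]

lemma lintegral_shear {e : ι → Fin n} {j : Fin n} (hj : ∀ k, e k ≠ j)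
    {f : (ι → Fin n → ℝ) → ℝ} {ψ : (ι → ℝ) → ℝ} (hf : Continuous f) (hψ : Continuous ψ)
    (hf0 : ∀ Y, (colMat e Y).det = 0 → f Y = 0) {τ : ℝ} (hτ : 0 < τ) (Y : ι → Fin n → ℝ) :
    ∫⁻ w, ENNReal.ofReal (ψ w * f (setCol j Y (τ • ((fun i => Y i j) + colMat e Y *ᵥ w)))) =
      ENNReal.ofReal (τ⁻¹ ^ Fintype.card ι) *
        ∫⁻ s, ENNReal.ofReal (shearDensity e j f ψ τ⁻¹ Y s) := by
  by_cases hd : (colMat e Y).det = 0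
  · have h1 : ∀ s, f (setCol j Y s) = 0 := fun s => hf0 _ (by rw [colMat_setCol hj, hd])
    simp [h1, shearDensity]
  set y : ι → ℝ := fun i => Y i j with hy
  have hB : (τ • colMat e Y).det ≠ 0 := by
    rw [det_smul]
    exact mul_ne_zero (pow_ne_zero _ hτ.ne') hd
  have hsm : Measurable fun s : ι → ℝ => f (setCol j Y s) * ψ ((colMat e Y)⁻¹ *ᵥ (τ⁻¹ • s - y)) := by
    refine Continuous.measurable (Continuous.mul ?_ ?_)
    · exact hf.comp ((continuous_setCol j).comp (continuous_const.prodMk continuous_id))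
    · refine hψ.comp (Continuous.matrix_mulVec continuous_const ?_)
      exact (continuous_id.const_smul τ⁻¹).sub continuous_const
  have key := lintegral_affine hB (τ • y) (ENNReal.measurable_ofReal.comp hsm)
  have h2 : ∀ w, f (setCol j Y (τ • y + (τ • colMat e Y) *ᵥ w)) *
      ψ ((colMat e Y)⁻¹ *ᵥ (τ⁻¹ • (τ • y + (τ • colMat e Y) *ᵥ w) - y)) =
      ψ w * f (setCol j Y (τ • (y + colMat e Y *ᵥ w))) := by
    intro w
    have hu : IsUnit (colMat e Y).det := isUnit_iff_ne_zero.mpr hd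
    rw [smul_mulVec, ← smul_add, smul_smul, inv_mul_cancel₀ hτ.ne', one_smul, add_sub_cancel_left,
      mulVec_mulVec, nonsing_inv_mul _ hu, one_mulVec, mul_comm]
  simp only [Function.comp_def, h2] at key
  rw [key]
  have h3 : ∀ s, ENNReal.ofReal (shearDensity e j f ψ τ⁻¹ Y s) = ENNReal.ofReal |(colMat e Y).det|⁻¹ *
      ENNReal.ofReal (f (setCol j Y s) * ψ ((colMat e Y)⁻¹ *ᵥ (τ⁻¹ • s - y))) := by
    intro s
    rw [shearDensity, ENNReal.ofReal_mul (by positivity)]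
  simp only [h3]
  rw [lintegral_const_mul _ hsm.ennreal_ofReal, ← mul_assoc, ← ENNReal.ofReal_mul (by positivity),
    det_smul, abs_mul, mul_inv, abs_pow, abs_of_pos hτ, inv_pow]

end ChangeOfVariables

section ShearDensity

variable {n : ℕ} {ι : Type*} [Fintype ι]

lemma exists_bound_shearDensity (e : ι → Fin n) (j : Fin n) (hj : ∀ k, e k ≠ j)
    {f : (ι → Fin n → ℝ) → ℝ} {ψ : (ι → ℝ) → ℝ} (hf : Continuous f) (hψ : Continuous ψ)
    {K : Set (ι → Fin n → ℝ)} (hK : IsCompact K) (hfK : ∀ Y, Y ∉ K → f Y = 0)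
    (hdK : ∀ Y ∈ K, (colMat e Y).det ≠ 0) (hψs : HasCompactSupport ψ) :
    ∃ R C : ℝ, ∀ σ ∈ Set.Icc (0 : ℝ) 1, ∀ Y s, shearDensity e j f ψ σ Y s ≤ C ∧
      (shearDensity e j f ψ σ Y s ≠ 0 → ‖Y‖ ≤ R ∧ ‖s‖ ≤ R) := by
  obtain ⟨Cf, hCf⟩ := hK.exists_bound_of_continuousOn hf.continuousOn
  obtain ⟨Cp, hCp⟩ := hψs.exists_bound_of_continuous hψ
  have hdet : Continuous fun Y : ι → Fin n → ℝ => (colMat e Y).det := (continuous_colMat e).matrix_det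
  obtain ⟨Cd, hCd⟩ := hK.exists_bound_of_continuousOn (f := fun Y => |(colMat e Y).det|⁻¹)
    (hdet.abs.continuousOn.inv₀ fun Y hY => abs_ne_zero.mpr (hdK Y hY))
  obtain ⟨R1, hR1⟩ := hK.exists_bound_of_continuousOn (f := id) continuousOn_id
  obtain ⟨R3, hR3⟩ := (hK.prod hψs).exists_bound_of_continuousOn
    (f := fun p : (ι → Fin n → ℝ) × (ι → ℝ) => colMat e p.1 *ᵥ p.2)
    (((continuous_colMat e).comp continuous_fst).matrix_mulVec continuous_snd).continuousOn
  refine ⟨|R1| + |R3|, |Cd| * (|Cf| * |Cp|), fun σ hσ Y s => ⟨?_, fun h => ?_⟩⟩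
  · by_cases hZ : setCol j Y s ∈ K
    · refine (le_abs_self _).trans ?_
      rw [shearDensity, abs_mul, abs_mul]
      have h1 := hCd _ hZ
      rw [colMat_setCol hj] at h1
      rw [Real.norm_eq_abs] at h1
      have h2 := hCf _ hZ
      rw [Real.norm_eq_abs] at h2
      have h3 := hCp ((colMat e Y)⁻¹ *ᵥ (σ • s - fun i => Y i j))
      rw [Real.norm_eq_abs] at h3
      exact mul_le_mul (h1.trans (le_abs_self _)) (mul_le_mul (h2.trans (le_abs_self _))
        (h3.trans (le_abs_self _)) (abs_nonneg _) (abs_nonneg _)) (by positivity) (abs_nonneg _)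
    · rw [shearDensity, hfK _ hZ]
      simp only [zero_mul, mul_zero]
      positivity
  · have hZ : setCol j Y s ∈ K := by
      by_contra hZ
      exact h (by rw [shearDensity, hfK _ hZ]; simp)
    have hd : (colMat e Y).det ≠ 0 := by
      have := hdK _ hZ
      rwa [colMat_setCol hj] at this
    set u := (colMat e Y)⁻¹ *ᵥ (σ • s - fun i => Y i j) with hu
    have hus : u ∈ tsupport ψ := by
      refine subset_tsupport _ ?_
      intro h0
      exact h (by rw [shearDensity, ← hu, h0]; simp)
    have hZn : ∀ i c, |setCol j Y s i c| ≤ |R1| := fun i c => by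
      have h1 := (norm_le_pi_norm (setCol j Y s i) c).trans
        ((norm_le_pi_norm (setCol j Y s) i).trans (hR1 _ hZ))
      exact (Real.norm_eq_abs _ ▸ h1).trans (le_abs_self _)
    have hsn : ∀ i, |s i| ≤ |R1| := fun i => by simpa [setCol] using hZn i j
    have hyu : ∀ i, Y i j = σ * s i - (colMat e Y *ᵥ u) i := by
      intro i
      rw [hu, mulVec_mulVec, mul_nonsing_inv _ (isUnit_iff_ne_zero.mpr hd), one_mulVec]
      simp
    have hcu : ∀ i, |(colMat e Y *ᵥ u) i| ≤ |R3| := fun i => by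
      have h1 := hR3 (setCol j Y s, u) ⟨hZ, hus⟩
      simp only [colMat_setCol hj] at h1
      exact (Real.norm_eq_abs _ ▸ (norm_le_pi_norm _ i).trans h1).trans (le_abs_self _)
    constructor
    · refine (pi_norm_le_iff_of_nonneg (by positivity)).mpr fun i =>
        (pi_norm_le_iff_of_nonneg (by positivity)).mpr fun c => ?_
      rw [Real.norm_eq_abs]
      by_cases hc : c = j
      · subst hc
        rw [hyu]
        refine (abs_sub _ _).trans (add_le_add ?_ (hcu i))
        rw [abs_mul, abs_of_nonneg hσ.1]
        exact (mul_le_of_le_one_left (abs_nonneg _) hσ.2).trans (hsn i)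
      · have := hZn i c
        simp only [setCol, Function.update_of_ne hc] at this
        linarith [abs_nonneg R3]
    · refine (pi_norm_le_iff_of_nonneg (by positivity)).mpr fun i => ?_
      rw [Real.norm_eq_abs]
      linarith [hsn i, abs_nonneg R3]

lemma continuous_shearDensity (e : ι → Fin n) (j : Fin n) (hj : ∀ k, e k ≠ j)
    {f : (ι → Fin n → ℝ) → ℝ} {ψ : (ι → ℝ) → ℝ} (hf : Continuous f) (hψ : Continuous ψ)
    {K : Set (ι → Fin n → ℝ)} (hK : IsCompact K) (hfK : ∀ Y, Y ∉ K → f Y = 0)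
    (hdK : ∀ Y ∈ K, (colMat e Y).det ≠ 0) :
    Continuous fun p : ℝ × (ι → Fin n → ℝ) × (ι → ℝ) => shearDensity e j f ψ p.1 p.2.1 p.2.2 := by
  have hset : Continuous fun p : ℝ × (ι → Fin n → ℝ) × (ι → ℝ) => setCol j p.2.1 p.2.2 :=
    (continuous_setCol j).comp continuous_snd
  have hcol : Continuous fun p : ℝ × (ι → Fin n → ℝ) × (ι → ℝ) => colMat e p.2.1 :=
    (continuous_colMat e).comp (continuous_fst.comp continuous_snd)
  have hdet := hcol.matrix_det
  refine continuous_iff_continuousAt.mpr fun p => ?_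
  by_cases hZ : setCol j p.2.1 p.2.2 ∈ K
  · have hd : (colMat e p.2.1).det ≠ 0 := by
      have := hdK _ hZ
      rwa [colMat_setCol hj] at this
    have hinv : ContinuousAt (fun p : ℝ × (ι → Fin n → ℝ) × (ι → ℝ) => (colMat e p.2.1)⁻¹) p := by
      simp only [Matrix.inv_def, Ring.inverse_eq_inv']
      exact (hdet.continuousAt.inv₀ hd).smul hcol.matrix_adjugate.continuousAt
    refine (hdet.abs.continuousAt.inv₀ (abs_ne_zero.mpr hd)).mul
      ((hf.comp hset).continuousAt.mul (hψ.continuousAt.comp ?_))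
    have hv : Continuous fun p : ℝ × (ι → Fin n → ℝ) × (ι → ℝ) =>
        (p.1 • p.2.2 - fun i => p.2.1 i j) := by fun_prop
    have hmv : Continuous fun q : Matrix ι ι ℝ × (ι → ℝ) => q.1 *ᵥ q.2 :=
      continuous_fst.matrix_mulVec continuous_snd
    exact hmv.continuousAt.comp (hinv.prodMk hv.continuousAt)
  · have h0 : ∀ᶠ q in nhds p, shearDensity e j f ψ q.1 q.2.1 q.2.2 = 0 := by
      have := hset.continuousAt.eventually (hK.isClosed.isOpen_compl.mem_nhds hZ)
      filter_upwards [this] with q hq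
      rw [shearDensity, hfK _ hq]
      simp
    exact (continuousAt_congr (g := fun _ => (0 : ℝ)) h0).mpr continuousAt_const

instance isAddHaarMeasure_volume_tuple :
    (volume : Measure (ι → Fin n → ℝ)).IsAddHaarMeasure :=
  Measure.pi.isAddHaarMeasure (fun _ : ι => (volume : Measure (Fin n → ℝ)))

/-- Exchange column `j` with a separate vector. -/
def swapCol (ι : Type*) (j : Fin n) : ((ι → Fin n → ℝ) × (ι → ℝ)) →ₗ[ℝ] ((ι → Fin n → ℝ) × (ι → ℝ)) where
  toFun p := (setCol j p.1 p.2, fun i => p.1 i j)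
  map_add' p q := by
    refine Prod.ext ?_ rfl
    ext i c
    by_cases hc : c = j
    · subst hc; simp [setCol]
    · simp [setCol, hc]
  map_smul' r p := by
    refine Prod.ext ?_ rfl
    ext i c
    by_cases hc : c = j
    · subst hc; simp [setCol]
    · simp [setCol, hc]

lemma swapCol_swapCol (j : Fin n) : swapCol ι j ∘ₗ swapCol ι j = LinearMap.id := by
  refine LinearMap.ext fun p => Prod.ext ?_ ?_
  · ext i c
    by_cases hc : c = j
    · subst hc; simp [swapCol, setCol]
    · simp [swapCol, setCol, hc]
  · ext i
    simp [swapCol, setCol]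

lemma measurePreserving_swapCol (j : Fin n) :
    MeasurePreserving (swapCol ι j) ((volume : Measure (ι → Fin n → ℝ)).prod (volume : Measure (ι → ℝ)))
      ((volume : Measure (ι → Fin n → ℝ)).prod (volume : Measure (ι → ℝ))) := by
  have hd : LinearMap.det (swapCol ι j) * LinearMap.det (swapCol ι j) = 1 := by
    rw [← LinearMap.det_comp, swapCol_swapCol, LinearMap.det_id]
  refine ⟨(LinearMap.continuous_of_finiteDimensional _).measurable, ?_⟩
  have : (((volume : Measure (ι → Fin n → ℝ)).prod (volume : Measure (ι → ℝ)))).IsAddHaarMeasure :=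
    Measure.prod.instIsAddHaarMeasure _ _
  rw [Measure.map_linearMap_addHaar_eq_smul_addHaar _ (left_ne_zero_of_mul_eq_one hd)]
  have : |(LinearMap.det (swapCol ι j))⁻¹| = 1 := by
    rw [abs_inv]
    have := congrArg abs hd
    rw [abs_mul, abs_one, ← sq] at this
    rw [(pow_eq_one_iff_of_nonneg (abs_nonneg _) two_ne_zero).mp this, inv_one]
  rw [this, ENNReal.ofReal_one, one_smul]

lemma lintegral_shearDensity_zero (e : ι → Fin n) (j : Fin n) (hj : ∀ k, e k ≠ j)
    {f : (ι → Fin n → ℝ) → ℝ} {ψ : (ι → ℝ) → ℝ} (hf : Continuous f) (hψ : Continuous ψ)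
    {K : Set (ι → Fin n → ℝ)} (hK : IsCompact K) (hfK : ∀ Y, Y ∉ K → f Y = 0)
    (hdK : ∀ Y ∈ K, (colMat e Y).det ≠ 0) (hf0 : ∀ Y, 0 ≤ f Y)
    (hψ1 : ∫⁻ w, ENNReal.ofReal (ψ w) = 1) :
    ∫⁻ Y, ∫⁻ s, ENNReal.ofReal (shearDensity e j f ψ 0 Y s) = ∫⁻ Y, ENNReal.ofReal (f Y) := by
  have hc := (continuous_shearDensity e j hj hf hψ hK hfK hdK).comp
    (continuous_const (y := (0 : ℝ)) |>.prodMk continuous_id)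
  have hm : Measurable fun p : (ι → Fin n → ℝ) × (ι → ℝ) =>
      ENNReal.ofReal (shearDensity e j f ψ 0 p.1 p.2) := hc.measurable.ennreal_ofReal
  have hsw := (measurePreserving_swapCol (ι := ι) j).lintegral_comp hm
  rw [← lintegral_prod _ hm.aemeasurable, ← hsw,
    lintegral_prod (fun a => ENNReal.ofReal (shearDensity e j f ψ 0 (swapCol ι j a).1
      (swapCol ι j a).2)) (hm.comp (measurePreserving_swapCol j).measurable).aemeasurable]
  refine lintegral_congr fun Y => ?_
  have h1 : ∀ t, shearDensity e j f ψ 0 (swapCol ι j (Y, t)).1 (swapCol ι j (Y, t)).2 =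
      f Y * (|(colMat e Y).det|⁻¹ * ψ (0 + (-(colMat e Y)⁻¹) *ᵥ t)) := by
    intro t
    have ha : setCol j (setCol j Y t) (fun i => Y i j) = Y := by
      ext i c
      by_cases hc : c = j
      · subst hc; simp [setCol]
      · simp [setCol, hc]
    have hb : (fun i => setCol j Y t i j) = t := by ext i; simp [setCol]
    simp only [swapCol, LinearMap.coe_mk, AddHom.coe_mk, shearDensity, ha, colMat_setCol hj, hb,
      zero_smul, zero_sub, mulVec_neg, neg_mulVec, zero_add]
    ring
  simp only [h1]
  by_cases hd : (colMat e Y).det = 0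
  · have : f Y = 0 := hfK Y fun hY => hdK Y hY hd
    simp [this]
  have hB : (-(colMat e Y)⁻¹).det ≠ 0 := by
    rw [det_neg, det_nonsing_inv, Ring.inverse_eq_inv']
    exact mul_ne_zero (pow_ne_zero _ (by norm_num)) (inv_ne_zero hd)
  have hBd : |(-(colMat e Y)⁻¹).det| = |(colMat e Y).det|⁻¹ := by
    rw [det_neg, det_nonsing_inv, Ring.inverse_eq_inv', abs_mul, abs_pow, abs_neg, abs_one,
      one_pow, one_mul, abs_inv]
  have key := lintegral_affine hB 0 hψ.measurable.ennreal_ofReal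
  simp only [ENNReal.ofReal_mul (hf0 Y), ENNReal.ofReal_mul (inv_nonneg.mpr (abs_nonneg _))]
  have hmψ : Measurable fun t => ENNReal.ofReal (ψ (0 + (-(colMat e Y)⁻¹) *ᵥ t)) :=
    (hψ.comp (continuous_const.add (continuous_const.matrix_mulVec
      continuous_id))).measurable.ennreal_ofReal
  rw [lintegral_const_mul _ (hmψ.const_mul _), lintegral_const_mul _ hmψ, key, hψ1, hBd, inv_inv,
    mul_one, ← ENNReal.ofReal_mul (by positivity), inv_mul_cancel₀ (abs_ne_zero.mpr hd),
    ENNReal.ofReal_one, mul_one]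

end ShearDensity

section Averages

variable {n : ℕ} {ι : Type*} [Fintype ι]

/-- The sum of a function over the integral tuples, transported by `g`. -/
noncomputable def tupSum (f : (ι → Fin n → ℝ) → ENNReal) (g : SLR n) : ENNReal :=
  ∑' m : ι → Fin n → ℤ, f (ract (castZ m) g)

lemma measurable_ract (X : ι → Fin n → ℝ) : Measurable fun g : SLR n => ract X g := by
  refine measurable_pi_iff.mpr fun i => measurable_pi_iff.mpr fun c => ?_
  simp only [ract, vecMul, dotProduct]
  exact Finset.measurable_sum _ fun k _ => (measurable_SLR_entry k c).const_mul _

lemma measurable_tupSum {f : (ι → Fin n → ℝ) → ENNReal} (hf : Measurable f) :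
    Measurable (tupSum f) :=
  Measurable.tsum fun m => hf.comp (measurable_ract _)

lemma continuous_ract (g : SLR n) : Continuous fun X : ι → Fin n → ℝ => ract X g := by
  refine continuous_pi fun i => ?_
  exact (continuous_apply i).matrix_vecMul continuous_const

lemma ract_one (X : ι → Fin n → ℝ) : ract X (1 : SLR n) = X := by
  ext1 i
  simp only [ract, toMat_one, vecMul_one]

lemma ract_smul (r : ℝ) (X : ι → Fin n → ℝ) (g : SLR n) : ract (r • X) g = r • ract X g := by
  ext1 i
  simp only [ract, Pi.smul_apply, smul_vecMul]

/-- The matrix of an element of `SL_n(ℤ)`. -/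
def intMat (z : Matrix.SpecialLinearGroup (Fin n) ℤ) : Matrix (Fin n) (Fin n) ℤ := z

lemma intMat_mul (z z' : Matrix.SpecialLinearGroup (Fin n) ℤ) :
    intMat (z * z') = intMat z * intMat z' := Matrix.SpecialLinearGroup.coe_mul z z'

lemma intMat_one : intMat (1 : Matrix.SpecialLinearGroup (Fin n) ℤ) = 1 :=
  Matrix.SpecialLinearGroup.coe_one

lemma tupSum_mul_left (f : (ι → Fin n → ℝ) → ENNReal) {γ : SLR n} (hγ : γ ∈ SLZ n) (g : SLR n) :
    tupSum f (γ * g) = tupSum f g := by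
  obtain ⟨z, rfl⟩ := hγ
  have hmap : ∀ (z : Matrix.SpecialLinearGroup (Fin n) ℤ) (m : ι → Fin n → ℤ),
      ract (castZ m) (Matrix.SpecialLinearGroup.map (Int.castRingHom ℝ) z) =
        castZ (fun i => vecMul (m i) (intMat z)) := by
    intro z m
    ext i c
    simp only [ract, castZ, vecMul, dotProduct, Int.cast_sum, Int.cast_mul]
    rfl
  let E : (ι → Fin n → ℤ) ≃ (ι → Fin n → ℤ) :=
    { toFun := fun m i => vecMul (m i) (intMat z)
      invFun := fun m i => vecMul (m i) (intMat z⁻¹)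
      left_inv := fun m => by
        ext1 i
        simp only [vecMul_vecMul, ← intMat_mul, mul_inv_cancel, intMat_one, vecMul_one]
      right_inv := fun m => by
        ext1 i
        simp only [vecMul_vecMul, ← intMat_mul, inv_mul_cancel, intMat_one, vecMul_one] }
  rw [tupSum, tupSum, ← E.tsum_eq fun m => f (ract (castZ m) g)]
  refine tsum_congr fun m => ?_
  rw [← ract_ract, hmap z m]
  rfl

lemma measurePreserving_ract (g : SLR n) :
    MeasurePreserving (fun X : ι → Fin n → ℝ => ract X g) volume volume := by
  refine measurePreserving_pi (fun _ : ι => (volume : Measure (Fin n → ℝ))) (fun _ => volume)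
    (f := fun _ x => vecMul x (toMat g)) fun i => ?_
  have hd : (toMat g)ᵀ.det = 1 := by rw [det_transpose, det_toMat]
  have h := Real.map_matrix_volume_pi_eq_smul_volume_pi (M := (toMat g)ᵀ) (by rw [hd]; exact one_ne_zero)
  rw [hd, inv_one, abs_one, ENNReal.ofReal_one, one_smul] at h
  have hfun : (fun x => vecMul x (toMat g)) = ⇑(toLin' (toMat g)ᵀ) := by
    ext1 x
    rw [toLin'_apply, mulVec_transpose]
  rw [hfun]
  exact ⟨(LinearMap.continuous_of_finiteDimensional _).measurable, h⟩

variable {e : ι → Fin n} {j : Fin n}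

/-- The average of `tupSum f` over shears. -/
noncomputable def shearAvg (hj : ∀ k, e k ≠ j)
    (f : (ι → Fin n → ℝ) → ℝ) (ψ : (ι → ℝ) → ℝ) {T : ℕ} (hT : 0 < T)
    (g : SLR n) : ENNReal :=
  ∫⁻ w, ENNReal.ofReal (ψ w) * tupSum (fun X => ENNReal.ofReal (f X)) (g * shear hj hT w)

lemma measurable_roundDensity
    (hj : ∀ k, e k ≠ j)
    {f : (ι → Fin n → ℝ) → ℝ} {ψ : (ι → ℝ) → ℝ} (hf : Continuous f) (hψ : Continuous ψ)
    {K : Set (ι → Fin n → ℝ)} (hK : IsCompact K) (hfK : ∀ Y, Y ∉ K → f Y = 0)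
    (hdK : ∀ Y ∈ K, (colMat e Y).det ≠ 0)
    (T : ℝ) (g : SLR n) (σ : ℝ) :
    Measurable fun p : (ι → Fin n → ℝ) × (ι → ℝ) => ENNReal.ofReal (shearDensity e j f ψ σ
      (ract (T⁻¹ • castZ fun i c => ⌊T * p.1 i c⌋) g) p.2) := by
  have hsd := (continuous_shearDensity e j hj hf hψ hK hfK hdK).measurable
  have h0 : Measurable fun p : (ι → Fin n → ℝ) × (ι → ℝ) =>
      (T⁻¹ • castZ fun i c => ⌊T * p.1 i c⌋ : ι → Fin n → ℝ) := by
    refine measurable_pi_iff.mpr fun i => measurable_pi_iff.mpr fun c => ?_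
    have h : Measurable fun p : (ι → Fin n → ℝ) × (ι → ℝ) => T * p.1 i c := by fun_prop
    exact ((measurable_of_countable (fun z : ℤ => (z : ℝ))).comp
      (Int.measurable_floor.comp h)).const_mul T⁻¹
  exact (hsd.comp (measurable_const.prodMk
    (((continuous_ract g).measurable.comp h0).prodMk measurable_snd))).ennreal_ofReal

lemma shearAvg_eq
    (hj : ∀ k, e k ≠ j)
    {f : (ι → Fin n → ℝ) → ℝ} {ψ : (ι → ℝ) → ℝ} (hf : Continuous f) (hψ : Continuous ψ)
    {K : Set (ι → Fin n → ℝ)} (hK : IsCompact K) (hfK : ∀ Y, Y ∉ K → f Y = 0)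
    (hdK : ∀ Y ∈ K, (colMat e Y).det ≠ 0)
    (hψ0 : ∀ w, 0 ≤ ψ w) {T : ℕ} (hT : 0 < T) (g : SLR n) :
    shearAvg hj f ψ hT g = ∫⁻ p : (ι → Fin n → ℝ) × (ι → ℝ),
      ENNReal.ofReal (shearDensity e j f ψ ((T : ℝ) ^ n)⁻¹
        (ract ((T : ℝ)⁻¹ • castZ fun i c => ⌊(T : ℝ) * p.1 i c⌋) g) p.2)
        ∂(volume.prod volume) := by
  have hT' : (0 : ℝ) < T := by exact_mod_cast hT
  have hn : (T : ℝ) ^ n = T ^ (n - 1) * T := by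
    rw [← pow_succ]
    congr 1
    have := j.pos
    omega
  rw [lintegral_prod _ (measurable_roundDensity hj hf hψ hK hfK hdK T g _).aemeasurable]
  have h1 := lintegral_floor (ι := ι) (n := n) hT' (fun m => ∫⁻ s, ENNReal.ofReal
    (shearDensity e j f ψ ((T : ℝ) ^ n)⁻¹ (ract ((T : ℝ)⁻¹ • castZ m) g) s))
  rw [h1, shearAvg]
  simp only [tupSum, ← ENNReal.tsum_mul_left]
  have hmw : ∀ m : ι → Fin n → ℤ, Measurable fun w =>
      ENNReal.ofReal (f (ract (castZ m) (g * shear hj hT w))) := fun m =>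
    (hf.measurable.comp ((measurable_ract _).comp
      (measurable_SLR_mul measurable_const (measurable_shear hj hT)))).ennreal_ofReal
  rw [lintegral_tsum (f := fun m w => ENNReal.ofReal (ψ w) *
    ENNReal.ofReal (f (ract (castZ m) (g * shear hj hT w)))) fun m => (hψ.measurable.ennreal_ofReal.mul (hmw m)).aemeasurable]
  refine tsum_congr fun m => ?_
  have h2 := lintegral_shear hj hf hψ (fun Y h => hfK Y fun hY => hdK Y hY h)
    (pow_pos hT' n) (ract ((T : ℝ)⁻¹ • castZ m) g)
  rw [← inv_pow] at h2 ⊢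
  rw [← h2]
  refine lintegral_congr fun w => ?_
  rw [← ENNReal.ofReal_mul (hψ0 w), ← ract_ract, ract_shear, ract_smul]
  congr 4
  have h3 : colMat e ((T : ℝ)⁻¹ • ract (castZ m) g) = (T : ℝ)⁻¹ • colMat e (ract (castZ m) g) := rfl
  have h4 : (fun i => ((T : ℝ)⁻¹ • ract (castZ m) g) i j) =
    (T : ℝ)⁻¹ • fun i => ract (castZ m) g i j := rfl
  rw [h3, h4, smul_mulVec, ← smul_add, smul_smul, hn, mul_assoc, mul_inv_cancel₀ hT'.ne', mul_one]

lemma abs_sub_floor_le {T : ℕ} (hT : 0 < T) (x : ℝ) : |(T : ℝ)⁻¹ * ⌊(T : ℝ) * x⌋ - x| ≤ (T : ℝ)⁻¹ := by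
  have hT' : (0 : ℝ) < T := by exact_mod_cast hT
  have h1 := Int.floor_le ((T : ℝ) * x)
  have h2 := Int.lt_floor_add_one ((T : ℝ) * x)
  have h3 : (T : ℝ)⁻¹ * ⌊(T : ℝ) * x⌋ - x = (T : ℝ)⁻¹ * (⌊(T : ℝ) * x⌋ - T * x) := by
    field_simp
  rw [h3, abs_mul, abs_of_pos (inv_pos.mpr hT')]
  refine mul_le_of_le_one_right (inv_pos.mpr hT').le ?_
  rw [abs_le]
  constructor <;> linarith

lemma tendsto_shearAvg
    (hj : ∀ k, e k ≠ j)
    {f : (ι → Fin n → ℝ) → ℝ} {ψ : (ι → ℝ) → ℝ} (hf : Continuous f) (hψ : Continuous ψ)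
    {K : Set (ι → Fin n → ℝ)} (hK : IsCompact K) (hfK : ∀ Y, Y ∉ K → f Y = 0)
    (hdK : ∀ Y ∈ K, (colMat e Y).det ≠ 0)
    (hf0 : ∀ Y, 0 ≤ f Y) (hψ0 : ∀ w, 0 ≤ ψ w)
    (hψs : HasCompactSupport ψ) (hψ1 : ∫⁻ w, ENNReal.ofReal (ψ w) = 1) (g : SLR n) :
    Filter.Tendsto (fun T : ℕ => shearAvg hj f ψ T.succ_pos g) Filter.atTop
      (nhds (∫⁻ Y, ENNReal.ofReal (f Y))) := by
  have hcont := continuous_shearDensity e j hj hf hψ hK hfK hdK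
  have hlim : ∫⁻ p : (ι → Fin n → ℝ) × (ι → ℝ), ENNReal.ofReal
      (shearDensity e j f ψ 0 (ract p.1 g) p.2) ∂(volume.prod volume) =
      ∫⁻ Y, ENNReal.ofReal (f Y) := by
    have hm : Measurable fun p : (ι → Fin n → ℝ) × (ι → ℝ) =>
        ENNReal.ofReal (shearDensity e j f ψ 0 p.1 p.2) :=
      (hcont.comp (continuous_const (y := (0 : ℝ)) |>.prodMk continuous_id)).measurable.ennreal_ofReal
    rw [← lintegral_shearDensity_zero e j hj hf hψ hK hfK hdK hf0 hψ1,
      ← (measurePreserving_ract g).lintegral_comp hm.lintegral_prod_right', lintegral_prod]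
    exact (hm.comp (((continuous_ract g).measurable.comp measurable_fst).prodMk
      measurable_snd)).aemeasurable
  rw [← hlim]
  simp only [shearAvg_eq hj hf hψ hK hfK hdK hψ0]
  obtain ⟨R, C, hRC⟩ := exists_bound_shearDensity e j hj hf hψ hK hfK hdK hψs
  obtain ⟨R', hR'⟩ : ∃ R', ∀ Z : ι → Fin n → ℝ, ‖ract Z g‖ ≤ R → ‖Z‖ ≤ R' := by
    obtain ⟨R', hR'⟩ := (isCompact_closedBall (0 : ι → Fin n → ℝ) R).exists_bound_of_continuousOn
      (f := fun X => ract X g⁻¹) (continuous_ract _).continuousOn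
    refine ⟨R', fun Z hZ => ?_⟩
    have := hR' (ract Z g) (by simpa using hZ)
    rwa [ract_ract, mul_inv_cancel, ract_one] at this
  have hfl : ∀ (T : ℕ) (y : ι → Fin n → ℝ),
      ‖((T + 1 : ℕ) : ℝ)⁻¹ • castZ (fun i c => ⌊((T + 1 : ℕ) : ℝ) * y i c⌋) - y‖ ≤
        ((T + 1 : ℕ) : ℝ)⁻¹ := by
    intro T y
    refine (pi_norm_le_iff_of_nonneg (by positivity)).mpr fun i =>
        (pi_norm_le_iff_of_nonneg (by positivity)).mpr fun c => ?_
    exact abs_sub_floor_le T.succ_pos (y i c)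
  have hone : ∀ T : ℕ, ((T + 1 : ℕ) : ℝ)⁻¹ ≤ 1 := fun T =>
    inv_le_one_of_one_le₀ (by push_cast; linarith [(Nat.cast_nonneg T : (0 : ℝ) ≤ T)])
  have hten : Filter.Tendsto (fun T : ℕ => ((T + 1 : ℕ) : ℝ)⁻¹) Filter.atTop (nhds 0) := by
    have := tendsto_one_div_add_atTop_nhds_zero_nat (𝕜 := ℝ)
    simpa using this
  refine tendsto_lintegral_of_dominated_convergence
    ((Metric.closedBall (0 : ι → Fin n → ℝ) (R' + 1) ×ˢ Metric.closedBall (0 : ι → ℝ) R).indicator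
      fun _ => ENNReal.ofReal C) ?_ ?_ ?_ ?_
  · exact fun T => measurable_roundDensity hj hf hψ hK hfK hdK _ g _
  · refine fun T => Filter.Eventually.of_forall fun p => ?_
    have hσ : (((T + 1 : ℕ) : ℝ) ^ n)⁻¹ ∈ Set.Icc (0 : ℝ) 1 :=
      ⟨by positivity, by rw [← inv_pow]; exact pow_le_one₀ (by positivity) (hone T)⟩
    obtain ⟨h1, h2⟩ := hRC _ hσ
      (ract (((T + 1 : ℕ) : ℝ)⁻¹ • castZ fun i c => ⌊((T + 1 : ℕ) : ℝ) * p.1 i c⌋) g) p.2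
    by_cases h0 : shearDensity e j f ψ (((T + 1 : ℕ) : ℝ) ^ n)⁻¹
      (ract (((T + 1 : ℕ) : ℝ)⁻¹ • castZ fun i c => ⌊((T + 1 : ℕ) : ℝ) * p.1 i c⌋) g) p.2 = 0
    · simp only [Nat.succ_eq_add_one, h0, ENNReal.ofReal_zero]
      exact zero_le
    · obtain ⟨h3, h4⟩ := h2 h0
      rw [Set.indicator_of_mem]
      · exact ENNReal.ofReal_le_ofReal h1
      · refine ⟨?_, by simpa using h4⟩
        have h5 := hR' _ h3
        rw [mem_closedBall_zero_iff]
        have h6 := (hfl T p.1).trans (hone T)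
        have h7 := norm_sub_norm_le p.1
          (((T + 1 : ℕ) : ℝ)⁻¹ • castZ fun i c => ⌊((T + 1 : ℕ) : ℝ) * p.1 i c⌋)
        rw [norm_sub_rev] at h6
        linarith
  · rw [lintegral_indicator (measurableSet_closedBall.prod measurableSet_closedBall),
      setLIntegral_const, Measure.prod_prod]
    exact ENNReal.mul_ne_top ENNReal.ofReal_ne_top
      (ENNReal.mul_ne_top measure_closedBall_lt_top.ne measure_closedBall_lt_top.ne)
  · refine Filter.Eventually.of_forall fun p => ?_
    refine (ENNReal.continuous_ofReal.tendsto _).comp ?_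
    have hc := hcont.tendsto (0, ract p.1 g, p.2)
    refine Filter.Tendsto.comp (f := fun T : ℕ => ((((T + 1 : ℕ) : ℝ) ^ n)⁻¹,
      ract (((T + 1 : ℕ) : ℝ)⁻¹ • castZ fun i c => ⌊((T + 1 : ℕ) : ℝ) * p.1 i c⌋) g, p.2)) hc ?_
    refine Filter.Tendsto.prodMk_nhds ?_ (Filter.Tendsto.prodMk_nhds ?_ tendsto_const_nhds)
    · have h1 : Filter.Tendsto (fun T : ℕ => (((T + 1 : ℕ) : ℝ)⁻¹) ^ n) Filter.atTop (nhds 0) := by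
        have := hten.pow n
        rwa [zero_pow (by have := j.pos; omega)] at this
      simpa only [inv_pow] using h1
    · refine ((continuous_ract g).tendsto p.1).comp ?_
      rw [tendsto_iff_norm_sub_tendsto_zero]
      exact squeeze_zero (fun _ => norm_nonneg _) (fun T => hfl T p.1) hten

end Averages

section MeanValue

variable {n : ℕ} {ι : Type*} [Fintype ι]

lemma exists_mollifier (ι : Type*) [Fintype ι] : ∃ ψ : (ι → ℝ) → ℝ, Continuous ψ ∧ (∀ w, 0 ≤ ψ w) ∧
    HasCompactSupport ψ ∧ ∫⁻ w, ENNReal.ofReal (ψ w) = 1 := by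
  let b : ContDiffBump (0 : ι → ℝ) := ⟨1, 2, one_pos, one_lt_two⟩
  refine ⟨b.normed volume, b.continuous_normed, b.nonneg_normed, b.hasCompactSupport_normed, ?_⟩
  rw [← ofReal_integral_eq_lintegral_ofReal b.integrable_normed
    (Filter.Eventually.of_forall b.nonneg_normed), b.integral_normed, ENNReal.ofReal_one]

lemma lintegral_tupSum_of_isCompact {P : Measure (SLR n)} (hP : IsLatticeLift P)
    {e : ι → Fin n} {j : Fin n} (hj : ∀ k, e k ≠ j)
    {f : (ι → Fin n → ℝ) → ℝ} (hf : Continuous f)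
    {K : Set (ι → Fin n → ℝ)} (hK : IsCompact K) (hfK : ∀ Y, Y ∉ K → f Y = 0)
    (hdK : ∀ Y ∈ K, (colMat e Y).det ≠ 0) (hf0 : ∀ Y, 0 ≤ f Y) :
    ∫⁻ g, tupSum (fun X => ENNReal.ofReal (f X)) g ∂P = ∫⁻ Y, ENNReal.ofReal (f Y) := by
  have := hP.prob
  obtain ⟨ψ, hψ, hψ0, hψs, hψ1⟩ := exists_mollifier ι
  set F := tupSum (n := n) (fun X => ENNReal.ofReal (f X)) with hF
  have hFm : Measurable F := measurable_tupSum hf.measurable.ennreal_ofReal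
  have hlim := fun g => tendsto_shearAvg hj hf hψ hK hfK hdK hf0 hψ0 hψs hψ1 g
  have hmul : ∀ T : ℕ, Measurable fun p : SLR n × (ι → ℝ) => p.1 * shear hj T.succ_pos p.2 :=
    fun T => measurable_SLR_mul measurable_fst ((measurable_shear hj T.succ_pos).comp measurable_snd)
  have hψm : Measurable fun p : SLR n × (ι → ℝ) => ENNReal.ofReal (ψ p.2) :=
    (hψ.measurable.comp measurable_snd).ennreal_ofReal
  have hum : ∀ T : ℕ, Measurable (shearAvg hj f ψ T.succ_pos) := fun T =>
    (hψm.mul (hFm.comp (hmul T))).lintegral_prod_right'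
  have hswap : ∀ (T : ℕ) (G : SLR n → ENNReal), Measurable G →
      (∀ γ ∈ SLZ n, ∀ g, G (γ * g) = G g) →
      ∫⁻ g, (∫⁻ w : ι → ℝ, ENNReal.ofReal (ψ w) * G (g * shear hj T.succ_pos w)) ∂P = ∫⁻ g, G g ∂P := by
    intro T G hG hGinv
    rw [lintegral_lintegral_swap (hψm.mul (hG.comp (hmul T))).aemeasurable]
    have h1 : ∀ w, ∫⁻ g, ENNReal.ofReal (ψ w) * G (g * shear hj T.succ_pos w) ∂P =
        ENNReal.ofReal (ψ w) * ∫⁻ g, G g ∂P := by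
      intro w
      rw [lintegral_const_mul (f := fun g => G (g * shear hj T.succ_pos w)) _ (hG.comp (measurable_SLR_mul measurable_id measurable_const)),
        hP.lintegral_mul_right G hG hGinv]
    simp only [h1]
    rw [lintegral_mul_const _ hψ.measurable.ennreal_ofReal, hψ1, one_mul]
  have hFinv : ∀ γ ∈ SLZ n, ∀ g, F (γ * g) = F g := fun γ hγ g => tupSum_mul_left _ hγ g
  refine le_antisymm ?_ ?_
  · have hM : ∀ M : ℕ, ∫⁻ g, min (F g) M ∂P ≤ ∫⁻ Y, ENNReal.ofReal (f Y) := by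
      intro M
      have hten : Filter.Tendsto (fun T : ℕ => ∫⁻ g, min (shearAvg hj f ψ T.succ_pos g) M ∂P)
          Filter.atTop (nhds (∫⁻ _, min (∫⁻ Y, ENNReal.ofReal (f Y)) M ∂P)) := by
        refine tendsto_lintegral_of_dominated_convergence (fun _ => (M : ENNReal))
          (fun T => (hum T).min measurable_const)
          (fun T => Filter.Eventually.of_forall fun g => min_le_right _ _) ?_
          (Filter.Eventually.of_forall fun g => (hlim g).min tendsto_const_nhds)
        simp
      have hle : ∀ T : ℕ, ∫⁻ g, min (F g) M ∂P ≤
          ∫⁻ g, min (shearAvg hj f ψ T.succ_pos g) M ∂P := by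
        intro T
        rw [← hswap T (fun g => min (F g) M) (hFm.min measurable_const)
          (fun γ hγ g => by rw [hFinv γ hγ g])]
        refine lintegral_mono fun g => le_min ?_ ?_
        · exact lintegral_mono fun w => mul_le_mul_right (min_le_left _ _) _
        · calc _ ≤ ∫⁻ w, ENNReal.ofReal (ψ w) * M :=
                lintegral_mono fun w => mul_le_mul_right (min_le_right _ _) _
            _ = M := by rw [lintegral_mul_const _ hψ.measurable.ennreal_ofReal, hψ1, one_mul]
      have := ge_of_tendsto' hten hle
      rw [lintegral_const, measure_univ, mul_one] at this
      exact this.trans (min_le_left _ _)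
    have hlimF : ∀ g, Filter.liminf (fun M : ℕ => min (F g) (M : ENNReal)) Filter.atTop = F g := by
      intro g
      have : Filter.Tendsto (fun M : ℕ => min (F g) (M : ENNReal)) Filter.atTop
          (nhds (min (F g) ⊤)) := tendsto_const_nhds.min ENNReal.tendsto_nat_nhds_top
      rw [min_top_right] at this
      exact this.liminf_eq
    calc ∫⁻ g, F g ∂P = ∫⁻ g, Filter.liminf (fun M : ℕ => min (F g) (M : ENNReal)) Filter.atTop ∂P := by
          simp only [hlimF]
      _ ≤ Filter.liminf (fun M : ℕ => ∫⁻ g, min (F g) (M : ENNReal) ∂P) Filter.atTop :=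
          lintegral_liminf_le fun M => hFm.min measurable_const
      _ ≤ Filter.liminf (fun _ : ℕ => ∫⁻ Y, ENNReal.ofReal (f Y)) Filter.atTop :=
          Filter.liminf_le_liminf (Filter.Eventually.of_forall hM)
      _ = _ := by simp
  · calc ∫⁻ Y, ENNReal.ofReal (f Y) = ∫⁻ g, Filter.liminf
          (fun T : ℕ => shearAvg hj f ψ T.succ_pos g) Filter.atTop ∂P := by
          simp only [fun g => (hlim g).liminf_eq]
          rw [lintegral_const, measure_univ, mul_one]
      _ ≤ Filter.liminf (fun T : ℕ => ∫⁻ g, shearAvg hj f ψ T.succ_pos g ∂P) Filter.atTop :=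
          lintegral_liminf_le hum
      _ = _ := by
          have : ∀ T : ℕ, ∫⁻ g, shearAvg hj f ψ T.succ_pos g ∂P = ∫⁻ g, F g ∂P :=
            fun T => hswap T F hFm hFinv
          simp only [this]
          simp

/-- The sum over integral tuples of the laws of the transported tuples. -/
noncomputable def tupMeasure (ι : Type*) (P : Measure (SLR n)) : Measure (ι → Fin n → ℝ) :=
  Measure.sum fun m : ι → Fin n → ℤ => P.map fun g => ract (castZ m) g

lemma lintegral_tupMeasure (P : Measure (SLR n)) {f : (ι → Fin n → ℝ) → ENNReal}
    (hf : Measurable f) : ∫⁻ X, f X ∂(tupMeasure ι P) = ∫⁻ g, tupSum f g ∂P := by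
  rw [tupMeasure, lintegral_sum_measure]
  simp only [tupSum]
  rw [lintegral_tsum (f := fun (m : ι → Fin n → ℤ) (g : SLR n) => f (ract (castZ m) g)) fun m => (hf.comp (measurable_ract _)).aemeasurable]
  exact tsum_congr fun m => lintegral_map hf (measurable_ract _)

lemma exists_bump {α : Type*} [TopologicalSpace α] [LocallyCompactSpace α] [T2Space α] {K O : Set α}
    (hK : IsCompact K) (hO : IsOpen O) (hKO : K ⊆ O) :
    ∃ (f : α → ℝ) (L : Set α), Continuous f ∧ IsCompact L ∧ L ⊆ O ∧ (∀ x, x ∉ L → f x = 0) ∧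
      (∀ x, 0 ≤ f x) ∧ (∀ x ∈ K, f x = 1) ∧ ∀ x, f x ≤ 1 := by
  obtain ⟨L, hL, hKL, hLO⟩ := exists_compact_between hK hO hKO
  obtain ⟨f, h1, h2, -, h3⟩ := exists_continuous_one_zero_of_isCompact hK
    (isOpen_interior (s := L)).isClosed_compl (Set.disjoint_compl_right_iff_subset.mpr hKL)
  refine ⟨f, L, f.continuous, hL, hLO, fun x hx => ?_, fun x => (h3 x).1, fun x hx => h1 hx,
    fun x => (h3 x).2⟩
  exact h2 fun h => hx (interior_subset h)

lemma measure_le_of_compact {α : Type*} [MetricSpace α] [ProperSpace α] [MeasurableSpace α]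
    [BorelSpace α] {μ : Measure α} {O : Set α} (hO : IsOpen O) {c : ENNReal}
    (h : ∀ K ⊆ O, IsCompact K → μ K ≤ c) : μ O ≤ c := by
  obtain ⟨F, hF, hFO, hFU, hFm⟩ := hO.exists_iUnion_isClosed
  rcases isEmpty_or_nonempty α with he | ⟨⟨x⟩⟩
  · rw [Set.eq_empty_of_isEmpty O, measure_empty]
    exact zero_le
  have hU : O = ⋃ i : ℕ, (F i ∩ Metric.closedBall x i) := by
    rw [← hFU]
    ext y
    simp only [Set.mem_iUnion, Set.mem_inter_iff]
    constructor
    · rintro ⟨i, hi⟩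
      obtain ⟨k, hk⟩ := exists_nat_ge (dist y x)
      exact ⟨max i k, hFm (le_max_left _ _) hi, Metric.mem_closedBall.mpr
        (hk.trans (by exact_mod_cast le_max_right i k))⟩
    · rintro ⟨i, hi, -⟩
      exact ⟨i, hi⟩
  have hmono : Monotone fun i : ℕ => F i ∩ Metric.closedBall x i := fun i k hik =>
    Set.inter_subset_inter (hFm hik) (Metric.closedBall_subset_closedBall (by exact_mod_cast hik))
  rw [hU, hmono.measure_iUnion]
  exact iSup_le fun i => h _ (Set.inter_subset_left.trans (hFO i))
    ((isCompact_closedBall x i).inter_left (hF i))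

lemma tupMeasure_restrict_eq {P : Measure (SLR n)} (hP : IsLatticeLift P)
    (hι : Fintype.card ι < n) (e : ι → Fin n) :
    (tupMeasure ι P).restrict {X | (colMat e X).det ≠ 0} =
      (volume : Measure (ι → Fin n → ℝ)).restrict {X | (colMat e X).det ≠ 0} := by
  obtain ⟨j, hj⟩ : ∃ j, ∀ k, e k ≠ j := by
    by_contra! h
    have := Fintype.card_le_of_surjective e h
    rw [Fintype.card_fin] at this
    omega
  set U : Set (ι → Fin n → ℝ) := {X | (colMat e X).det ≠ 0} with hU
  have hUo : IsOpen U := isOpen_ne_fun (continuous_colMat e).matrix_det continuous_const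
  have key : ∀ O ⊆ U, IsOpen O → tupMeasure ι P O = volume O := by
    intro O hOU hO
    have hb : ∀ K ⊆ O, IsCompact K → tupMeasure ι P K ≤ volume O ∧ volume K ≤ tupMeasure ι P O := by
      intro K hKO hK
      obtain ⟨f, L, hf, hL, hLO, hfL, hf0, hf1, hf1'⟩ := exists_bump hK hO hKO
      have h1 := lintegral_tupSum_of_isCompact hP hj hf hL hfL (fun Y hY => hOU (hLO hY)) hf0
      rw [← lintegral_tupMeasure P hf.measurable.ennreal_ofReal] at h1
      have hlow : ∀ ν : Measure (ι → Fin n → ℝ), ν K ≤ ∫⁻ X, ENNReal.ofReal (f X) ∂ν := by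
        intro ν
        rw [← lintegral_indicator_one hK.measurableSet]
        refine lintegral_mono fun X => ?_
        by_cases hX : X ∈ K
        · simp [hX, hf1 X hX]
        · simp [hX]
      have hup : ∀ ν : Measure (ι → Fin n → ℝ), ∫⁻ X, ENNReal.ofReal (f X) ∂ν ≤ ν O := by
        intro ν
        rw [← lintegral_indicator_one hO.measurableSet]
        refine lintegral_mono fun X => ?_
        by_cases hX : X ∈ O
        · simp [hX, hf1' X]
        · simp [hX, hfL X fun h => hX (hLO h)]
      exact ⟨(hlow _).trans (h1.trans_le (hup _)), (hlow _).trans (h1.symm.trans_le (hup _))⟩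
    exact le_antisymm (measure_le_of_compact hO fun K hKO hK => (hb K hKO hK).1)
      (measure_le_of_compact hO fun K hKO hK => (hb K hKO hK).2)
  symm
  have hball : ∀ i : ℕ, IsOpen (Metric.ball (0 : ι → Fin n → ℝ) i) := fun i => Metric.isOpen_ball
  refine Measure.ext_of_generateFrom_of_iUnion {s : Set (ι → Fin n → ℝ) | IsOpen s}
    (fun i : ℕ => Metric.ball (0 : ι → Fin n → ℝ) i) ?_ isPiSystem_isOpen ?_
    hball (fun i => ?_) fun s hs => ?_
  · exact BorelSpace.measurable_eq
  · exact Metric.iUnion_ball_nat 0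
  · exact ((Measure.restrict_apply_le _ _).trans_lt measure_ball_lt_top).ne
  · have hs' : IsOpen s := hs
    rw [Measure.restrict_apply hs'.measurableSet, Measure.restrict_apply hs'.measurableSet,
      key _ Set.inter_subset_right (hs'.inter hUo)]

end MeanValue

section Rogers

variable {n : ℕ} {ι : Type*} [Fintype ι]

lemma exists_colMat_det_ne_zero {K : Type*} [Field K] {X : ι → Fin n → K}
    (h : LinearIndependent K X) : ∃ e : ι → Fin n, (Matrix.of fun i k => X i (e k)).det ≠ 0 := by
  have hr : (Matrix.of X).rank = Fintype.card ι := LinearIndependent.rank_matrix h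
  rw [Matrix.rank_eq_finrank_span_cols] at hr
  obtain ⟨f, hf, -, hli⟩ := Submodule.exists_fun_fin_finrank_span_eq K (Set.range (Matrix.of X).col)
  choose c hc using hf
  let τ : ι ≃ Fin (Module.finrank K (Submodule.span K (Set.range (Matrix.of X).col))) :=
    (Fintype.equivFin ι).trans (finCongr hr.symm)
  refine ⟨fun k => c (τ k), ?_⟩
  have h1 : LinearIndependent K (Matrix.of fun i k => X i (c (τ k))).col := by
    have : (Matrix.of fun i k => X i (c (τ k))).col = f ∘ τ := by
      ext k i
      rw [Function.comp_apply, ← hc]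
      rfl
    rw [this]
    exact hli.comp _ τ.injective
  rw [Matrix.linearIndependent_cols_iff_isUnit, Matrix.isUnit_iff_isUnit_det] at h1
  exact h1.ne_zero

lemma linearIndependent_of_colMat {e : ι → Fin n} {X : ι → Fin n → ℝ}
    (h : (colMat e X).det ≠ 0) : LinearIndependent ℝ X := by
  have h1 : LinearIndependent ℝ (colMat e X).row :=
    Matrix.linearIndependent_rows_iff_isUnit.mpr ((Matrix.isUnit_iff_isUnit_det _).mpr h.isUnit)
  let L : (Fin n → ℝ) →ₗ[ℝ] (ι → ℝ) := LinearMap.funLeft ℝ ℝ e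
  exact LinearIndependent.of_comp L h1

lemma linearIndependent_iff_colMat {X : ι → Fin n → ℝ} :
    LinearIndependent ℝ X ↔ ∃ e : ι → Fin n, (colMat e X).det ≠ 0 :=
  ⟨exists_colMat_det_ne_zero, fun ⟨_, h⟩ => linearIndependent_of_colMat h⟩

lemma setOf_linearIndependent : {X : ι → Fin n → ℝ | LinearIndependent ℝ X} =
    ⋃ e : ι → Fin n, {X | (colMat e X).det ≠ 0} := by
  ext X
  rw [Set.mem_iUnion]
  exact linearIndependent_iff_colMat

lemma measurableSet_linearIndependent :
    MeasurableSet {X : ι → Fin n → ℝ | LinearIndependent ℝ X} := by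
  rw [setOf_linearIndependent]
  exact (isOpen_iUnion fun e =>
    isOpen_ne_fun (continuous_colMat e).matrix_det continuous_const).measurableSet

lemma linearIndependent_castZ {m : ι → Fin n → ℤ} :
    LinearIndependent ℝ (castZ m) ↔ LinearIndependent ℤ m := by
  constructor
  · intro h
    have h1 : LinearIndependent ℤ (castZ m) :=
      h.restrict_scalars fun a b hab => by simpa using hab
    let L : (Fin n → ℤ) →ₗ[ℤ] (Fin n → ℝ) :=
      { toFun := fun x c => x c
        map_add' := fun x y => by ext; simp
        map_smul' := fun x y => by ext; simp }
    exact LinearIndependent.of_comp L h1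
  · intro h
    let L : (Fin n → ℤ) →ₗ[ℤ] (Fin n → ℚ) :=
      { toFun := fun x c => x c
        map_add' := fun x y => by ext; simp
        map_smul' := fun x y => by ext; simp }
    have hL : LinearMap.ker L = ⊥ := by
      rw [LinearMap.ker_eq_bot]
      intro x y hxy
      ext c
      have : (x c : ℚ) = y c := congrFun hxy c
      exact_mod_cast this
    have h1 := (LinearIndependent.iff_fractionRing ℤ ℚ).mp ((L.linearIndependent_iff hL).mpr h)
    obtain ⟨e, he⟩ := exists_colMat_det_ne_zero h1
    refine linearIndependent_of_colMat (e := e) ?_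
    have : colMat e (castZ m) = (Matrix.of fun i k => (L ∘ m) i (e k)).map (Rat.castHom ℝ) := by
      ext i k
      simp [colMat, castZ, L]
    rw [this, ← RingHom.mapMatrix_apply, ← RingHom.map_det]
    simpa using he

lemma linearIndependent_ract {X : ι → Fin n → ℝ} (g : SLR n) :
    LinearIndependent ℝ (ract X g) ↔ LinearIndependent ℝ X := by
  have h1 : ∀ (X : ι → Fin n → ℝ) (g : SLR n), LinearIndependent ℝ (ract X g) →
      LinearIndependent ℝ X := fun X g h => LinearIndependent.of_comp (Matrix.vecMulLinear (toMat g)) h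
  refine ⟨h1 X g, fun h => h1 _ g⁻¹ ?_⟩
  rwa [ract_ract, mul_inv_cancel, ract_one]

lemma ae_linearIndependent (hι : Fintype.card ι ≤ n) :
    ∀ᵐ X : ι → Fin n → ℝ, LinearIndependent ℝ X := by
  obtain ⟨e⟩ : Nonempty (ι ↪ Fin n) := by
    rw [Function.Embedding.nonempty_iff_card_le, Fintype.card_fin]
    exact hι
  set Z : Set (ι → Fin n → ℝ) := {X | (colMat e X).det = 0} with hZ
  have hZm : MeasurableSet Z :=
    (isClosed_eq (continuous_colMat e).matrix_det continuous_const).measurableSet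
  let E : ι → Fin n → ℝ := fun i c => if c = e i then 1 else 0
  have hcol : ∀ (X : ι → Fin n → ℝ) (t : ℝ),
      (colMat e (X + t • E)).det = (-(colMat e X)).charpoly.eval t := by
    intro X t
    rw [Matrix.eval_charpoly]
    congr 1
    ext i k
    simp only [colMat, E, Matrix.of_apply, Pi.add_apply, Pi.smul_apply, smul_eq_mul, sub_neg_eq_add,
      Matrix.add_apply, Matrix.scalar_apply, Matrix.diagonal_apply, e.injective.eq_iff]
    rw [add_comm]
    by_cases h : i = k <;> simp [h, eq_comm]
  have hvol : volume Z = 0 := by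
    have h1 : ∀ t : ℝ, ∫⁻ X : ι → Fin n → ℝ, Z.indicator 1 (X + t • E) = volume Z := by
      intro t
      rw [lintegral_add_right_eq_self (fun X => Z.indicator (1 : (ι → Fin n → ℝ) → ENNReal) X),
        lintegral_indicator_one hZm]
    have hm : Measurable fun p : (ι → Fin n → ℝ) × ℝ =>
        Z.indicator (1 : (ι → Fin n → ℝ) → ENNReal) (p.1 + p.2 • E) :=
      (measurable_one.indicator hZm).comp (by fun_prop)
    have h2 : ∫⁻ t in Set.Icc (0 : ℝ) 1, ∫⁻ X, Z.indicator 1 (X + t • E) = volume Z := by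
      simp only [h1]
      simp
    rw [← h2, lintegral_lintegral_swap
      (f := fun (t : ℝ) (X : ι → Fin n → ℝ) => Z.indicator (1 : (ι → Fin n → ℝ) → ENNReal) (X + t • E)) (hm.comp measurable_swap).aemeasurable]
    refine (lintegral_congr fun X => ?_).trans lintegral_zero
    refine le_antisymm ?_ zero_le
    refine (setLIntegral_le_lintegral _ _).trans (le_of_eq ?_)
    have hfin : {t : ℝ | X + t • E ∈ Z}.Finite := by
      refine ((-(colMat e X)).charpoly.roots.toFinset.finite_toSet).subset fun t ht => ?_
      have ht' : (colMat e (X + t • E)).det = 0 := ht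
      rw [hcol] at ht'
      simp only [Finset.mem_coe, Multiset.mem_toFinset]
      rw [Polynomial.mem_roots (Matrix.charpoly_monic _).ne_zero]
      exact ht'
    have : (fun t : ℝ => Z.indicator (1 : (ι → Fin n → ℝ) → ENNReal) (X + t • E)) =
        {t : ℝ | X + t • E ∈ Z}.indicator 1 := by
      ext t
      rfl
    rw [this, lintegral_indicator_one hfin.measurableSet]
    exact hfin.measure_zero _
  rw [ae_iff]
  refine measure_mono_null (fun X hX => ?_) hvol
  by_contra h
  exact hX (linearIndependent_of_colMat h)

lemma lintegral_indep {P : Measure (SLR n)} (hP : IsLatticeLift P) (hι : Fintype.card ι < n)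
    {f : (ι → Fin n → ℝ) → ENNReal} (hf : Measurable f) :
    ∫⁻ g, (∑' m : ι → Fin n → ℤ, if LinearIndependent ℤ m then f (ract (castZ m) g) else 0) ∂P =
      ∫⁻ X, f X := by
  set W := {X : ι → Fin n → ℝ | LinearIndependent ℝ X} with hW
  have hWm : MeasurableSet W := measurableSet_linearIndependent
  have h1 : ∀ g, (∑' m : ι → Fin n → ℤ, if LinearIndependent ℤ m then f (ract (castZ m) g) else 0) =
      tupSum (W.indicator f) g := by
    intro g
    refine tsum_congr fun m => ?_
    have : ract (castZ m) g ∈ W ↔ LinearIndependent ℤ m :=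
      (linearIndependent_ract g).trans linearIndependent_castZ
    rw [Set.indicator_apply]
    simp only [this]
  simp only [h1]
  rw [← lintegral_tupMeasure P (hf.indicator hWm), lintegral_indicator hWm]
  have h2 : (tupMeasure ι P).restrict W = (volume : Measure (ι → Fin n → ℝ)).restrict W := by
    rw [hW, setOf_linearIndependent, Measure.restrict_iUnion_congr]
    exact tupMeasure_restrict_eq hP hι
  have hae : ∀ᵐ X : ι → Fin n → ℝ, X ∈ W := ae_linearIndependent hι.le
  rw [h2, Measure.restrict_eq_self_of_ae_mem hae]

end Rogers

section SharpYoung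

lemma exists_median {F : ℝ → ENNReal} (hF : Measurable F) (h1 : ∫⁻ x, F x = 1) :
    ∃ x₁ : ℝ, ∫⁻ x in Set.Iic x₁, F x = 1 / 2 ∧ ∫⁻ x in Set.Ioi x₁, F x = 1 / 2 := by
  set ν : Measure ℝ := volume.withDensity F with hν
  have hp : IsProbabilityMeasure ν := ⟨by rw [hν, withDensity_apply _ MeasurableSet.univ, setLIntegral_univ, h1]⟩
  have hna : ∀ a : ℝ, ν {a} = 0 := fun a =>
    withDensity_absolutelyContinuous _ _ Real.volume_singleton
  have hcont : Continuous (ProbabilityTheory.cdf ν) := by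
    rw [continuous_iff_continuousAt]
    intro a
    rw [(ProbabilityTheory.monotone_cdf ν).continuousAt_iff_leftLim_eq_rightLim,
      StieltjesFunction.rightLim_eq]
    have h2 := (ProbabilityTheory.cdf ν).measure_singleton a
    rw [ProbabilityTheory.measure_cdf, hna] at h2
    have h3 := ENNReal.ofReal_eq_zero.mp h2.symm
    exact le_antisymm ((ProbabilityTheory.monotone_cdf ν).leftLim_le le_rfl) (by linarith)
  have hlo : ∃ a, ProbabilityTheory.cdf ν a ≤ 1 / 2 :=
    ((ProbabilityTheory.tendsto_cdf_atBot ν).eventually_le_const (by norm_num : (0 : ℝ) < 1 / 2)).exists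
  have hhi : ∃ a, 1 / 2 ≤ ProbabilityTheory.cdf ν a :=
    ((ProbabilityTheory.tendsto_cdf_atTop ν).eventually_const_le (by norm_num : (1 / 2 : ℝ) < 1)).exists
  obtain ⟨x₁, hx⟩ := mem_range_of_exists_le_of_exists_ge hcont hlo hhi
  have h4 : ν (Set.Iic x₁) = 1 / 2 := by
    rw [← ENNReal.ofReal_toReal (measure_ne_top ν (Set.Iic x₁))]
    have : (ν (Set.Iic x₁)).toReal = 1 / 2 := by
      rw [← hx, ProbabilityTheory.cdf_eq_real]
      rfl
    rw [this, ENNReal.ofReal_div_of_pos two_pos]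
    simp
  have h5 : ν (Set.Ioi x₁) = 1 / 2 := by
    rw [← Set.compl_Iic, prob_compl_eq_one_sub measurableSet_Iic, h4]
    simp
  rw [hν, withDensity_apply _ measurableSet_Iic] at h4
  rw [hν, withDensity_apply _ measurableSet_Ioi] at h5
  exact ⟨x₁, h4, h5⟩

lemma lintegral_median_weight {F : ℝ → ENNReal} (hF : Measurable F) {x₁ : ℝ}
    (h1 : ∫⁻ x in Set.Iic x₁, F x = 1 / 2) (h2 : ∫⁻ x in Set.Ioi x₁, F x = 1 / 2) (c : Prop) :
    ∫⁻ x, (if (x₁ < x ↔ c) then 1 / 2 else 1) * F x = 3 / 4 := by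
  have h34 : (1 / 2 : ENNReal) * (1 / 2) + 1 / 2 = 3 / 4 := by
    rw [← ENNReal.toReal_eq_toReal_iff' (by finiteness) (by finiteness),
      ENNReal.toReal_add (by finiteness) (by finiteness)]
    norm_num [ENNReal.toReal_mul, ENNReal.toReal_div]
  rw [← lintegral_add_compl _ (measurableSet_Iic (a := x₁)), Set.compl_Iic]
  by_cases hc : c
  · have e1 : ∫⁻ x in Set.Iic x₁, (if (x₁ < x ↔ c) then 1 / 2 else 1) * F x = 1 / 2 := by
      rw [← h1]
      refine setLIntegral_congr_fun measurableSet_Iic fun x hx => ?_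
      have : ¬ x₁ < x := not_lt.mpr hx
      simp [this, hc]
    have e2 : ∫⁻ x in Set.Ioi x₁, (if (x₁ < x ↔ c) then 1 / 2 else 1) * F x = 1 / 2 * (1 / 2) := by
      rw [← h2, ← lintegral_const_mul _ hF, h2]
      refine setLIntegral_congr_fun measurableSet_Ioi fun x hx => ?_
      have : x₁ < x := hx
      simp [this, hc]
    rw [e1, e2, add_comm, h34]
  · have e1 : ∫⁻ x in Set.Iic x₁, (if (x₁ < x ↔ c) then 1 / 2 else 1) * F x = 1 / 2 * (1 / 2) := by
      rw [← h1, ← lintegral_const_mul _ hF, h1]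
      refine setLIntegral_congr_fun measurableSet_Iic fun x hx => ?_
      have : ¬ x₁ < x := not_lt.mpr hx
      simp [this, hc]
    have e2 : ∫⁻ x in Set.Ioi x₁, (if (x₁ < x ↔ c) then 1 / 2 else 1) * F x = 1 / 2 := by
      rw [← h2]
      refine setLIntegral_congr_fun measurableSet_Ioi fun x hx => ?_
      have : x₁ < x := hx
      simp [this, hc]
    rw [e1, e2, h34]

lemma ENNReal_geom_mean_le (a b c : ENNReal) : (a * b * c) ^ (1 / 3 : ℝ) ≤ (a + b + c) / 3 := by
  by_cases h : a + b + c = ⊤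
  · rw [h, ENNReal.top_div_of_ne_top (by norm_num)]
    exact le_top
  simp only [ENNReal.add_eq_top, not_or] at h
  obtain ⟨⟨ha, hb⟩, hc⟩ := h
  lift a to NNReal using ha
  lift b to NNReal using hb
  lift c to NNReal using hc
  have h3 : (1 / 3 : NNReal) + 1 / 3 + 1 / 3 = 1 := by
    rw [← NNReal.coe_inj]
    push_cast
    norm_num
  have := NNReal.geom_mean_le_arith_mean3_weighted (1 / 3) (1 / 3) (1 / 3) a b c h3
  have e : ((1 / 3 : NNReal) : ℝ) = 1 / 3 := by norm_num
  rw [e, ← NNReal.mul_rpow, ← NNReal.mul_rpow] at this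
  have h4 : (1 / 3 : NNReal) * a + 1 / 3 * b + 1 / 3 * c = (a + b + c) / 3 := by ring
  rw [h4] at this
  have h5 : (((a * b * c) ^ (1 / 3 : ℝ) : NNReal) : ENNReal) ≤ ((a + b + c) / 3 : NNReal) :=
    ENNReal.coe_le_coe.mpr this
  rwa [ENNReal.coe_rpow_of_nonneg _ (by norm_num), ENNReal.coe_div (by norm_num), ENNReal.coe_mul,
    ENNReal.coe_mul, ENNReal.coe_add, ENNReal.coe_add] at h5

/-- The constant in the one-dimensional inequality. -/
noncomputable def youngA : ENNReal := 2 ^ (1 / 3 : ℝ) * (3 / 4)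

lemma pow_two_thirds_le {w₁ w₂ w₃ : ENNReal} (hw : w₁ * w₂ * w₃ = 1 / 2) (a b c : ENNReal) :
    a ^ (2 / 3 : ℝ) * b ^ (2 / 3 : ℝ) * c ^ (2 / 3 : ℝ) ≤
      2 ^ (1 / 3 : ℝ) * ((w₁ * (a * b) + w₂ * (b * c) + w₃ * (a * c)) / 3) := by
  have h1 := ENNReal_geom_mean_le (w₁ * (a * b)) (w₂ * (b * c)) (w₃ * (a * c))
  have h2 : w₁ * (a * b) * (w₂ * (b * c)) * (w₃ * (a * c)) = 1 / 2 * (a * b * c) ^ (2 : ℝ) := by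
    rw [← hw, ENNReal.rpow_two]
    ring
  rw [h2, ENNReal.mul_rpow_of_nonneg _ _ (by norm_num), ← ENNReal.rpow_mul] at h1
  have h3 : (2 : ENNReal) ^ (1 / 3 : ℝ) * (1 / 2) ^ (1 / 3 : ℝ) = 1 := by
    rw [← ENNReal.mul_rpow_of_nonneg _ _ (by norm_num), ENNReal.mul_div_cancel (by norm_num) (by norm_num),
      ENNReal.one_rpow]
  calc a ^ (2 / 3 : ℝ) * b ^ (2 / 3 : ℝ) * c ^ (2 / 3 : ℝ)
      = 2 ^ (1 / 3 : ℝ) * ((1 / 2) ^ (1 / 3 : ℝ) * (a * b * c) ^ ((2 : ℝ) * (1 / 3))) := by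
        rw [← mul_assoc, h3, one_mul, ENNReal.mul_rpow_of_nonneg _ _ (by norm_num),
          ENNReal.mul_rpow_of_nonneg _ _ (by norm_num)]
        norm_num
    _ ≤ _ := by gcongr

lemma lintegral_shear_fst {E : Type*} [AddCommGroup E] [MeasurableSpace E] [MeasurableAdd₂ E]
    {μ : Measure E} [SFinite μ] [μ.IsAddLeftInvariant] {K : E → E → ENNReal}
    (hK : Measurable (Function.uncurry K)) :
    ∫⁻ x, ∫⁻ y, K x (x + y) ∂μ ∂μ = ∫⁻ z, ∫⁻ x, K x z ∂μ ∂μ := by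
  rw [lintegral_lintegral_swap (f := fun z x => K x z) (hK.comp measurable_swap).aemeasurable]
  exact lintegral_congr fun x => lintegral_add_left_eq_self (K x) x

lemma lintegral_shear_snd {E : Type*} [AddCommGroup E] [MeasurableSpace E] [MeasurableAdd₂ E]
    {μ : Measure E} [SFinite μ] [μ.IsAddLeftInvariant] {K : E → E → ENNReal}
    (hK : Measurable (Function.uncurry K)) :
    ∫⁻ x, ∫⁻ y, K y (x + y) ∂μ ∂μ = ∫⁻ z, ∫⁻ y, K y z ∂μ ∂μ := by
  rw [lintegral_lintegral_swap (f := fun x y => K y (x + y)), ← lintegral_shear_fst hK]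
  · exact lintegral_congr fun x => lintegral_congr fun y => by rw [add_comm]
  · exact (hK.comp (measurable_snd.prodMk (measurable_fst.add measurable_snd))).aemeasurable

lemma lintegral_const_mul_mean {f g h : ℝ × ℝ → ENNReal} (hf : Measurable f) (hg : Measurable g)
    (hh : Measurable h) (c : ENNReal) :
    ∫⁻ q, c * ((f q + g q + h q) / 3) = c * (((∫⁻ q, f q) + (∫⁻ q, g q) + ∫⁻ q, h q) / 3) := by
  simp only [div_eq_mul_inv]
  have hs : Measurable fun q => f q + g q + h q := (hf.add hg).add hh
  rw [lintegral_const_mul c (hs.mul_const _), lintegral_mul_const _ hs,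
    lintegral_add_left (f := fun q => f q + g q) (hf.add hg), lintegral_add_left hf]

lemma young_normalized {F G H : ℝ → ENNReal} (hF : Measurable F) (hG : Measurable G)
    (hH : Measurable H) (hF1 : ∫⁻ x, F x = 1) (hG1 : ∫⁻ x, G x = 1) (hH1 : ∫⁻ x, H x = 1) :
    ∫⁻ x, ∫⁻ y, F x ^ (2 / 3 : ℝ) * G y ^ (2 / 3 : ℝ) * H (x + y) ^ (2 / 3 : ℝ) ≤ youngA := by
  obtain ⟨x₁, hx1, hx2⟩ := exists_median hF hF1
  obtain ⟨y₁, hy1, hy2⟩ := exists_median hG hG1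
  let wt : Prop → ENNReal := fun c => if c then 1 / 2 else 1
  let w₁ : ℝ → ℝ → ENNReal := fun x y => wt (y₁ < y ↔ x₁ < x)
  let w₂ : ℝ → ℝ → ENNReal := fun x y => wt (y₁ < y ↔ ¬ x₁ + y₁ < x + y)
  let w₃ : ℝ → ℝ → ENNReal := fun x y => wt (x₁ < x ↔ ¬ x₁ + y₁ < x + y)
  have hw : ∀ x y, w₁ x y * w₂ x y * w₃ x y = 1 / 2 := by
    intro x y
    simp only [w₁, w₂, w₃, wt]
    by_cases hX : x₁ < x <;> by_cases hY : y₁ < y <;> by_cases hZ : x₁ + y₁ < x + y <;>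
      simp only [hX, hY, hZ, iff_true, iff_false, not_true_eq_false, not_false_eq_true, if_true, if_false,
        one_mul, mul_one]
    · exact absurd (by linarith) hZ
    · exact absurd hZ (by linarith)
  have hm : ∀ {p : ℝ × ℝ → Prop}, MeasurableSet {q | p q} → Measurable fun q => wt (p q) :=
    fun h => Measurable.ite h measurable_const measurable_const
  have hX : MeasurableSet {q : ℝ × ℝ | x₁ < q.1} := measurableSet_lt measurable_const measurable_fst
  have hY : MeasurableSet {q : ℝ × ℝ | y₁ < q.2} := measurableSet_lt measurable_const measurable_snd
  have hZ : MeasurableSet {q : ℝ × ℝ | x₁ + y₁ < q.1 + q.2} :=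
    measurableSet_lt measurable_const (by fun_prop)
  have m₁ : Measurable fun q : ℝ × ℝ => w₁ q.1 q.2 * (F q.1 * G q.2) :=
    (hm (hY.iff hX)).mul ((hF.comp measurable_fst).mul (hG.comp measurable_snd))
  have m₂ : Measurable fun q : ℝ × ℝ => w₂ q.1 q.2 * (G q.2 * H (q.1 + q.2)) :=
    (hm (hY.iff hZ.compl)).mul ((hG.comp measurable_snd).mul (hH.comp (by fun_prop)))
  have m₃ : Measurable fun q : ℝ × ℝ => w₃ q.1 q.2 * (F q.1 * H (q.1 + q.2)) :=
    (hm (hX.iff hZ.compl)).mul ((hF.comp measurable_fst).mul (hH.comp (by fun_prop)))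
  have i₁ : ∫⁻ x, ∫⁻ y, w₁ x y * (F x * G y) = 3 / 4 := by
    have : ∀ x, ∫⁻ y, w₁ x y * (F x * G y) = F x * (3 / 4) := by
      intro x
      rw [← lintegral_median_weight hG hy1 hy2 (x₁ < x), ← lintegral_const_mul]
      · exact lintegral_congr fun y => by
          rw [mul_left_comm]
          by_cases h : y₁ < y ↔ x₁ < x <;> simp only [w₁, wt, h, if_true, if_false]
      · exact (Measurable.ite ((measurableSet_lt measurable_const measurable_id).iff
          (MeasurableSet.const _)) measurable_const measurable_const).mul hG
    simp only [this]
    rw [lintegral_mul_const _ hF, hF1, one_mul]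
  have i₂ : ∫⁻ x, ∫⁻ y, w₂ x y * (G y * H (x + y)) = 3 / 4 := by
    have hK : Measurable (Function.uncurry fun y z : ℝ =>
        wt (y₁ < y ↔ ¬ x₁ + y₁ < z) * (G y * H z)) :=
      (hm ((measurableSet_lt measurable_const measurable_fst).iff
        (measurableSet_lt measurable_const measurable_snd).compl)).mul
        ((hG.comp measurable_fst).mul (hH.comp measurable_snd))
    rw [lintegral_shear_snd hK]
    have : ∀ z, ∫⁻ y, wt (y₁ < y ↔ ¬ x₁ + y₁ < z) * (G y * H z) = 3 / 4 * H z := by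
      intro z
      rw [← lintegral_median_weight hG hy1 hy2 (¬ x₁ + y₁ < z), ← lintegral_mul_const]
      · exact lintegral_congr fun y => by
          rw [← mul_assoc]
          by_cases h : y₁ < y ↔ ¬ x₁ + y₁ < z <;> simp only [wt, h, if_true, if_false]
      · exact (Measurable.ite ((measurableSet_lt measurable_const measurable_id).iff
          (MeasurableSet.const _)) measurable_const measurable_const).mul hG
    simp only [this]
    rw [lintegral_const_mul _ hH, hH1, mul_one]
  have i₃ : ∫⁻ x, ∫⁻ y, w₃ x y * (F x * H (x + y)) = 3 / 4 := by
    have hK : Measurable (Function.uncurry fun x z : ℝ =>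
        wt (x₁ < x ↔ ¬ x₁ + y₁ < z) * (F x * H z)) :=
      (hm ((measurableSet_lt measurable_const measurable_fst).iff
        (measurableSet_lt measurable_const measurable_snd).compl)).mul
        ((hF.comp measurable_fst).mul (hH.comp measurable_snd))
    rw [lintegral_shear_fst hK]
    have : ∀ z, ∫⁻ x, wt (x₁ < x ↔ ¬ x₁ + y₁ < z) * (F x * H z) = 3 / 4 * H z := by
      intro z
      rw [← lintegral_median_weight hF hx1 hx2 (¬ x₁ + y₁ < z), ← lintegral_mul_const]
      · exact lintegral_congr fun x => by
          rw [← mul_assoc]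
          by_cases h : x₁ < x ↔ ¬ x₁ + y₁ < z <;> simp only [wt, h, if_true, if_false]
      · exact (Measurable.ite ((measurableSet_lt measurable_const measurable_id).iff
          (MeasurableSet.const _)) measurable_const measurable_const).mul hF
    simp only [this]
    rw [lintegral_const_mul _ hH, hH1, mul_one]
  calc ∫⁻ x, ∫⁻ y, F x ^ (2 / 3 : ℝ) * G y ^ (2 / 3 : ℝ) * H (x + y) ^ (2 / 3 : ℝ)
      ≤ ∫⁻ x, ∫⁻ y, 2 ^ (1 / 3 : ℝ) * ((w₁ x y * (F x * G y) + w₂ x y * (G y * H (x + y)) +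
          w₃ x y * (F x * H (x + y))) / 3) :=
        lintegral_mono fun x => lintegral_mono fun y => pow_two_thirds_le (hw x y) _ _ _
    _ = 2 ^ (1 / 3 : ℝ) * ((3 / 4 + 3 / 4 + 3 / 4) / 3) := by
        have hp : ∀ f : ℝ → ℝ → ENNReal, Measurable (fun q : ℝ × ℝ => f q.1 q.2) →
            ∫⁻ x, ∫⁻ y, f x y = ∫⁻ q : ℝ × ℝ, f q.1 q.2 := fun f hf =>
          (lintegral_prod (fun q : ℝ × ℝ => f q.1 q.2) hf.aemeasurable).symm
        rw [hp (fun x y => w₁ x y * (F x * G y)) m₁] at i₁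
        rw [hp (fun x y => w₂ x y * (G y * H (x + y))) m₂] at i₂
        rw [hp (fun x y => w₃ x y * (F x * H (x + y))) m₃] at i₃
        rw [hp (fun x y => 2 ^ (1 / 3 : ℝ) * ((w₁ x y * (F x * G y) + w₂ x y * (G y * H (x + y)) +
          w₃ x y * (F x * H (x + y))) / 3)) ((((m₁.add m₂).add m₃).div_const 3).const_mul _)]
        have hs := lintegral_const_mul_mean m₁ m₂ m₃ (2 ^ (1 / 3 : ℝ))
        rw [i₁, i₂, i₃] at hs
        exact hs
    _ = youngA := by
        rw [youngA]
        congr 1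
        rw [← ENNReal.toReal_eq_toReal_iff' (by finiteness) (by finiteness), ENNReal.toReal_div,
          ENNReal.toReal_add (by finiteness) (by finiteness),
          ENNReal.toReal_add (by finiteness) (by finiteness)]
        norm_num [ENNReal.toReal_div]

end SharpYoung

section YoungBound

/-- The trilinear inequality
`∫∫ F(x)^{2/3} G(y)^{2/3} H(x+y)^{2/3} ≤ c (∫F)^{2/3} (∫G)^{2/3} (∫H)^{2/3}`. -/
def YoungBound (E : Type*) [Add E] [MeasureSpace E] (c : ENNReal) : Prop :=
  ∀ F G H : E → ENNReal, Measurable F → Measurable G → Measurable H →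
    ∫⁻ x, ∫⁻ y, F x ^ (2 / 3 : ℝ) * G y ^ (2 / 3 : ℝ) * H (x + y) ^ (2 / 3 : ℝ) ≤
      c * ((∫⁻ x, F x) ^ (2 / 3 : ℝ) * (∫⁻ x, G x) ^ (2 / 3 : ℝ) * (∫⁻ x, H x) ^ (2 / 3 : ℝ))

lemma youngA_ne_zero : youngA ≠ 0 := by
  unfold youngA
  simp [ENNReal.div_eq_zero_iff]

lemma youngBound_real : YoungBound ℝ youngA := by
  intro F G H hF hG hH
  have p23 : (0 : ℝ) < 2 / 3 := by norm_num
  by_cases hF0 : ∫⁻ x, F x = 0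
  · rw [lintegral_eq_zero_iff hF] at hF0
    have : ∫⁻ x, ∫⁻ y, F x ^ (2 / 3 : ℝ) * G y ^ (2 / 3 : ℝ) * H (x + y) ^ (2 / 3 : ℝ) = 0 := by
      rw [← lintegral_zero (μ := (volume : Measure ℝ))]
      refine lintegral_congr_ae ?_
      filter_upwards [hF0] with x hx
      simp [hx, p23]
    rw [this]
    simp
  by_cases hG0 : ∫⁻ x, G x = 0
  · rw [lintegral_eq_zero_iff hG] at hG0
    have : ∫⁻ x, ∫⁻ y, F x ^ (2 / 3 : ℝ) * G y ^ (2 / 3 : ℝ) * H (x + y) ^ (2 / 3 : ℝ) = 0 := by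
      rw [← lintegral_zero (μ := (volume : Measure ℝ))]
      refine lintegral_congr fun x => ?_
      rw [← lintegral_zero (μ := (volume : Measure ℝ))]
      refine lintegral_congr_ae ?_
      filter_upwards [hG0] with y hy
      simp [hy, p23]
    rw [this]
    simp
  by_cases hH0 : ∫⁻ x, H x = 0
  · rw [lintegral_eq_zero_iff hH] at hH0
    have : ∫⁻ x, ∫⁻ y, F x ^ (2 / 3 : ℝ) * G y ^ (2 / 3 : ℝ) * H (x + y) ^ (2 / 3 : ℝ) = 0 := by
      rw [← lintegral_zero (μ := (volume : Measure ℝ))]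
      refine lintegral_congr fun x => ?_
      rw [← lintegral_zero (μ := (volume : Measure ℝ))]
      refine lintegral_congr_ae ?_
      filter_upwards [(quasiMeasurePreserving_add_left (volume : Measure ℝ) x).ae hH0] with y hy
      simp only [Pi.zero_apply] at hy
      simp [hy, p23]
    rw [this]
    simp
  have hp : ∀ {a : ENNReal}, a ≠ 0 → a ^ (2 / 3 : ℝ) ≠ 0 := fun ha => by
    simp [ENNReal.rpow_eq_zero_iff, ha]
    intros; linarith
  by_cases hFt : ∫⁻ x, F x = ⊤
  · rw [hFt, ENNReal.top_rpow_of_pos p23, ENNReal.top_mul (hp hG0), ENNReal.top_mul (hp hH0),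
      ENNReal.mul_top youngA_ne_zero]
    exact le_top
  by_cases hGt : ∫⁻ x, G x = ⊤
  · rw [hGt, ENNReal.top_rpow_of_pos p23, ENNReal.mul_top (hp hF0), ENNReal.top_mul (hp hH0),
      ENNReal.mul_top youngA_ne_zero]
    exact le_top
  by_cases hHt : ∫⁻ x, H x = ⊤
  · rw [hHt, ENNReal.top_rpow_of_pos p23, ENNReal.mul_top (mul_ne_zero (hp hF0) (hp hG0)),
      ENNReal.mul_top youngA_ne_zero]
    exact le_top
  have hn : ∀ {f : ℝ → ENNReal}, Measurable f → ∫⁻ x, f x ≠ 0 → ∫⁻ x, f x ≠ ⊤ →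
      ∫⁻ x, (∫⁻ t, f t)⁻¹ * f x = 1 := fun hf h0 ht => by
    rw [lintegral_const_mul _ hf, ENNReal.inv_mul_cancel h0 ht]
  have key := young_normalized (hF.const_mul (∫⁻ t, F t)⁻¹) (hG.const_mul (∫⁻ t, G t)⁻¹)
    (hH.const_mul (∫⁻ t, H t)⁻¹) (hn hF hF0 hFt) (hn hG hG0 hGt) (hn hH hH0 hHt)
  set a := ∫⁻ t, F t
  set b := ∫⁻ t, G t
  set c := ∫⁻ t, H t
  have hc : ∀ {a : ENNReal}, a ≠ 0 → a ≠ ⊤ → ∀ t, t ^ (2 / 3 : ℝ) =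
      a ^ (2 / 3 : ℝ) * (a⁻¹ * t) ^ (2 / 3 : ℝ) := fun h0 ht t => by
    rw [← ENNReal.mul_rpow_of_nonneg _ _ p23.le, ← mul_assoc, ENNReal.mul_inv_cancel h0 ht, one_mul]
  have hfin : a ^ (2 / 3 : ℝ) * b ^ (2 / 3 : ℝ) * c ^ (2 / 3 : ℝ) ≠ ⊤ :=
    ENNReal.mul_ne_top (ENNReal.mul_ne_top (ENNReal.rpow_ne_top_of_nonneg p23.le hFt)
      (ENNReal.rpow_ne_top_of_nonneg p23.le hGt)) (ENNReal.rpow_ne_top_of_nonneg p23.le hHt)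
  calc ∫⁻ x, ∫⁻ y, F x ^ (2 / 3 : ℝ) * G y ^ (2 / 3 : ℝ) * H (x + y) ^ (2 / 3 : ℝ)
      = ∫⁻ x, ∫⁻ y, (a ^ (2 / 3 : ℝ) * b ^ (2 / 3 : ℝ) * c ^ (2 / 3 : ℝ)) *
          ((a⁻¹ * F x) ^ (2 / 3 : ℝ) * (b⁻¹ * G y) ^ (2 / 3 : ℝ) *
            (c⁻¹ * H (x + y)) ^ (2 / 3 : ℝ)) := by
        refine lintegral_congr fun x => lintegral_congr fun y => ?_
        rw [hc hF0 hFt (F x), hc hG0 hGt (G y), hc hH0 hHt (H (x + y))]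
        ring
    _ = (a ^ (2 / 3 : ℝ) * b ^ (2 / 3 : ℝ) * c ^ (2 / 3 : ℝ)) *
          ∫⁻ x, ∫⁻ y, ((a⁻¹ * F x) ^ (2 / 3 : ℝ) * (b⁻¹ * G y) ^ (2 / 3 : ℝ) *
            (c⁻¹ * H (x + y)) ^ (2 / 3 : ℝ)) := by
        rw [← lintegral_const_mul' _ _ hfin]
        exact lintegral_congr fun x => lintegral_const_mul' _ _ hfin
    _ ≤ (a ^ (2 / 3 : ℝ) * b ^ (2 / 3 : ℝ) * c ^ (2 / 3 : ℝ)) * youngA := by gcongr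
    _ = _ := mul_comm _ _

lemma YoungBound.prod {E E' : Type*} [Add E] [Add E'] [MeasureSpace E] [MeasureSpace E']
    [MeasurableAdd₂ E] [MeasurableAdd₂ E'] [SigmaFinite (volume : Measure E)]
    [SigmaFinite (volume : Measure E')] {c c' : ENNReal}
    (h : YoungBound E c) (h' : YoungBound E' c') : YoungBound (E × E') (c * c') := by
  intro F G H hF hG hH
  have m3 : Measurable fun q : (E × E') × (E × E') =>
      F q.1 ^ (2 / 3 : ℝ) * G q.2 ^ (2 / 3 : ℝ) * H (q.1 + q.2) ^ (2 / 3 : ℝ) :=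
    (((hF.comp measurable_fst).pow_const _).mul ((hG.comp measurable_snd).pow_const _)).mul
      ((hH.comp (((measurable_fst.comp measurable_fst).add (measurable_fst.comp measurable_snd)).prodMk
        ((measurable_snd.comp measurable_fst).add (measurable_snd.comp measurable_snd)))).pow_const _)
  have hI : ∀ {f : E × E' → ENNReal}, Measurable f → ∫⁻ q, f q = ∫⁻ x, ∫⁻ x', f (x, x') :=
    fun hf => lintegral_prod _ hf.aemeasurable
  calc ∫⁻ p, ∫⁻ q, F p ^ (2 / 3 : ℝ) * G q ^ (2 / 3 : ℝ) * H (p + q) ^ (2 / 3 : ℝ)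
      = ∫⁻ x, ∫⁻ x', ∫⁻ q, F (x, x') ^ (2 / 3 : ℝ) * G q ^ (2 / 3 : ℝ) *
          H ((x, x') + q) ^ (2 / 3 : ℝ) := hI m3.lintegral_prod_right'
    _ = ∫⁻ x, ∫⁻ x', ∫⁻ y, ∫⁻ y', F (x, x') ^ (2 / 3 : ℝ) * G (y, y') ^ (2 / 3 : ℝ) *
          H (x + y, x' + y') ^ (2 / 3 : ℝ) :=
        lintegral_congr fun x => lintegral_congr fun x' => hI (m3.comp measurable_prodMk_left)
    _ = ∫⁻ x, ∫⁻ y, ∫⁻ x', ∫⁻ y', F (x, x') ^ (2 / 3 : ℝ) * G (y, y') ^ (2 / 3 : ℝ) *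
          H (x + y, x' + y') ^ (2 / 3 : ℝ) := by
        refine lintegral_congr fun x => lintegral_lintegral_swap (f := fun x' y => ∫⁻ y',
          F (x, x') ^ (2 / 3 : ℝ) * G (y, y') ^ (2 / 3 : ℝ) * H (x + y, x' + y') ^ (2 / 3 : ℝ)) ?_
        have : Measurable fun q : (E' × E) × E' => F (x, q.1.1) ^ (2 / 3 : ℝ) *
            G (q.1.2, q.2) ^ (2 / 3 : ℝ) * H (x + q.1.2, q.1.1 + q.2) ^ (2 / 3 : ℝ) := by
          fun_prop
        exact this.lintegral_prod_right'.aemeasurable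
    _ ≤ ∫⁻ x, ∫⁻ y, c' * ((∫⁻ x', F (x, x')) ^ (2 / 3 : ℝ) * (∫⁻ y', G (y, y')) ^ (2 / 3 : ℝ) *
          (∫⁻ z', H (x + y, z')) ^ (2 / 3 : ℝ)) :=
        lintegral_mono fun x => lintegral_mono fun y => h' (fun x' => F (x, x'))
          (fun y' => G (y, y')) (fun z' => H (x + y, z')) (hF.comp measurable_prodMk_left)
          (hG.comp measurable_prodMk_left) (hH.comp measurable_prodMk_left)
    _ = c' * ∫⁻ x, ∫⁻ y, (∫⁻ x', F (x, x')) ^ (2 / 3 : ℝ) * (∫⁻ y', G (y, y')) ^ (2 / 3 : ℝ) *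
          (∫⁻ z', H (x + y, z')) ^ (2 / 3 : ℝ) := by
        have mF := hF.lintegral_prod_right' (ν := (volume : Measure E'))
        have mG := hG.lintegral_prod_right' (ν := (volume : Measure E'))
        have mH := hH.lintegral_prod_right' (ν := (volume : Measure E'))
        have m : Measurable fun q : E × E => (∫⁻ x', F (q.1, x')) ^ (2 / 3 : ℝ) *
            (∫⁻ y', G (q.2, y')) ^ (2 / 3 : ℝ) * (∫⁻ z', H (q.1 + q.2, z')) ^ (2 / 3 : ℝ) :=
          (((mF.comp measurable_fst).pow_const _).mul ((mG.comp measurable_snd).pow_const _)).mul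
            ((mH.comp (measurable_fst.add measurable_snd)).pow_const _)
        rw [← lintegral_const_mul _ m.lintegral_prod_right']
        exact lintegral_congr fun x => lintegral_const_mul _ (m.comp measurable_prodMk_left)
    _ ≤ c' * (c * ((∫⁻ x, ∫⁻ x', F (x, x')) ^ (2 / 3 : ℝ) * (∫⁻ x, ∫⁻ x', G (x, x')) ^ (2 / 3 : ℝ) *
          (∫⁻ x, ∫⁻ x', H (x, x')) ^ (2 / 3 : ℝ))) := by
        gcongr
        exact h _ _ _ hF.lintegral_prod_right' hG.lintegral_prod_right' hH.lintegral_prod_right'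
    _ = _ := by rw [hI hF, hI hG, hI hH]; ring

lemma YoungBound.of_equiv {E E' : Type*} [Add E] [Add E'] [MeasureSpace E] [MeasureSpace E']
    {c : ENNReal} (e : E ≃ᵐ E') (he : MeasurePreserving e) (hadd : ∀ x y, e (x + y) = e x + e y)
    (h : YoungBound E' c) : YoungBound E c := by
  intro F G H hF hG hH
  have key := h (F ∘ e.symm) (G ∘ e.symm) (H ∘ e.symm) (hF.comp e.symm.measurable)
    (hG.comp e.symm.measurable) (hH.comp e.symm.measurable)
  have hI : ∀ f : E' → ENNReal, ∫⁻ x, f x = ∫⁻ x, f (e x) := fun f =>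
    (he.lintegral_comp_emb e.measurableEmbedding f).symm
  simp only [Function.comp_apply, hI, ← hadd, MeasurableEquiv.symm_apply_apply] at key
  exact key

lemma youngBound_pi (n : ℕ) : YoungBound (Fin n → ℝ) (youngA ^ n) := by
  induction n with
  | zero =>
    intro F G H hF hG hH
    rw [volume_pi, Measure.pi_of_empty]
    simp only [lintegral_dirac]
    rw [pow_zero, one_mul]
    exact le_of_eq (by congr 3; exact Subsingleton.elim _ _)
  | succ n ih =>
    rw [pow_succ']
    exact YoungBound.of_equiv (MeasurableEquiv.piFinSuccAbove (fun _ => ℝ) 0)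
      (volume_preserving_piFinSuccAbove (fun _ => ℝ) 0) (fun x y => rfl) (youngBound_real.prod ih)

lemma lintegral_three_indicators_le {n : ℕ} {T : Set (Fin n → ℝ)} (hT : MeasurableSet T)
    (hv : volume T ≠ ⊤) (c : Fin n → ℝ) {d₁ d₂ : ℝ} (h₁ : d₁ = 1 ∨ d₁ = -1) (h₂ : d₂ = 1 ∨ d₂ = -1) :
    ∫⁻ x, ∫⁻ y, T.indicator 1 x * T.indicator 1 y * T.indicator 1 (c + (d₁ • x + d₂ • y)) ≤
      youngA ^ n * volume T ^ 2 := by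
  have flip : ∀ {d : ℝ}, d = 1 ∨ d = -1 → ∀ f : (Fin n → ℝ) → ENNReal,
      ∫⁻ x, f x = ∫⁻ x, f (d • x) := by
    rintro d (rfl | rfl) f
    · simp
    · simp only [neg_smul, one_smul]
      exact (lintegral_neg_eq_self (μ := volume) f).symm
  have hm : ∀ {f : (Fin n → ℝ) → (Fin n → ℝ)}, Measurable f →
      Measurable fun x => T.indicator (1 : (Fin n → ℝ) → ENNReal) (f x) :=
    fun hf => (measurable_const.indicator hT).comp hf
  have dd : ∀ {d : ℝ}, d = 1 ∨ d = -1 → ∀ x : Fin n → ℝ, d • d • x = x := by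
    rintro d (rfl | rfl) x <;> simp
  have hpow : ∀ x : Fin n → ℝ, (T.indicator (1 : (Fin n → ℝ) → ENNReal) x) ^ (2 / 3 : ℝ) =
      T.indicator 1 x := fun x => by
    by_cases hx : x ∈ T <;> simp [hx]
  have key := youngBound_pi n (fun x => T.indicator 1 (d₁ • x)) (fun y => T.indicator 1 (d₂ • y))
    (fun z => T.indicator 1 (c + z)) (hm (by fun_prop)) (hm (by fun_prop)) (hm (by fun_prop))
  simp only [hpow] at key
  rw [← flip h₁ (T.indicator 1), ← flip h₂ (T.indicator 1),
    lintegral_add_left_eq_self (T.indicator 1) c, lintegral_indicator_one hT] at key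
  rw [flip h₁]
  simp only [flip h₂ (fun y => T.indicator 1 _ * T.indicator 1 y * _), dd h₁, dd h₂]
  refine key.trans (le_of_eq ?_)
  congr 1
  rw [← ENNReal.rpow_natCast, ← ENNReal.mul_rpow_of_nonneg _ _ (by norm_num),
    ← ENNReal.mul_rpow_of_nonneg _ _ (by norm_num), ← pow_two, ← pow_succ, ← ENNReal.rpow_natCast,
    ← ENNReal.rpow_mul]
  norm_num

lemma youngA_le : youngA ≤ ENNReal.ofReal 0.945 := by
  have h : (2 : ENNReal) ^ (1 / 3 : ℝ) ≤ ENNReal.ofReal 1.26 := by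
    rw [one_div, ENNReal.rpow_inv_le_iff (by norm_num), ENNReal.ofReal_rpow_of_pos (by norm_num)]
    rw [show (2 : ENNReal) = ENNReal.ofReal 2 by simp]
    exact ENNReal.ofReal_le_ofReal (by norm_num)
  unfold youngA
  calc (2 : ENNReal) ^ (1 / 3 : ℝ) * (3 / 4) ≤ ENNReal.ofReal 1.26 * (3 / 4) := by gcongr
    _ = ENNReal.ofReal 1.26 * ENNReal.ofReal (3 / 4) := by
        rw [ENNReal.ofReal_div_of_pos (by norm_num)]; simp
    _ = ENNReal.ofReal 0.945 := by
        rw [← ENNReal.ofReal_mul (by norm_num)]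
        norm_num

end YoungBound

lemma ENNReal_tsum_le_of_section {α β : Type*} {f : α → ENNReal} {g : β → ENNReal} (p : β → α)
    (h : ∀ a, f a ≠ 0 → ∃ b, p b = a ∧ f a ≤ g b) : ∑' a, f a ≤ ∑' b, g b := by
  have h' : ∀ a : Function.support f, ∃ b, p b = a ∧ f a ≤ g b := fun a => h a a.2
  choose s hs hfs using h'
  rw [← tsum_subtype_support f]
  have hinj : Function.Injective s := by
    intro a b hab
    apply Subtype.ext
    rw [← hs a, ← hs b, hab]
  exact (ENNReal.tsum_le_tsum hfs).trans (ENNReal.tsum_comp_le_tsum_of_injective hinj g)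

section RowBound

variable {n : ℕ} {ι : Type*} [Fintype ι]

lemma exists_sublattice_matrix {q : ℤ} (hq : q ≠ 0) (d : ι → ℤ)
    (hqd : ∃ (a : ι → ℤ) (b : ℤ), ∑ k, a k * d k + b * q = 1) :
    ∃ B : Matrix ι ι ℤ, B.det ≠ 0 ∧ q ∣ B.det ∧
      ∀ w : ι → ℤ, q ∣ ∑ k, d k * w k → ∃ w', B *ᵥ w' = w := by
  let L : (ι → ℤ) →ₗ[ℤ] ℤ := ∑ k, d k • LinearMap.proj k
  have hL : ∀ w, L w = ∑ k, d k * w k := fun w => by simp [L]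
  let K : Submodule ℤ (ι → ℤ) := Submodule.comap L (Ideal.span {q})
  have hK : ∀ w, w ∈ K ↔ q ∣ ∑ k, d k * w k := fun w => by
    rw [← hL]
    exact Ideal.mem_span_singleton
  have hrank : Module.finrank ℤ (ι → ℤ) = Module.finrank ℤ K := by
    refine le_antisymm ?_ K.finrank_le
    let M : (ι → ℤ) →ₗ[ℤ] K := LinearMap.codRestrict K (q • LinearMap.id) fun w => by
      rw [hK]
      refine Finset.dvd_sum fun k _ => ?_
      simp only [LinearMap.smul_apply, LinearMap.id_apply, Pi.smul_apply, smul_eq_mul]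
      exact ⟨d k * w k, by ring⟩
    refine LinearMap.finrank_le_finrank_of_injective (f := M) fun x y hxy => ?_
    have h1 : q • x = q • y := congrArg Subtype.val hxy
    exact smul_right_injective _ hq h1
  let E : (ι → ℤ) ≃ₗ[ℤ] K := LinearEquiv.ofFinrankEq _ _ hrank
  let B : Matrix ι ι ℤ := LinearMap.toMatrix' (K.subtype ∘ₗ E.toLinearMap)
  have hB : ∀ w, B *ᵥ w = E w := fun w => by
    rw [← Matrix.toLin'_apply, Matrix.toLin'_toMatrix']
    rfl
  have hdvd : ∀ k, q ∣ (d ᵥ* B) k := by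
    intro k
    have h1 := (hK (B *ᵥ Pi.single k 1)).mp (by rw [hB]; exact (E _).2)
    have h2 : ∑ i, d i * (B *ᵥ Pi.single k 1) i = (d ᵥ* B) k := by
      simp [Matrix.vecMul, dotProduct]
    rwa [h2] at h1
  refine ⟨B, ?_, ?_, ?_⟩
  · intro h0
    obtain ⟨v, hv, hv0⟩ := Matrix.exists_mulVec_eq_zero_iff.mpr h0
    rw [hB] at hv0
    exact hv (by simpa using hv0)
  · have h1 : ∀ k, q ∣ B.det * d k := by
      intro k
      have h2 : (d ᵥ* B) ᵥ* B.adjugate = B.det • d := by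
        rw [Matrix.vecMul_vecMul, Matrix.mul_adjugate, Matrix.vecMul_smul, Matrix.vecMul_one]
      have h3 := congrFun h2 k
      rw [Pi.smul_apply, smul_eq_mul] at h3
      rw [← h3]
      exact Finset.dvd_sum fun i _ => (hdvd i).mul_right _
    obtain ⟨a, b, hab⟩ := hqd
    have : B.det = ∑ k, a k * (B.det * d k) + q * (b * B.det) := by
      calc B.det = B.det * (∑ k, a k * d k + b * q) := by rw [hab, mul_one]
        _ = _ := by rw [mul_add, Finset.mul_sum]; congr 1; exacts [Finset.sum_congr rfl fun k _ => by ring, by ring]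
    rw [this]
    exact dvd_add (Finset.dvd_sum fun k _ => (h1 k).mul_left _) (dvd_mul_right _ _)
  · intro w hw
    obtain ⟨w', hw'⟩ := E.surjective ⟨w, (hK w).mpr hw⟩
    exact ⟨w', by rw [hB, hw']⟩

/-- Left multiplication of a tuple of row vectors by a matrix. -/
def lact (B : Matrix ι ι ℝ) : (ι → Fin n → ℝ) →ₗ[ℝ] (ι → Fin n → ℝ) where
  toFun X k c := ∑ j, B k j * X j c
  map_add' X Y := by ext k c; simp [mul_add, Finset.sum_add_distrib]
  map_smul' r X := by ext k c; simp [Finset.mul_sum, mul_left_comm]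

lemma det_lact (B : Matrix ι ι ℝ) : LinearMap.det (lact (n := n) B) = B.det ^ n := by
  let τ : (ι → Fin n → ℝ) ≃ₗ[ℝ] (Fin n → ι → ℝ) :=
    { Equiv.piComm (fun _ _ => ℝ) with
      map_add' := fun _ _ => rfl
      map_smul' := fun _ _ => rfl }
  rw [← LinearMap.det_conj (lact (n := n) B) τ]
  have : (τ : (ι → Fin n → ℝ) →ₗ[ℝ] (Fin n → ι → ℝ)) ∘ₗ lact (n := n) B ∘ₗ
      (τ.symm : (Fin n → ι → ℝ) →ₗ[ℝ] (ι → Fin n → ℝ)) =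
      LinearMap.pi fun c => Matrix.toLin' B ∘ₗ LinearMap.proj c := by
    ext c
    rfl
  rw [this, LinearMap.det_pi]
  simp

/-- The tuples all of whose entries lie in `T`. -/
def box (ι : Type*) (T : Set (Fin n → ℝ)) : Set (ι → Fin n → ℝ) := {X | ∀ k, X k ∈ T}

lemma measurableSet_box {T : Set (Fin n → ℝ)} (hT : MeasurableSet T) : MeasurableSet (box ι T) := by
  rw [box, Set.ofPred_forall]
  exact MeasurableSet.iInter fun k => hT.preimage (measurable_pi_apply k)

lemma volume_box (T : Set (Fin n → ℝ)) : volume (box ι T) = volume T ^ Fintype.card ι := by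
  have : box ι T = Set.univ.pi fun _ => T := by
    ext X
    simp [box]
  rw [this, volume_pi_pi, Finset.prod_const, Finset.card_univ]

lemma lintegral_row_denominator {P : Measure (SLR n)} (hP : IsLatticeLift P)
    (hι : Fintype.card ι < n) {T : Set (Fin n → ℝ)} (hT : MeasurableSet T) {q : ℤ} (hq : q ≠ 0)
    (d : ι → ℤ) (hqd : ∃ (a : ι → ℤ) (b : ℤ), ∑ k, a k * d k + b * q = 1) :
    ∫⁻ g, (∑' m : ι → Fin n → ℤ, if LinearIndependent ℤ m ∧ ract (castZ m) g ∈ box ι T ∧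
        ∃ m' : Fin n → ℤ, q • m' = ∑ k, d k • m k then 1 else 0) ∂P ≤
      ((q.natAbs : ENNReal) ^ n)⁻¹ * volume T ^ Fintype.card ι := by
  obtain ⟨B, hB0, hqB, hB⟩ := exists_sublattice_matrix hq d hqd
  let Bℝ : Matrix ι ι ℝ := B.map (Int.castRingHom ℝ)
  have hBR : Bℝ.det = B.det := by
    rw [show Bℝ = (Int.castRingHom ℝ).mapMatrix B from rfl, ← RingHom.map_det]
    rfl
  let p : (ι → Fin n → ℤ) → (ι → Fin n → ℤ) := fun m k c => ∑ j, B k j * m j c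
  have hp : ∀ m, castZ (p m) = lact Bℝ (castZ m) := by
    intro m
    ext k c
    simp [castZ, p, lact, Bℝ]
  have hcomm : ∀ (X : ι → Fin n → ℝ) (g : SLR n), ract (lact Bℝ X) g = lact Bℝ (ract X g) := by
    intro X g
    ext k c
    simp only [ract, lact, vecMul, dotProduct, LinearMap.coe_mk, AddHom.coe_mk, Finset.sum_mul,
      Finset.mul_sum, mul_assoc]
    exact Finset.sum_comm
  set b : (ι → Fin n → ℝ) → ENNReal := ((lact Bℝ) ⁻¹' (box ι T)).indicator 1 with hb
  have hLm : Measurable (lact (n := n) Bℝ) := (LinearMap.continuous_of_finiteDimensional _).measurable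
  have hbm : Measurable b := measurable_one.indicator (hLm (measurableSet_box hT))
  have hle : ∀ g, (∑' m : ι → Fin n → ℤ, if LinearIndependent ℤ m ∧ ract (castZ m) g ∈ box ι T ∧
        ∃ m' : Fin n → ℤ, q • m' = ∑ k, d k • m k then (1 : ENNReal) else 0) ≤
      ∑' m : ι → Fin n → ℤ, if LinearIndependent ℤ m then b (ract (castZ m) g) else 0 := by
    intro g
    refine ENNReal_tsum_le_of_section p fun m hm => ?_
    have hm' : LinearIndependent ℤ m ∧ ract (castZ m) g ∈ box ι T ∧
        ∃ m' : Fin n → ℤ, q • m' = ∑ k, d k • m k := by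
      by_contra h
      exact hm (if_neg h)
    obtain ⟨h1, h2, m', h3⟩ := hm'
    have h4 : ∀ c, ∃ w', B *ᵥ w' = fun k => m k c := fun c => hB _ ⟨m' c, by
      have := congrFun h3 c
      simpa using this.symm⟩
    choose w hw using h4
    have h5 : p (fun k c => w c k) = m := by
      ext k c
      exact congrFun (hw c) k
    refine ⟨_, h5, ?_⟩
    rw [if_pos ⟨h1, h2, m', h3⟩]
    have h6 : LinearIndependent ℤ (fun k c => w c k : ι → Fin n → ℤ) := by
      rw [Fintype.linearIndependent_iff] at h1 ⊢
      intro u hu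
      have h7 := h1 (u ᵥ* B.adjugate) (by
        ext c
        have : ∑ k, (u ᵥ* B.adjugate) k * m k c = B.det * ∑ k, u k * w c k := by
          have e1 : ∑ k, (u ᵥ* B.adjugate) k * m k c = (u ᵥ* B.adjugate) ⬝ᵥ (B *ᵥ w c) := by
            rw [hw c]; rfl
          rw [e1, Matrix.dotProduct_mulVec, Matrix.vecMul_vecMul, Matrix.adjugate_mul,
            Matrix.vecMul_smul, Matrix.vecMul_one, smul_dotProduct, smul_eq_mul]
          rfl
        have e2 : ∑ k, u k * w c k = 0 := by
          have := congrFun hu c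
          simpa using this
        rw [e2, mul_zero] at this
        simpa using this)
      have h8 : u ᵥ* B.adjugate = 0 := funext h7
      have h9 : B.det • u = 0 := by
        have : (u ᵥ* B.adjugate) ᵥ* B = B.det • u := by
          rw [Matrix.vecMul_vecMul, Matrix.adjugate_mul, Matrix.vecMul_smul, Matrix.vecMul_one]
        rw [← this, h8, Matrix.zero_vecMul]
      exact congrFun ((smul_eq_zero.mp h9).resolve_left hB0)
    rw [if_pos h6, hb, Set.indicator_of_mem]
    · rfl
    · change lact Bℝ _ ∈ box ι T
      rw [← hcomm, ← hp, h5]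
      exact h2
  refine (lintegral_mono hle).trans ?_
  rw [lintegral_indep hP hι hbm, hb, lintegral_indicator_one (hLm (measurableSet_box hT))]
  have hdet : LinearMap.det (lact (n := n) Bℝ) ≠ 0 := by
    rw [det_lact, hBR]
    exact pow_ne_zero _ (Int.cast_ne_zero.mpr hB0)
  rw [Measure.addHaar_preimage_linearMap _ hdet, volume_box]
  gcongr
  rw [det_lact, hBR, abs_inv, abs_pow, ← Int.cast_abs, Int.abs_eq_natAbs,
    ENNReal.ofReal_inv_of_pos (by positivity), ENNReal.ofReal_pow (by positivity)]
  gcongr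
  have : q.natAbs ≤ B.det.natAbs := Nat.le_of_dvd (Int.natAbs_pos.mpr hB0) (Int.natAbs_dvd_natAbs.mpr hqB)
  simp only [Int.cast_natCast, ENNReal.ofReal_natCast]
  exact_mod_cast this

end RowBound

section RowBound

variable {n : ℕ} {ι : Type*} [Fintype ι]

lemma linearIndependent_update {m : ι → Fin n → ℤ} (hm : LinearIndependent ℤ m) {q : ℤ} (hq : q ≠ 0)
    {d : ι → ℤ} {k₀ : ι} (hk₀ : d k₀ ≠ 0) {m' : Fin n → ℤ} (h : q • m' = ∑ k, d k • m k) :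
    LinearIndependent ℤ (Function.update m k₀ m') := by
  rw [Fintype.linearIndependent_iff] at hm ⊢
  intro u hu
  have h1 : ∀ k ∈ Finset.univ.erase k₀, u k • Function.update m k₀ m' k = u k • m k := fun k hk => by
    rw [Function.update_of_ne (Finset.ne_of_mem_erase hk)]
  rw [← Finset.add_sum_erase _ _ (Finset.mem_univ k₀), Function.update_self,
    Finset.sum_congr rfl h1] at hu
  have h2 : ∑ k, (u k₀ * d k + if k = k₀ then 0 else q * u k) • m k = 0 := by
    calc ∑ k, (u k₀ * d k + if k = k₀ then 0 else q * u k) • m k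
        = u k₀ • ∑ k, d k • m k + ∑ k, (if k = k₀ then 0 else q * u k) • m k := by
          rw [Finset.smul_sum, ← Finset.sum_add_distrib]
          exact Finset.sum_congr rfl fun k _ => by rw [add_smul, mul_smul]
      _ = u k₀ • q • m' + q • ∑ k ∈ Finset.univ.erase k₀, u k • m k := by
          rw [h, ← Finset.add_sum_erase _ (fun k => (if k = k₀ then 0 else q * u k) • m k)
            (Finset.mem_univ k₀), if_pos rfl, zero_smul, zero_add,
            Finset.smul_sum (s := Finset.univ.erase k₀) (r := q)]
          congr 1
          exact Finset.sum_congr rfl fun k hk => by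
            rw [if_neg (Finset.ne_of_mem_erase hk), mul_smul]
      _ = q • (u k₀ • m' + ∑ k ∈ Finset.univ.erase k₀, u k • m k) := by
          rw [smul_add, smul_comm]
      _ = 0 := by rw [hu, smul_zero]
  have h3 := hm _ h2
  have h4 : u k₀ = 0 := by
    have := h3 k₀
    rw [if_pos rfl, add_zero] at this
    exact (mul_eq_zero.mp this).resolve_right hk₀
  intro k
  by_cases hk : k = k₀
  · rw [hk, h4]
  · have := h3 k
    rw [h4, zero_mul, zero_add, if_neg hk] at this
    exact (mul_eq_zero.mp this).resolve_left hq

lemma lintegral_row_numerator {P : Measure (SLR n)} (hP : IsLatticeLift P)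
    (hι : Fintype.card ι < n) {T : Set (Fin n → ℝ)} (hT : MeasurableSet T) {q : ℤ} (hq : q ≠ 0)
    (d : ι → ℤ) (hqd : ∃ (a : ι → ℤ) (b : ℤ), ∑ k, a k * d k + b * q = 1) {k₀ : ι} (hk₀ : d k₀ ≠ 0) :
    ∫⁻ g, (∑' m : ι → Fin n → ℤ, if LinearIndependent ℤ m ∧ ract (castZ m) g ∈ box ι T ∧
        ∃ m' : Fin n → ℤ, q • m' = ∑ k, d k • m k ∧ vecMul (fun c => (m' c : ℝ)) (toMat g) ∈ T
        then 1 else 0) ∂P ≤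
      (((d k₀).natAbs : ENNReal) ^ n)⁻¹ * volume T ^ Fintype.card ι := by
  have hqd' : ∃ (a : ι → ℤ) (b : ℤ),
      ∑ k, a k * Function.update (-d) k₀ q k + b * d k₀ = 1 := by
    obtain ⟨a, b, hab⟩ := hqd
    refine ⟨Function.update (-a) k₀ b, a k₀, ?_⟩
    rw [← Finset.add_sum_erase _ _ (Finset.mem_univ k₀)] at hab ⊢
    rw [Function.update_self, Function.update_self, Finset.sum_congr rfl (g := fun k => a k * d k)
      fun k hk => by
        rw [Function.update_of_ne (Finset.ne_of_mem_erase hk),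
          Function.update_of_ne (Finset.ne_of_mem_erase hk)]
        simp]
    linarith
  refine le_trans (lintegral_mono fun g => ?_)
    (lintegral_row_denominator hP hι hT hk₀ (Function.update (-d) k₀ q) hqd')
  refine ENNReal_tsum_le_of_section (fun m => Function.update m k₀ fun c =>
    (q * m k₀ c - ∑ k ∈ Finset.univ.erase k₀, d k * m k c) / d k₀) fun m hm => ?_
  have hm' : LinearIndependent ℤ m ∧ ract (castZ m) g ∈ box ι T ∧
      ∃ m' : Fin n → ℤ, q • m' = ∑ k, d k • m k ∧ vecMul (fun c => (m' c : ℝ)) (toMat g) ∈ T := by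
    by_contra h
    exact hm (if_neg h)
  obtain ⟨h1, h2, m', h3, h4⟩ := hm'
  have h5 : d k₀ • m k₀ = q • m' - ∑ k ∈ Finset.univ.erase k₀, d k • m k := by
    rw [h3, ← Finset.add_sum_erase _ _ (Finset.mem_univ k₀), add_sub_cancel_right]
  refine ⟨Function.update m k₀ m', ?_, ?_⟩
  · simp only [Function.update_idem, Function.update_self]
    rw [Function.update_eq_self_iff]
    ext c
    have h6 := congrFun h5 c
    simp only [Pi.smul_apply, smul_eq_mul, Pi.sub_apply, Finset.sum_apply] at h6
    rw [Finset.sum_congr rfl (g := fun k => d k * m k c) fun k hk => by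
      rw [Function.update_of_ne (Finset.ne_of_mem_erase hk)], ← h6, Int.mul_ediv_cancel_left _ hk₀]
  · rw [if_pos ⟨h1, h2, m', h3, h4⟩, if_pos]
    refine ⟨linearIndependent_update h1 hq hk₀ h3, fun k => ?_, m k₀, ?_⟩
    · by_cases hk : k = k₀
      · rw [hk]
        have e : castZ (Function.update m k₀ m') k₀ = fun c => (m' c : ℝ) := by
          ext c
          rw [castZ, Function.update_self]
        rw [ract, e]
        exact h4
      · have e : castZ (Function.update m k₀ m') k = castZ m k := by
          ext c
          rw [castZ, Function.update_of_ne hk, castZ]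
        rw [ract, e]
        exact h2 k
    · rw [h5, ← Finset.add_sum_erase _ _ (Finset.mem_univ k₀), Function.update_self,
        Function.update_self, sub_eq_add_neg, ← Finset.sum_neg_distrib]
      congr 1
      refine Finset.sum_congr rfl fun k hk => ?_
      rw [Function.update_of_ne (Finset.ne_of_mem_erase hk),
        Function.update_of_ne (Finset.ne_of_mem_erase hk), Pi.neg_apply, neg_smul]

end RowBound

section UnitRow

variable {n : ℕ} {ι : Type*} [Fintype ι]

lemma lintegral_box_indicator_le {T : Set (Fin n → ℝ)} (hT : MeasurableSet T) (hv : volume T ≠ ⊤)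
    {d : ι → ℝ} {k₁ k₂ : ι} (hk : k₁ ≠ k₂) (h₁ : d k₁ = 1 ∨ d k₁ = -1) (h₂ : d k₂ = 1 ∨ d k₂ = -1) :
    ∫⁻ X : ι → Fin n → ℝ, (box ι T).indicator 1 X * T.indicator 1 (∑ k, d k • X k) ≤
      youngA ^ n * volume T ^ Fintype.card ι := by
  have hbox : Measurable ((box ι T).indicator (1 : (ι → Fin n → ℝ) → ENNReal)) :=
    measurable_const.indicator (measurableSet_box hT)
  have hf : Measurable fun X : ι → Fin n → ℝ =>
      (box ι T).indicator (1 : (ι → Fin n → ℝ) → ENNReal) X * T.indicator 1 (∑ k, d k • X k) :=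
    hbox.mul ((measurable_const.indicator hT).comp (by fun_prop))
  have hg : Measurable fun X : ι → Fin n → ℝ =>
      youngA ^ n * (box ι T).indicator (1 : (ι → Fin n → ℝ) → ENNReal) X := hbox.const_mul _
  have key := lintegral_le_of_lmarginal_le (μ := fun _ : ι => (volume : Measure (Fin n → ℝ)))
    {k₁, k₂} hf hg ?_
  · refine key.trans (le_of_eq ?_)
    rw [lintegral_const_mul _ hbox, ← volume_pi, lintegral_indicator_one (measurableSet_box hT),
      volume_box]
  · intro X
    have hk' : k₁ ∉ ({k₂} : Finset ι) := by simpa using hk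
    rw [lmarginal_insert _ hf hk', lmarginal_insert _ hg hk']
    simp only [lmarginal_singleton]
    let R : ENNReal := if ∀ k, k ≠ k₁ → k ≠ k₂ → X k ∈ T then 1 else 0
    have hind : ∀ x y, (box ι T).indicator (1 : (ι → Fin n → ℝ) → ENNReal)
        (Function.update (Function.update X k₁ x) k₂ y) =
          R * (T.indicator 1 x * T.indicator 1 y) := by
      intro x y
      have hiff : Function.update (Function.update X k₁ x) k₂ y ∈ box ι T ↔
          (∀ k, k ≠ k₁ → k ≠ k₂ → X k ∈ T) ∧ x ∈ T ∧ y ∈ T := by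
        constructor
        · intro h
          refine ⟨fun k ha hb => ?_, ?_, ?_⟩
          · have := h k
            rwa [Function.update_of_ne hb, Function.update_of_ne ha] at this
          · have := h k₁
            rwa [Function.update_of_ne hk, Function.update_self] at this
          · have := h k₂
            rwa [Function.update_self] at this
        · rintro ⟨h, hx, hy⟩ k
          by_cases hb : k = k₂
          · subst hb
            rwa [Function.update_self]
          · rw [Function.update_of_ne hb]
            by_cases ha : k = k₁
            · subst ha
              rwa [Function.update_self]
            · rw [Function.update_of_ne ha]
              exact h k ha hb
      simp only [Set.indicator, hiff, R, Pi.one_apply]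
      by_cases hA : ∀ k, k ≠ k₁ → k ≠ k₂ → X k ∈ T <;> by_cases hx : x ∈ T <;> by_cases hy : y ∈ T <;>
        simp only [hA, hx, hy, and_true, and_false, if_true, if_false, mul_one, mul_zero, zero_mul,
          not_false_eq_true, implies_true]
    set c : Fin n → ℝ := ∑ k ∈ (Finset.univ.erase k₁).erase k₂, d k • X k with hc
    have hsum : ∀ x y, ∑ k, d k • Function.update (Function.update X k₁ x) k₂ y k =
        c + (d k₁ • x + d k₂ • y) := by
      intro x y
      rw [← Finset.add_sum_erase _ _ (Finset.mem_univ k₁), ← Finset.add_sum_erase _ _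
        (Finset.mem_erase.mpr ⟨hk.symm, Finset.mem_univ k₂⟩), Function.update_of_ne hk,
        Function.update_self, Function.update_self, hc]
      rw [Finset.sum_congr rfl (g := fun k => d k • X k) fun k hk => by
        rw [Function.update_of_ne (Finset.ne_of_mem_erase hk),
          Function.update_of_ne (Finset.ne_of_mem_erase (Finset.mem_of_mem_erase hk))]]
      abel
    simp only [hind, hsum]
    have hR : R ≠ ⊤ := by
      simp only [R]
      split_ifs <;> simp
    have hmT : Measurable (T.indicator (1 : (Fin n → ℝ) → ENNReal)) := measurable_const.indicator hT
    calc ∫⁻ x, ∫⁻ y, R * (T.indicator 1 x * T.indicator 1 y) *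
          T.indicator 1 (c + (d k₁ • x + d k₂ • y))
        = R * ∫⁻ x, ∫⁻ y, T.indicator 1 x * T.indicator 1 y *
          T.indicator 1 (c + (d k₁ • x + d k₂ • y)) := by
          rw [← lintegral_const_mul' _ _ hR]
          refine lintegral_congr fun x => ?_
          rw [← lintegral_const_mul' _ _ hR]
          exact lintegral_congr fun y => mul_assoc _ _ _
      _ ≤ R * (youngA ^ n * volume T ^ 2) := by
          gcongr
          exact lintegral_three_indicators_le hT hv c h₁ h₂
      _ = ∫⁻ x, ∫⁻ y, youngA ^ n * (R * (T.indicator 1 x * T.indicator 1 y)) := by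
          have : ∀ x, ∫⁻ y, youngA ^ n * (R * (T.indicator 1 x * T.indicator 1 y)) =
              (youngA ^ n * R * volume T) * T.indicator 1 x := by
            intro x
            calc ∫⁻ y, youngA ^ n * (R * (T.indicator 1 x * T.indicator 1 y))
                = ∫⁻ y, (youngA ^ n * R * T.indicator 1 x) * T.indicator 1 y :=
                  lintegral_congr fun y => by ring
              _ = _ := by
                  rw [lintegral_const_mul _ hmT, lintegral_indicator_one hT]
                  ring
          simp only [this]
          rw [lintegral_const_mul _ hmT, lintegral_indicator_one hT]
          ring

/-- The tuple `m` admits an integral solution `m'` of `q m' = ∑ d_k m_k` which differs from all the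
`m_k` and for which `m' g` lies in `T`. -/
def RowEvent (T : Set (Fin n → ℝ)) (q : ℤ) (d : ι → ℤ) (m : ι → Fin n → ℤ) (g : SLR n) : Prop :=
  ∃ m' : Fin n → ℤ, q • m' = ∑ k, d k • m k ∧ vecMul (fun c => (m' c : ℝ)) (toMat g) ∈ T ∧
    ∀ k, m' ≠ m k

lemma lintegral_row_unit {P : Measure (SLR n)} (hP : IsLatticeLift P)
    (hι : Fintype.card ι < n) {T : Set (Fin n → ℝ)} (hT : MeasurableSet T) (hv : volume T ≠ ⊤)
    (h0 : (0 : Fin n → ℝ) ∉ T) (hneg : ∀ x ∈ T, -x ∉ T) {q : ℤ} (hq : q = 1 ∨ q = -1)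
    {d : ι → ℤ} (hd : ∀ k, (d k).natAbs ≤ 1) :
    ∫⁻ g, (∑' m : ι → Fin n → ℤ, if LinearIndependent ℤ m ∧ ract (castZ m) g ∈ box ι T ∧
        RowEvent T q d m g then 1 else 0) ∂P ≤
      youngA ^ n * volume T ^ Fintype.card ι := by
  have hqq : q * q = 1 := by rcases hq with rfl | rfl <;> rfl
  have hsol : ∀ {m : ι → Fin n → ℤ} {m' : Fin n → ℤ}, q • m' = ∑ k, d k • m k →
      m' = ∑ k, (q * d k) • m k := by
    intro m m' h
    have : q • q • m' = ∑ k, (q * d k) • m k := by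
      rw [h, Finset.smul_sum]
      exact Finset.sum_congr rfl fun k _ => by rw [mul_smul]
    rwa [smul_smul, hqq, one_smul] at this
  have hunit : ∀ k, d k ≠ 0 → q * d k = 1 ∨ q * d k = -1 := by
    intro k hk
    have h1 := hd k
    rcases hq with rfl | rfl <;> omega
  by_cases hex : ∃ k₁ k₂, k₁ ≠ k₂ ∧ d k₁ ≠ 0 ∧ d k₂ ≠ 0
  · obtain ⟨k₁, k₂, hk, hd₁, hd₂⟩ := hex
    have hcast : ∀ k, d k ≠ 0 → ((q * d k : ℤ) : ℝ) = 1 ∨ ((q * d k : ℤ) : ℝ) = -1 := by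
      intro k hk
      rcases hunit k hk with h | h <;> rw [h] <;> simp
    have hf : Measurable fun X : ι → Fin n → ℝ =>
        (box ι T).indicator (1 : (ι → Fin n → ℝ) → ENNReal) X *
          T.indicator 1 (∑ k, ((q * d k : ℤ) : ℝ) • X k) :=
      (measurable_const.indicator (measurableSet_box hT)).mul
        ((measurable_const.indicator hT).comp (by fun_prop))
    refine le_trans ?_ (lintegral_box_indicator_le hT hv (d := fun k => ((q * d k : ℤ) : ℝ)) hk
      (hcast k₁ hd₁) (hcast k₂ hd₂))
    rw [← lintegral_indep hP hι hf]
    refine lintegral_mono fun g => ENNReal.tsum_le_tsum fun m => ?_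
    split_ifs with h1 h2
    · obtain ⟨-, h3, m', h4, h5, -⟩ := h1
      have h6 : ∑ k, ((q * d k : ℤ) : ℝ) • ract (castZ m) g k =
          vecMul (fun c => (m' c : ℝ)) (toMat g) := by
        simp only [ract]
        simp_rw [← smul_vecMul]
        rw [← sum_vecMul]
        congr 1
        ext c
        rw [hsol h4]
        simp [castZ, Finset.sum_apply]
      rw [h6, Set.indicator_of_mem h3, Set.indicator_of_mem h5]
      simp
    · exact absurd h1.1 h2
    · exact zero_le
    · exact le_rfl
  · push Not at hex
    refine le_trans (le_of_eq ?_) zero_le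
    refine (lintegral_congr (g := fun _ => 0) fun g => ?_).trans lintegral_zero
    refine ENNReal.tsum_eq_zero.mpr fun m => if_neg ?_
    rintro ⟨-, h3, m', h4, h5, h6⟩
    have h7 := hsol h4
    by_cases hz : ∀ k, d k = 0
    · have : m' = 0 := by
        rw [h7]
        exact Finset.sum_eq_zero fun k _ => by rw [hz k, mul_zero, zero_smul]
      rw [this] at h5
      apply h0
      convert h5
      ext c
      simp [vecMul, dotProduct]
    · push Not at hz
      obtain ⟨k₁, hk₁⟩ := hz
      have h8 : m' = (q * d k₁) • m k₁ := by
        rw [h7]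
        exact Finset.sum_eq_single k₁ (fun k _ hk => by
          rw [hex k₁ k hk.symm hk₁, mul_zero, zero_smul]) fun h => absurd (Finset.mem_univ _) h
      rcases hunit k₁ hk₁ with h | h
      · rw [h, one_smul] at h8
        exact h6 k₁ h8
      · rw [h] at h8
        apply hneg _ (h3 k₁)
        convert h5
        rw [h8, ract, ← neg_vecMul]
        congr 1
        ext c
        simp [castZ]

lemma ite_one_zero_mono {a b : Prop} [Decidable a] [Decidable b] (h : a → b) :
    (if a then 1 else 0 : ENNReal) ≤ if b then 1 else 0 := by
  by_cases ha : a
  · rw [if_pos ha, if_pos (h ha)]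
  · rw [if_neg ha]
    exact zero_le

/-- The bound for a relation whose largest coefficient is `H`. -/
noncomputable def rowWeight (n H : ℕ) : ENNReal :=
  if H ≤ 1 then youngA ^ n else ((H : ENNReal) ^ n)⁻¹

lemma lintegral_row_le {P : Measure (SLR n)} (hP : IsLatticeLift P)
    (hι : Fintype.card ι < n) {T : Set (Fin n → ℝ)} (hT : MeasurableSet T) (hv : volume T ≠ ⊤)
    (h0 : (0 : Fin n → ℝ) ∉ T) (hneg : ∀ x ∈ T, -x ∉ T) {q : ℤ} (hq : q ≠ 0) {d : ι → ℤ}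
    (hqd : ∃ (a : ι → ℤ) (b : ℤ), ∑ k, a k * d k + b * q = 1) {H : ℕ}
    (hqH : q.natAbs ≤ H) (hdH : ∀ k, (d k).natAbs ≤ H) (hH : q.natAbs = H ∨ ∃ k, (d k).natAbs = H) :
    ∫⁻ g, (∑' m : ι → Fin n → ℤ, if LinearIndependent ℤ m ∧ ract (castZ m) g ∈ box ι T ∧
        RowEvent T q d m g then 1 else 0) ∂P ≤
      rowWeight n H * volume T ^ Fintype.card ι := by
  unfold rowWeight
  split_ifs with h1
  · refine lintegral_row_unit hP hι hT hv h0 hneg ?_ fun k => (hdH k).trans h1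
    clear hqd hdH hH
    omega
  · rcases hH with hH | ⟨k₀, hH⟩
    · refine le_trans (lintegral_mono fun g => ENNReal.tsum_le_tsum fun m => ite_one_zero_mono ?_)
        (hH ▸ lintegral_row_denominator hP hι hT hq d hqd)
      rintro ⟨h2, h3, m', h4, -⟩
      exact ⟨h2, h3, m', h4⟩
    · have hk₀ : d k₀ ≠ 0 := by
        intro h
        rw [h] at hH
        simp at hH
        omega
      refine le_trans (lintegral_mono fun g => ENNReal.tsum_le_tsum fun m => ite_one_zero_mono ?_)
        (hH ▸ lintegral_row_numerator hP hι hT hq d hqd hk₀)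
      rintro ⟨h2, h3, m', h4, h5, -⟩
      exact ⟨h2, h3, m', h4, h5⟩

end UnitRow

section Relations

variable {n h : ℕ}

lemma exists_primitive_relation {κ : Type*} [Fintype κ] {m : κ → Fin n → ℤ} {x : Fin n → ℤ} {q : ℤ}
    (hq : q ≠ 0) {d : κ → ℤ} (h : q • x = ∑ k, d k • m k) :
    ∃ e : Option κ → ℤ, e none ≠ 0 ∧ (∃ (a : κ → ℤ) (b : ℤ), ∑ k, a k * e (some k) + b * e none = 1) ∧
      e none • x = ∑ k, e (some k) • m k := by
  let f : Option κ → ℤ := fun o => o.elim q d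
  let g : ℤ := Submodule.IsPrincipal.generator (Ideal.span (Set.range f))
  have hg : Ideal.span {g} = Ideal.span (Set.range f) := Ideal.span_singleton_generator _
  have hdvd : ∀ o, ∃ c, f o = g * c := fun o => by
    have : f o ∈ Ideal.span {g} := by
      rw [hg]
      exact Ideal.subset_span ⟨o, rfl⟩
    exact Ideal.mem_span_singleton'.mp this |>.imp fun c hc => by rw [← hc, mul_comm]
  choose e he using hdvd
  have hg0 : g ≠ 0 := by
    intro h0
    have := he none
    rw [h0, zero_mul] at this
    exact hq this
  obtain ⟨c, hc⟩ := Ideal.mem_span_range_iff_exists_fun.mp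
    (hg ▸ Ideal.mem_span_singleton_self g : g ∈ Ideal.span (Set.range f))
  refine ⟨e, ?_, ⟨fun k => c (some k), c none, ?_⟩, ?_⟩
  · intro h0
    have := he none
    rw [h0, mul_zero] at this
    exact hq this
  · rw [Fintype.sum_option] at hc
    have : g * (∑ k, c (some k) * e (some k) + c none * e none) = g * 1 := by
      rw [mul_one]
      conv_rhs => rw [← hc]
      rw [he none, mul_add, Finset.mul_sum, add_comm]
      congr 1
      · ring
      · refine Finset.sum_congr rfl fun k _ => ?_
        rw [he (some k)]
        ring
    exact mul_left_cancel₀ hg0 this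
  · have h1 : g • (e none • x) = g • ∑ k, e (some k) • m k := by
      rw [smul_smul, ← he none, Finset.smul_sum]
      change q • x = _
      rw [h]
      refine Finset.sum_congr rfl fun k _ => ?_
      rw [smul_smul, ← he (some k)]
      rfl
    exact smul_right_injective _ hg0 h1

lemma exists_relations {m : Fin h → Fin n → ℤ} (hm : ¬ LinearIndependent ℤ m) :
    ∃ I : Finset (Fin h), I ≠ Finset.univ ∧ LinearIndependent ℤ (fun k : {k // k ∈ I} => m k) ∧
      ∃ D : {i // i ∉ I} × Option {k // k ∈ I} → ℤ, ∀ i, D (i, none) ≠ 0 ∧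
        (∃ (a : {k // k ∈ I} → ℤ) (b : ℤ), ∑ k, a k * D (i, some k) + b * D (i, none) = 1) ∧
        D (i, none) • m i = ∑ k, D (i, some k) • m k := by
  obtain ⟨s, hs, hmax⟩ := exists_maximal_linearIndepOn ℤ m
  obtain ⟨I, rfl⟩ : ∃ I : Finset (Fin h), (I : Set (Fin h)) = s := ⟨s.toFinset, by simp⟩
  have hrow : ∀ i : {i // i ∉ I}, ∃ e : Option {k // k ∈ I} → ℤ, e none ≠ 0 ∧
      (∃ (a : {k // k ∈ I} → ℤ) (b : ℤ), ∑ k, a k * e (some k) + b * e none = 1) ∧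
      e none • m i = ∑ k, e (some k) • m k := by
    rintro ⟨i, hi⟩
    obtain ⟨a, ha, hmem⟩ := hmax i (by simpa using hi)
    have hr : m '' (I : Set (Fin h)) = Set.range fun k : {k // k ∈ I} => m k := by
      ext y
      simp
    rw [hr, Submodule.mem_span_range_iff_exists_fun] at hmem
    obtain ⟨d, hd⟩ := hmem
    exact exists_primitive_relation ha hd.symm
  choose e he using hrow
  refine ⟨I, ?_, hs, fun p => e p.1 p.2, fun i => he i⟩
  rintro rfl
  apply hm
  have := hs.comp (fun i : Fin h => (⟨i, by simp⟩ : ((Finset.univ : Finset (Fin h)) : Set (Fin h))))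
    (fun i j hij => by simpa using hij)
  exact this

/-- The largest absolute value of an entry. -/
def entryMax {κ : Type*} [Fintype κ] (D : κ → ℤ) : ℕ := Finset.univ.sup fun x => (D x).natAbs

lemma le_entryMax {κ : Type*} [Fintype κ] (D : κ → ℤ) (x : κ) : (D x).natAbs ≤ entryMax D :=
  Finset.le_sup (f := fun x => (D x).natAbs) (Finset.mem_univ x)

lemma exists_eq_entryMax {κ : Type*} [Fintype κ] [Nonempty κ] (D : κ → ℤ) :
    ∃ x, (D x).natAbs = entryMax D := by
  obtain ⟨x, -, hx⟩ := Finset.exists_mem_eq_sup Finset.univ Finset.univ_nonempty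
    fun x => (D x).natAbs
  exact ⟨x, hx.symm⟩

lemma tsum_entryMax_le {κ : Type*} [Fintype κ] (w : ℕ → ENNReal) :
    ∑' D : κ → ℤ, w (entryMax D) ≤ ∑' H : ℕ, (2 * H + 1 : ENNReal) ^ Fintype.card κ * w H := by
  have h1 : ∀ D : κ → ℤ, w (entryMax D) = ∑' H : ℕ, if entryMax D = H then w H else 0 := fun D => by
    rw [tsum_eq_single (entryMax D) fun H hH => if_neg hH.symm, if_pos rfl]
  simp_rw [h1]
  rw [ENNReal.tsum_comm]
  refine ENNReal.tsum_le_tsum fun H => ?_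
  let B : Finset (κ → ℤ) := Fintype.piFinset fun _ => Finset.Icc (-H : ℤ) H
  have hB : ∀ D : κ → ℤ, entryMax D = H → D ∈ B := fun D hD => by
    refine Fintype.mem_piFinset.mpr fun x => ?_
    have := le_entryMax D x
    rw [Finset.mem_Icc]
    omega
  calc ∑' D : κ → ℤ, (if entryMax D = H then w H else 0)
      = ∑ D ∈ B, if entryMax D = H then w H else 0 :=
        tsum_eq_sum fun D hD => if_neg fun h => hD (hB D h)
    _ ≤ ∑ D ∈ B, w H := Finset.sum_le_sum fun D _ => by
        split_ifs
        · exact le_rfl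
        · exact zero_le
    _ = _ := by
        rw [Finset.sum_const, nsmul_eq_mul, Fintype.card_piFinset, Finset.prod_const, Int.card_Icc,
          Finset.card_univ]
        congr 1
        have : ((H : ℤ) + 1 - -H).toNat = 2 * H + 1 := by omega
        rw [this]
        push_cast
        rfl

end Relations

section WeightSum

lemma rowWeight_sum_le {n N b : ℕ} (hN : N ≤ b) (hb : b + 2 ≤ n) :
    ∑' H : ℕ, (2 * H + 1 : ENNReal) ^ N * (if H = 0 then 0 else rowWeight n H) ≤
      3 ^ b * (youngA ^ n + 4 * (2 ^ (n - b))⁻¹) := by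
  have hterm : ∀ H : ℕ, (2 * (H + 2 : ℕ) + 1 : ENNReal) ^ N *
      (if H + 2 = 0 then 0 else rowWeight n (H + 2)) ≤
        3 ^ b * (4 * (2 ^ (n - b))⁻¹) * (((H + 2 : ℕ) : ENNReal) ^ 2)⁻¹ := by
    intro H
    rw [if_neg (by omega), rowWeight, if_neg (by omega)]
    set K : ENNReal := ((H + 2 : ℕ) : ENNReal) with hK
    have hK2 : (2 : ENNReal) ≤ K := by
      rw [hK]
      exact_mod_cast Nat.le_add_left 2 H
    have hK1 : (1 : ENNReal) ≤ K := le_trans (by norm_num) hK2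
    have hK0 : K ≠ 0 := by
      intro h
      rw [h] at hK1
      simp at hK1
    have hKt : K ≠ ⊤ := by
      rw [hK]
      exact ENNReal.natCast_ne_top _
    have e1 : (2 * K + 1) ^ N ≤ 3 ^ b * K ^ b := by
      calc (2 * K + 1) ^ N ≤ (2 * K + 1) ^ b := pow_le_pow_right₀ (by simp) hN
        _ ≤ (2 * K + K) ^ b := by gcongr
        _ = 3 ^ b * K ^ b := by rw [← mul_pow]; congr 1; ring
    have hsplit : n = b + 2 + (n - b - 2) := by omega
    have e2 : K ^ b * (K ^ n)⁻¹ = (K ^ 2)⁻¹ * (K ^ (n - b - 2))⁻¹ := by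
      conv_lhs => rw [hsplit]
      rw [pow_add, pow_add, ENNReal.mul_inv (Or.inr (by finiteness)) (Or.inr (pow_ne_zero _ hK0)),
        ENNReal.mul_inv (Or.inr (by finiteness)) (Or.inr (pow_ne_zero _ hK0)), ← mul_assoc,
        ← mul_assoc, ENNReal.mul_inv_cancel (pow_ne_zero _ hK0) (by finiteness), one_mul]
    have e3 : (K ^ (n - b - 2))⁻¹ ≤ 4 * (2 ^ (n - b))⁻¹ := by
      have : (2 : ENNReal) ^ (n - b) = 2 ^ (n - b - 2) * 4 := by
        rw [show n - b = n - b - 2 + 2 by omega, pow_add]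
        norm_num
      rw [this, ENNReal.mul_inv (by norm_num) (by norm_num), mul_left_comm,
        ENNReal.mul_inv_cancel (by norm_num) (by norm_num), mul_one]
      gcongr
    calc (2 * K + 1) ^ N * (K ^ n)⁻¹ ≤ 3 ^ b * K ^ b * (K ^ n)⁻¹ := by gcongr
      _ = 3 ^ b * ((K ^ 2)⁻¹ * (K ^ (n - b - 2))⁻¹) := by rw [mul_assoc, e2]
      _ ≤ 3 ^ b * ((K ^ 2)⁻¹ * (4 * (2 ^ (n - b))⁻¹)) := by gcongr
      _ = _ := by ring
  have hsq : ∑' H : ℕ, (((H + 2 : ℕ) : ENNReal) ^ 2)⁻¹ ≤ 1 := by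
    refine ENNReal.tsum_le_of_sum_range_le fun M => ?_
    have : ∀ M : ℕ, ∑ H ∈ Finset.range M, (((H + 2 : ℕ) : ℝ) ^ 2)⁻¹ ≤ 1 - 1 / (M + 1) := by
      intro M
      induction M with
      | zero => simp
      | succ M ih =>
        rw [Finset.sum_range_succ]
        have h1 : ((M + 2 : ℕ) : ℝ) = M + 2 := by push_cast; ring
        have hM : (0 : ℝ) ≤ M := Nat.cast_nonneg M
        have h2 : (((M + 2 : ℕ) : ℝ) ^ 2)⁻¹ ≤ 1 / (M + 1) - 1 / ((M + 1 : ℕ) + 1) := by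
          rw [h1]
          push_cast
          rw [div_sub_div _ _ (by positivity) (by positivity), inv_eq_one_div,
            div_le_div_iff₀ (by positivity) (by positivity)]
          nlinarith
        linarith
    calc ∑ H ∈ Finset.range M, (((H + 2 : ℕ) : ENNReal) ^ 2)⁻¹
        = ENNReal.ofReal (∑ H ∈ Finset.range M, (((H + 2 : ℕ) : ℝ) ^ 2)⁻¹) := by
          rw [ENNReal.ofReal_sum_of_nonneg fun _ _ => by positivity]
          refine Finset.sum_congr rfl fun H _ => ?_
          rw [ENNReal.ofReal_inv_of_pos (by positivity), ENNReal.ofReal_pow (by positivity),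
            ENNReal.ofReal_natCast]
      _ ≤ ENNReal.ofReal 1 := ENNReal.ofReal_le_ofReal ((this M).trans (by
          have : (0 : ℝ) ≤ 1 / (M + 1) := by positivity
          linarith))
      _ = 1 := ENNReal.ofReal_one
  rw [tsum_eq_zero_add' ENNReal.summable, if_pos rfl, mul_zero, zero_add,
    tsum_eq_zero_add' ENNReal.summable, mul_add]
  refine add_le_add ?_ ?_
  · rw [if_neg (by omega), rowWeight, if_pos (by omega)]
    have : (2 * ((0 + 1 : ℕ) : ENNReal) + 1) = 3 := by norm_num
    rw [this]
    gcongr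
    norm_num
  · refine le_trans (ENNReal.tsum_le_tsum fun H => hterm H) ?_
    rw [ENNReal.tsum_mul_left]
    exact (mul_le_mul_right hsq _).trans (by rw [mul_one])

end WeightSum

section Moments

variable {n : ℕ}

/-- The number of `h`-tuples of distinct lattice vectors lying in `T`. -/
noncomputable def injSum (T : Set (Fin n → ℝ)) (h : ℕ) (g : SLR n) : ENNReal :=
  ∑' m : Fin h → Fin n → ℤ,
    if Function.Injective m ∧ ract (castZ m) g ∈ box (Fin h) T then 1 else 0

lemma measurable_ite_ract {ι : Type*} [Fintype ι] {T : Set (Fin n → ℝ)} (hT : MeasurableSet T)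
    (p : Prop) [Decidable p] (m : ι → Fin n → ℤ) :
    Measurable fun g : SLR n => if p ∧ ract (castZ m) g ∈ box ι T then (1 : ENNReal) else 0 :=
  Measurable.ite ((MeasurableSet.const p).inter (measurable_ract _ (measurableSet_box hT)))
    measurable_const measurable_const

lemma measurable_injSum {T : Set (Fin n → ℝ)} (hT : MeasurableSet T) (h : ℕ) :
    Measurable (injSum T h) :=
  Measurable.tsum fun m => Measurable.ite
    ((MeasurableSet.const _).inter (measurable_ract _ (measurableSet_box hT)))
    measurable_const measurable_const

lemma lintegral_indep_box {P : Measure (SLR n)} (hP : IsLatticeLift P) {h : ℕ} (hh : h < n)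
    {T : Set (Fin n → ℝ)} (hT : MeasurableSet T) :
    ∫⁻ g, (∑' m : Fin h → Fin n → ℤ,
      if LinearIndependent ℤ m ∧ ract (castZ m) g ∈ box (Fin h) T then 1 else 0) ∂P =
        volume T ^ h := by
  have hm : Measurable ((box (Fin h) T).indicator (1 : (Fin h → Fin n → ℝ) → ENNReal)) :=
    measurable_one.indicator (measurableSet_box hT)
  have := lintegral_indep hP (ι := Fin h) (by simpa using hh) hm
  rw [lintegral_indicator_one (measurableSet_box hT), volume_box, Fintype.card_fin] at this
  rw [← this]
  refine lintegral_congr fun g => tsum_congr fun m => ?_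
  by_cases h1 : LinearIndependent ℤ m <;> by_cases h2 : ract (castZ m) g ∈ box (Fin h) T <;>
    simp [h1, h2]

lemma le_lintegral_injSum {P : Measure (SLR n)} (hP : IsLatticeLift P) {h : ℕ} (hh : h < n)
    {T : Set (Fin n → ℝ)} (hT : MeasurableSet T) :
    volume T ^ h ≤ ∫⁻ g, injSum T h g ∂P := by
  rw [← lintegral_indep_box hP hh hT]
  refine lintegral_mono fun g => ENNReal.tsum_le_tsum fun m => ite_one_zero_mono ?_
  exact fun h => ⟨h.1.injective, h.2⟩

/-- The indicator of a choice of an independent subfamily together with a system of relations. -/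
noncomputable def relIndicator (T : Set (Fin n → ℝ)) {h : ℕ} (I : Finset (Fin h))
    (D : {i // i ∉ I} × Option {k // k ∈ I} → ℤ) (m : {k // k ∈ I} → Fin n → ℤ) (g : SLR n) :
    ENNReal :=
  if (I ≠ Finset.univ ∧ ∀ i, D (i, none) ≠ 0 ∧
      (∃ (a : {k // k ∈ I} → ℤ) (b : ℤ), ∑ k, a k * D (i, some k) + b * D (i, none) = 1)) ∧
    LinearIndependent ℤ m ∧ ract (castZ m) g ∈ box _ T ∧
      ∀ i, RowEvent T (D (i, none)) (fun k => D (i, some k)) m g then 1 else 0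

lemma dependent_tsum_le (T : Set (Fin n → ℝ)) {h : ℕ} (g : SLR n) :
    ∑' m : Fin h → Fin n → ℤ, (if (Function.Injective m ∧ ¬ LinearIndependent ℤ m) ∧
        ract (castZ m) g ∈ box (Fin h) T then 1 else 0 : ENNReal) ≤
      ∑ I : Finset (Fin h), ∑' D : {i // i ∉ I} × Option {k // k ∈ I} → ℤ,
        ∑' m : {k // k ∈ I} → Fin n → ℤ, relIndicator T I D m g := by
  rw [← tsum_fintype (L := SummationFilter.unconditional _)]
  simp_rw [← ENNReal.tsum_prod]
  rw [← ENNReal.tsum_sigma (fun (I : Finset (Fin h))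
    (p : ({i // i ∉ I} × Option {k // k ∈ I} → ℤ) × ({k // k ∈ I} → Fin n → ℤ)) =>
      relIndicator T I p.1 p.2 g)]
  refine ENNReal_tsum_le_of_section (fun b : Σ I : Finset (Fin h),
    ({i // i ∉ I} × Option {k // k ∈ I} → ℤ) × ({k // k ∈ I} → Fin n → ℤ) =>
      fun i => if hi : i ∈ b.1 then b.2.2 ⟨i, hi⟩ else fun c =>
        (∑ k, b.2.1 (⟨i, hi⟩, some k) * b.2.2 k c) / b.2.1 (⟨i, hi⟩, none)) fun m hm => ?_
  have hm' : (Function.Injective m ∧ ¬ LinearIndependent ℤ m) ∧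
      ract (castZ m) g ∈ box (Fin h) T := by
    by_contra hc
    exact hm (if_neg hc)
  obtain ⟨⟨hinj, hdep⟩, hbox⟩ := hm'
  obtain ⟨I, hI, hind, D, hD⟩ := exists_relations hdep
  refine ⟨⟨I, D, fun k => m k⟩, ?_, ?_⟩
  · ext i c
    by_cases hi : i ∈ I
    · simp [hi]
    · simp only [hi, dif_neg, not_false_eq_true]
      have h1 := congrFun (hD ⟨i, hi⟩).2.2 c
      simp only [Pi.smul_apply, smul_eq_mul, Finset.sum_apply] at h1
      rw [← h1, Int.mul_ediv_cancel_left _ (hD ⟨i, hi⟩).1]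
  · rw [if_pos ⟨⟨hinj, hdep⟩, hbox⟩, relIndicator, if_pos]
    refine ⟨⟨hI, fun i => ⟨(hD i).1, (hD i).2.1⟩⟩, hind, fun k => hbox k, fun i =>
      ⟨m i, (hD i).2.2, hbox i, fun k hk => ?_⟩⟩
    have := hinj hk
    exact i.2 (this ▸ k.2)

lemma lintegral_relIndicator_le {P : Measure (SLR n)} (hP : IsLatticeLift P) {h : ℕ} (hh : h < n)
    {T : Set (Fin n → ℝ)} (hT : MeasurableSet T) (hv : volume T ≠ ⊤)
    (h0 : (0 : Fin n → ℝ) ∉ T) (hneg : ∀ x ∈ T, -x ∉ T) (I : Finset (Fin h))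
    (D : {i // i ∉ I} × Option {k // k ∈ I} → ℤ) :
    ∫⁻ g, (∑' m : {k // k ∈ I} → Fin n → ℤ, relIndicator T I D m g) ∂P ≤
      (if entryMax D = 0 then 0 else rowWeight n (entryMax D)) * volume T ^ I.card := by
  by_cases hc : I ≠ Finset.univ ∧ ∀ i, D (i, none) ≠ 0 ∧
      (∃ (a : {k // k ∈ I} → ℤ) (b : ℤ), ∑ k, a k * D (i, some k) + b * D (i, none) = 1)
  · obtain ⟨hI, hD⟩ := hc
    obtain ⟨i₁, hi₁⟩ : ∃ i, i ∉ I := by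
      by_contra hcon
      push Not at hcon
      exact hI (Finset.eq_univ_iff_forall.mpr hcon)
    have : Nonempty ({i // i ∉ I} × Option {k // k ∈ I}) := ⟨(⟨i₁, hi₁⟩, none)⟩
    obtain ⟨⟨i, o⟩, hio⟩ := exists_eq_entryMax D
    have hmax0 : entryMax D ≠ 0 := by
      have h1 := le_entryMax D (⟨i₁, hi₁⟩, none)
      have h2 := Int.natAbs_ne_zero.mpr (hD ⟨i₁, hi₁⟩).1
      omega
    rw [if_neg hmax0]
    have hcard : Fintype.card {k // k ∈ I} = I.card := Fintype.card_coe I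
    have hcard' : Fintype.card {k // k ∈ I} < n := by
      rw [hcard]
      exact lt_of_le_of_lt (by simpa using Finset.card_le_univ I) hh
    have key := lintegral_row_le hP hcard' hT hv h0 hneg (hD i).1 (hD i).2
      (le_entryMax D (i, none)) (fun k => le_entryMax D (i, some k)) (by
        cases o with
        | none => exact Or.inl hio
        | some k => exact Or.inr ⟨k, hio⟩)
    rw [hcard] at key
    refine le_trans (lintegral_mono fun g => ENNReal.tsum_le_tsum fun m => ?_) key
    exact ite_one_zero_mono fun h => ⟨h.2.1, h.2.2.1, h.2.2.2 i⟩
  · refine le_trans (le_of_eq ?_) zero_le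
    refine (lintegral_congr (g := fun _ => 0) fun g => ?_).trans lintegral_zero
    exact ENNReal.tsum_eq_zero.mpr fun m => if_neg fun h => hc h.1

lemma measurableSet_rowEvent {ι : Type*} [Fintype ι] {T : Set (Fin n → ℝ)} (hT : MeasurableSet T)
    (q : ℤ) (d : ι → ℤ) (m : ι → Fin n → ℤ) : MeasurableSet {g : SLR n | RowEvent T q d m g} := by
  have : {g : SLR n | RowEvent T q d m g} = ⋃ m' : Fin n → ℤ, {g : SLR n | q • m' = ∑ k, d k • m k ∧
      vecMul (fun c => (m' c : ℝ)) (toMat g) ∈ T ∧ ∀ k, m' ≠ m k} := by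
    ext g
    simp [RowEvent]
  rw [this]
  refine MeasurableSet.iUnion fun m' => (MeasurableSet.const _).inter
    (MeasurableSet.inter ?_ (MeasurableSet.const _))
  have h1 := (measurable_pi_iff.mp (measurable_ract (n := n) (ι := Unit) fun _ c => (m' c : ℝ))) ()
  exact h1 hT

lemma measurable_relIndicator {T : Set (Fin n → ℝ)} (hT : MeasurableSet T) {h : ℕ}
    (I : Finset (Fin h)) (D : {i // i ∉ I} × Option {k // k ∈ I} → ℤ)
    (m : {k // k ∈ I} → Fin n → ℤ) : Measurable (relIndicator T I D m) := by
  refine Measurable.ite ?_ measurable_const measurable_const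
  refine (MeasurableSet.const _).inter ((MeasurableSet.const _).inter
    (MeasurableSet.inter (measurable_ract _ (measurableSet_box hT)) ?_))
  have h1 := MeasurableSet.iInter fun i : {i // i ∉ I} =>
    measurableSet_rowEvent hT (D (i, none)) (fun k => D (i, some k)) m
  rwa [← Set.ofPred_forall] at h1

theorem lintegral_injSum_le {P : Measure (SLR n)} (hP : IsLatticeLift P) {h b : ℕ} (hh : h < n)
    (hb : (h + 1) ^ 2 ≤ 4 * b + 3) (hbn : b + 2 ≤ n)
    {T : Set (Fin n → ℝ)} (hT : MeasurableSet T) (hv : volume T ≠ ⊤)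
    (h0 : (0 : Fin n → ℝ) ∉ T) (hneg : ∀ x ∈ T, -x ∉ T) :
    ∫⁻ g, injSum T h g ∂P ≤ volume T ^ h +
      (volume T + 1) ^ h * (3 ^ b * (youngA ^ n + 4 * (2 ^ (n - b))⁻¹)) := by
  set W : ENNReal := 3 ^ b * (youngA ^ n + 4 * (2 ^ (n - b))⁻¹) with hW
  have hsplit : ∀ g, injSum T h g ≤ (∑' m : Fin h → Fin n → ℤ,
      if LinearIndependent ℤ m ∧ ract (castZ m) g ∈ box (Fin h) T then 1 else 0) +
      ∑ I : Finset (Fin h), ∑' D : {i // i ∉ I} × Option {k // k ∈ I} → ℤ,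
        ∑' m : {k // k ∈ I} → Fin n → ℤ, relIndicator T I D m g := by
    intro g
    refine le_trans ?_ (add_le_add_right (dependent_tsum_le T g) _)
    rw [injSum, ← ENNReal.tsum_add]
    refine ENNReal.tsum_le_tsum fun m => ?_
    by_cases h1 : LinearIndependent ℤ m <;> by_cases h2 : ract (castZ m) g ∈ box (Fin h) T <;>
      by_cases h3 : Function.Injective m <;> simp [h1, h2, h3]
  have hdep : ∀ I : Finset (Fin h), ∫⁻ g, (∑' D : {i // i ∉ I} × Option {k // k ∈ I} → ℤ,
      ∑' m : {k // k ∈ I} → Fin n → ℤ, relIndicator T I D m g) ∂P ≤ volume T ^ I.card * W := by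
    intro I
    rw [lintegral_tsum (f := fun (D : {i // i ∉ I} × Option {k // k ∈ I} → ℤ) g =>
      ∑' m : {k // k ∈ I} → Fin n → ℤ, relIndicator T I D m g) fun D =>
        (Measurable.tsum fun m => measurable_relIndicator hT I D m).aemeasurable]
    refine le_trans (ENNReal.tsum_le_tsum fun D => lintegral_relIndicator_le hP hh hT hv h0 hneg I D) ?_
    rw [ENNReal.tsum_mul_right, mul_comm]
    refine mul_le_mul_right ?_ _
    refine le_trans (tsum_entryMax_le fun H => if H = 0 then 0 else rowWeight n H) ?_
    refine rowWeight_sum_le ?_ hbn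
    rw [Fintype.card_prod, Fintype.card_option, Fintype.card_coe, Fintype.card_subtype_compl,
      Fintype.card_fin, Fintype.card_coe]
    have hI : I.card ≤ h := by simpa using Finset.card_le_univ I
    obtain ⟨s, hs⟩ := Nat.exists_eq_add_of_le hI
    have hsub : h - I.card = s := by omega
    rw [hsub]
    have hb' := hb
    rw [show h + 1 = I.card + s + 1 by omega] at hb'
    have : 4 * (s * (I.card + 1)) ≤ (I.card + s + 1) ^ 2 := by
      zify
      nlinarith [sq_nonneg ((s : ℤ) - (I.card + 1))]
    omega
  refine (lintegral_mono hsplit).trans ?_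
  rw [lintegral_add_left (Measurable.tsum fun m => measurable_ite_ract hT _ m),
    lintegral_indep_box hP hh hT]
  refine add_le_add_right ?_ _
  rw [lintegral_finsetSum _ fun I _ => Measurable.tsum fun D => Measurable.tsum fun m =>
    measurable_relIndicator hT I D m]
  refine (Finset.sum_le_sum fun I _ => hdep I).trans ?_
  rw [← Finset.sum_mul]
  refine mul_le_mul_left (le_of_eq ?_) _
  rw [← Fin.sum_pow_mul_eq_add_pow]
  simp

end Moments

section Bonferroni

lemma abs_alternating_sum_choose_le {M : ℕ} (hM : M ≠ 0) (d : ℕ) :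
    |∑ i ∈ Finset.range d, (-1 : ℝ) ^ i * M.choose i| ≤ M.choose d := by
  rcases d with _ | d
  · simp
  have h : ∑ i ∈ Finset.range (d + 1), (-1 : ℝ) ^ i * M.choose i = (-1) ^ d * (M - 1).choose d := by
    have h1 := Int.alternating_sum_range_choose_eq_choose (n := M - 1) (m := d)
    rw [Nat.sub_add_cancel (Nat.one_le_iff_ne_zero.mpr hM)] at h1
    exact_mod_cast h1
  rw [h, abs_mul, abs_pow, abs_neg, abs_one, one_pow, one_mul, Nat.abs_cast]
  obtain ⟨M', rfl⟩ := Nat.exists_eq_succ_of_ne_zero hM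
  rw [Nat.succ_eq_add_one, Nat.add_sub_cancel, Nat.choose_succ_succ]
  exact_mod_cast Nat.le_add_right _ _

/-- The Bonferroni inequalities for the event that at least `k + 1` events occur. -/
lemma abs_indicator_sub_sum_choose_le (k d N : ℕ) :
    |(if k + 1 ≤ N then 1 else 0 : ℝ) - ∑ i ∈ Finset.range d,
      (-1 : ℝ) ^ i * (k + i).choose k * N.choose (k + 1 + i)| ≤
      (k + d).choose k * N.choose (k + 1 + d) := by
  induction N with
  | zero =>
    have : ∀ i, Nat.choose 0 (k + 1 + i) = 0 := fun i => Nat.choose_eq_zero_of_lt (by omega)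
    simp [this]
  | succ N ih =>
    have hstep : |(if N = k then 1 else 0 : ℝ) - ∑ i ∈ Finset.range d,
        (-1 : ℝ) ^ i * (k + i).choose k * N.choose (k + i)| ≤ (k + d).choose k * N.choose (k + d) := by
      rcases lt_or_ge N k with hN | hN
      · have : ∀ i, Nat.choose N (k + i) = 0 := fun i => Nat.choose_eq_zero_of_lt (by omega)
        simp [this, hN.ne]
      have hmul : ∀ i, ((k + i).choose k * N.choose (k + i) : ℝ) =
          N.choose k * (N - k).choose i := fun i => by
        have := Nat.choose_mul (n := N) (k := k + i) (s := k) (by omega)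
        rw [Nat.add_sub_cancel_left] at this
        rw [mul_comm]
        exact_mod_cast this
      simp_rw [mul_assoc, hmul, mul_left_comm _ ((N.choose k : ℕ) : ℝ), ← Finset.mul_sum]
      rcases hN.eq_or_lt with rfl | hN
      · rcases d with _ | d
        · simp
        · have : ∑ i ∈ Finset.range (d + 1), (-1 : ℝ) ^ i * ((k - k).choose i) = 1 := by
            rw [Finset.sum_range_succ']
            simp
          rw [this]
          simp
      · rw [if_neg hN.ne', zero_sub, abs_neg, abs_mul, Nat.abs_cast]
        exact mul_le_mul_of_nonneg_left (abs_alternating_sum_choose_le (by omega) d)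
          (Nat.cast_nonneg _)
    have hpascal : ∀ i, ((N + 1).choose (k + 1 + i) : ℝ) = N.choose (k + i) + N.choose (k + 1 + i) :=
      fun i => by
        rw [show k + 1 + i = k + i + 1 by omega, Nat.choose_succ_succ]
        push_cast
        rfl
    have hind : (if k + 1 ≤ N + 1 then 1 else 0 : ℝ) =
        (if N = k then 1 else 0) + if k + 1 ≤ N then 1 else 0 := by
      rcases lt_trichotomy N k with h | h | h
      · rw [if_neg (by omega), if_neg (by omega), if_neg (by omega), add_zero]
      · rw [if_pos (by omega), if_pos (by omega), if_neg (by omega), add_zero]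
      · rw [if_pos (by omega), if_neg (by omega), if_pos (by omega), zero_add]
    simp_rw [hind, hpascal, mul_add, Finset.sum_add_distrib]
    refine le_trans (le_of_eq ?_) ((abs_add_le _ _).trans (add_le_add hstep ih))
    congr 1
    ring

/-- Bonferroni inequalities in terms of factorial moments. -/
lemma abs_measureReal_sub_sum_le {Ω : Type*} [MeasurableSpace Ω] {P : Measure Ω}
    [IsProbabilityMeasure P] {N : Ω → ℕ} {F : ℕ → Ω → ENNReal} {k d : ℕ} {c : ℕ → ℝ}
    (hF : ∀ h ≤ k + 1 + d, Measurable (F h)) (hFN : ∀ h ≤ k + 1 + d, ∀ᵐ ω ∂P, F h ω = (N ω).descFactorial h)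
    (hc : ∀ h ≤ k + 1 + d, ∫⁻ ω, F h ω ∂P = ENNReal.ofReal (c h)) (hc0 : ∀ h, 0 ≤ c h)
    {E : Set Ω} (hE : MeasurableSet E) (hEN : ∀ᵐ ω ∂P, ω ∈ E ↔ k + 1 ≤ N ω) :
    |P.real E - ∑ i ∈ Finset.range d, (-1) ^ i * (k + i).choose k *
      (c (k + 1 + i) / (k + 1 + i)!)| ≤ (k + d).choose k * (c (k + 1 + d) / (k + 1 + d)!) := by
  have hcoe : ∀ h ≤ k + 1 + d, (fun ω => ((N ω).choose h : ℝ)) =ᵐ[P]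
      fun ω => (F h ω).toReal / h ! := fun h hh => by
    filter_upwards [hFN h hh] with ω hω
    rw [hω, ENNReal.toReal_natCast, Nat.descFactorial_eq_factorial_mul_choose, Nat.cast_mul,
      mul_div_cancel_left₀ _ (Nat.cast_ne_zero.mpr (Nat.factorial_ne_zero h))]
  have hfin : ∀ h ≤ k + 1 + d, ∫⁻ ω, F h ω ∂P ≠ ⊤ := fun h hh => by
    rw [hc h hh]
    exact ENNReal.ofReal_ne_top
  have hint : ∀ h ≤ k + 1 + d, Integrable (fun ω => ((N ω).choose h : ℝ)) P := fun h hh =>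
    ((integrable_toReal_of_lintegral_ne_top (hF h hh).aemeasurable (hfin h hh)).div_const _).congr
      (hcoe h hh).symm
  have hval : ∀ h ≤ k + 1 + d, ∫ ω, ((N ω).choose h : ℝ) ∂P = c h / h ! := fun h hh => by
    rw [integral_congr_ae (hcoe h hh), integral_div, integral_toReal (hF h hh).aemeasurable
      (ae_lt_top (hF h hh) (hfin h hh)), hc h hh, ENNReal.toReal_ofReal (hc0 h)]
  have hsum : Integrable (fun ω => ∑ i ∈ Finset.range d,
      (-1) ^ i * (k + i).choose k * ((N ω).choose (k + 1 + i) : ℝ)) P :=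
    integrable_finsetSum _ fun i hi => (hint _ (by have := Finset.mem_range.mp hi; omega)).const_mul _
  have hEind : P.real E = ∫ ω, E.indicator 1 ω ∂P := (integral_indicator_one hE).symm
  have hEint : Integrable (E.indicator (1 : Ω → ℝ)) P := (integrable_const (1 : ℝ)).indicator hE
  have hS : ∑ i ∈ Finset.range d, (-1) ^ i * (k + i).choose k * (c (k + 1 + i) / (k + 1 + i)!) =
      ∫ ω, ∑ i ∈ Finset.range d,
        (-1) ^ i * (k + i).choose k * ((N ω).choose (k + 1 + i) : ℝ) ∂P := by
    rw [integral_finsetSum _ fun i hi =>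
      (hint _ (by have := Finset.mem_range.mp hi; omega)).const_mul _]
    refine Finset.sum_congr rfl fun i hi => ?_
    rw [integral_const_mul, hval _ (by have := Finset.mem_range.mp hi; omega)]
  rw [hEind, hS, ← integral_sub hEint hsum, ← hval _ le_rfl, ← integral_const_mul]
  refine (abs_integral_le_integral_abs).trans (integral_mono_ae (hEint.sub hsum).abs
    ((hint _ le_rfl).const_mul _) ?_)
  filter_upwards [hEN] with ω hω
  have hi : E.indicator (1 : Ω → ℝ) ω = if k + 1 ≤ N ω then 1 else 0 := by
    by_cases h : k + 1 ≤ N ω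
    · rw [Set.indicator_of_mem (hω.mpr h), if_pos h, Pi.one_apply]
    · rw [Set.indicator_of_notMem (mt hω.mp h), if_neg h]
  rw [hi]
  exact abs_indicator_sub_sum_choose_le k d (N ω)

open ProbabilityTheory in
lemma lintegral_descFactorial_poissonMeasure (r : NNReal) (h : ℕ) :
    ∫⁻ x, (x.descFactorial h : ENNReal) ∂poissonMeasure r = ENNReal.ofReal ((r : ℝ) ^ h) := by
  rw [lintegral_countable']
  simp_rw [poissonMeasure_singleton]
  have hterm : ∀ x : ℕ, (x.descFactorial h : ENNReal) *
      ENNReal.ofReal (Real.exp (-r) * r ^ x / x !) =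
      ENNReal.ofReal (x.descFactorial h * (Real.exp (-r) * r ^ x / x !)) := fun x => by
    rw [ENNReal.ofReal_mul (Nat.cast_nonneg _), ENNReal.ofReal_natCast]
  simp_rw [hterm]
  have hs : HasSum (fun x : ℕ => (x.descFactorial h * (Real.exp (-r) * r ^ x / x !) : ℝ))
      ((r : ℝ) ^ h) := by
    rw [← hasSum_nat_add_iff' h, Finset.sum_eq_zero, sub_zero]
    · have := (hasSum_one_poissonMeasure r).mul_left ((r : ℝ) ^ h)
      rw [mul_one] at this
      refine this.congr_fun fun x => ?_
      have h1 := Nat.factorial_mul_descFactorial (Nat.le_add_left h x)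
      rw [Nat.add_sub_cancel] at h1
      have h2 : (x ! : ℝ) * (x + h).descFactorial h = (x + h)! := by exact_mod_cast h1
      have h3 : (x ! : ℝ) ≠ 0 := by positivity
      have h4 : ((x + h)! : ℝ) ≠ 0 := by positivity
      rw [← h2] at h4 ⊢
      field_simp
      ring
    · intro i hi
      rw [Nat.descFactorial_of_lt (Finset.mem_range.mp hi)]
      simp
  rw [← ENNReal.ofReal_tsum_of_nonneg (fun x => by positivity) hs.summable, hs.tsum_eq]

open ProbabilityTheory in
lemma abs_poisson_sub_sum_le {v : ℝ} (hv : 0 ≤ v) (k d : ℕ) :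
    |(1 - Real.exp (-v) * ∑ j ∈ Finset.range (k + 1), v ^ j / j !) - ∑ i ∈ Finset.range d,
      (-1) ^ i * (k + i).choose k * (v ^ (k + 1 + i) / (k + 1 + i)!)| ≤
      (k + d).choose k * (v ^ (k + 1 + d) / (k + 1 + d)!) := by
  lift v to NNReal using hv
  have hreal : (poissonMeasure v).real (Set.Ici (k + 1)) =
      1 - Real.exp (-v) * ∑ j ∈ Finset.range (k + 1), (v : ℝ) ^ j / j ! := by
    have h1 : (Set.Ici (k + 1) : Set ℕ) = (↑(Finset.range (k + 1)))ᶜ := by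
      ext x
      simp
    rw [h1, probReal_compl_eq_one_sub (Finset.measurableSet _), ← sum_measureReal_singleton]
    simp_rw [poissonMeasure_real_singleton, Finset.mul_sum, mul_div_assoc]
  rw [← hreal]
  exact abs_measureReal_sub_sum_le (P := poissonMeasure v) (N := id)
    (F := fun h x => (x.descFactorial h : ENNReal)) (c := fun h => (v : ℝ) ^ h)
    (fun h _ => measurable_from_top) (fun h _ => Filter.Eventually.of_forall fun x => rfl)
    (fun h _ => lintegral_descFactorial_poissonMeasure v h) (fun h => by positivity)
    MeasurableSet.of_discrete (Filter.Eventually.of_forall fun x => Iff.rfl)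

end Bonferroni

section LatticeCount

variable {n : ℕ}

/-- The coefficient vectors of the points of the lattice `ℤ^n g` that lie in `T`. -/
def coeffSet (T : Set (Fin n → ℝ)) (g : SLR n) : Set (Fin n → ℤ) :=
  {m | vecMul (fun i => (m i : ℝ)) (toMat g) ∈ T}

lemma hasAtLeast_iff {α : Type*} (A : Set α) (k : ℕ) : hasAtLeast A k ↔ (k : ℕ∞) ≤ A.encard := by
  constructor
  · rintro ⟨t, htA, rfl⟩
    rw [← Set.encard_coe_eq_coe_finsetCard]
    exact Set.encard_le_encard htA
  · intro h
    obtain ⟨t, htA, ht⟩ := Set.exists_subset_encard_eq h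
    have hfin : t.Finite := Set.finite_of_encard_eq_coe ht
    refine ⟨hfin.toFinset, by simpa using htA, ?_⟩
    rw [hfin.encard_eq_coe_toFinset_card] at ht
    exact_mod_cast ht

lemma injective_vecMul_toMat (g : SLR n) :
    Function.Injective fun m : Fin n → ℤ => vecMul (fun i => (m i : ℝ)) (toMat g) := by
  intro m m' h
  have hu : IsUnit (toMat g) := by
    rw [Matrix.isUnit_iff_isUnit_det, det_toMat]
    exact isUnit_one
  have h1 := Matrix.vecMul_injective_of_isUnit hu h
  ext i
  exact_mod_cast congrFun h1 i

lemma encard_latticeOf_inter (T : Set (Fin n → ℝ)) (g : SLR n) :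
    (latticeOf n g ∩ T).encard = (coeffSet T g).encard := by
  rw [← (injective_vecMul_toMat g).encard_image (coeffSet T g)]
  congr 1
  ext x
  constructor
  · rintro ⟨⟨m, rfl⟩, hx⟩
    exact ⟨m, hx, rfl⟩
  · rintro ⟨m, hm, rfl⟩
    exact ⟨⟨m, rfl⟩, hm⟩

lemma injSum_eq_encard (T : Set (Fin n → ℝ)) (h : ℕ) (g : SLR n) :
    injSum T h g = {m : Fin h → Fin n → ℤ |
      Function.Injective m ∧ ract (castZ m) g ∈ box (Fin h) T}.encard := by
  rw [← ENNReal.tsum_set_one, tsum_subtype _ (fun _ => (1 : ENNReal)), injSum]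
  refine tsum_congr fun m => ?_
  rw [Set.indicator_apply]
  congr

lemma injSum_eq_descFactorial {T : Set (Fin n → ℝ)} {g : SLR n} (hfin : (coeffSet T g).Finite)
    (h : ℕ) : injSum T h g = ((coeffSet T g).ncard.descFactorial h : ENNReal) := by
  have := hfin.fintype
  let e : {m : Fin h → Fin n → ℤ | Function.Injective m ∧ ract (castZ m) g ∈ box (Fin h) T} ≃
      (Fin h ↪ coeffSet T g) :=
    { toFun := fun m => ⟨fun i => ⟨m.1 i, m.2.2 i⟩, fun i j hij => m.2.1 (Subtype.ext_iff.mp hij)⟩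
      invFun := fun f => ⟨fun i => f i,
        fun i j hij => f.injective (Subtype.ext hij), fun i => (f i).2⟩
      left_inv := fun m => rfl
      right_inv := fun f => rfl }
  rw [injSum_eq_encard, Set.encard, ENat.card_congr e, ENat.card_eq_coe_fintype_card,
    Fintype.card_embedding_eq, Fintype.card_fin, ← Nat.card_eq_fintype_card,
    Nat.card_coe_set_eq]
  simp

lemma finite_coeffSet_of_injSum_ne_top {T : Set (Fin n → ℝ)} {g : SLR n} (h : injSum T 1 g ≠ ⊤) :
    (coeffSet T g).Finite := by
  rw [injSum_eq_encard] at h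
  have h1 : {m : Fin 1 → Fin n → ℤ |
      Function.Injective m ∧ ract (castZ m) g ∈ box (Fin 1) T}.Finite := by
    rw [← Set.encard_ne_top_iff]
    intro hc
    rw [hc] at h
    exact h rfl
  refine (h1.image fun m => m 0).subset fun m hm => ⟨fun _ => m, ⟨?_, fun _ => hm⟩, rfl⟩
  exact Function.injective_of_subsingleton _

theorem abs_measureReal_sub_poisson_le {P : Measure (SLR n)} (hP : IsLatticeLift P) {k d b : ℕ}
    (hh : k + 1 + d < n) (hb : (k + 2 + d) ^ 2 ≤ 4 * b + 3) (hbn : b + 2 ≤ n)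
    {T : Set (Fin n → ℝ)} (hT : MeasurableSet T) {v : ℝ} (hv0 : 0 ≤ v)
    (hv : volume T = ENNReal.ofReal v)
    (h0 : (0 : Fin n → ℝ) ∉ T) (hneg : ∀ x ∈ T, -x ∉ T) {W : ℝ} (hW0 : 0 ≤ W)
    (hW : 3 ^ b * (youngA ^ n + 4 * (2 ^ (n - b))⁻¹) ≤ ENNReal.ofReal W)
    {A : Set (SLR n)} (hA : MeasurableSet A)
    (hAT : ∀ g, g ∈ A ↔ ¬ hasAtLeast (latticeOf n g ∩ T) (k + 1)) :
    |P.real A - Real.exp (-v) * ∑ j ∈ Finset.range (k + 1), v ^ j / j !| ≤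
      ∑ i ∈ Finset.range (d + 1), (k + i).choose k * ((v + 1) ^ (k + 1 + i) * W / (k + 1 + i)!) +
      2 * ((k + d).choose k * (v ^ (k + 1 + d) / (k + 1 + d)!)) := by
  have := hP.prob
  have hvt : volume T ≠ ⊤ := hv ▸ ENNReal.ofReal_ne_top
  have hup : ∀ h ≤ k + 1 + d, ∫⁻ g, injSum T h g ∂P ≤
      ENNReal.ofReal (v ^ h + (v + 1) ^ h * W) := fun h hhd => by
    refine (lintegral_injSum_le hP (b := b) (by omega)
      (le_trans (Nat.pow_le_pow_left (by omega) 2) hb) hbn hT hvt h0 hneg).trans ?_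
    rw [hv, ENNReal.ofReal_add (by positivity) (by positivity),
      ENNReal.ofReal_mul (by positivity), ENNReal.ofReal_pow hv0, ENNReal.ofReal_pow (by positivity),
      ENNReal.ofReal_add hv0 zero_le_one, ENNReal.ofReal_one]
    gcongr
  have hne : ∀ h ≤ k + 1 + d, ∫⁻ g, injSum T h g ∂P ≠ ⊤ := fun h hhd =>
    ((hup h hhd).trans_lt ENNReal.ofReal_lt_top).ne
  have hfin : ∀ᵐ g ∂P, (coeffSet T g).Finite := by
    filter_upwards [ae_lt_top (measurable_injSum hT 1) (hne 1 (by omega))] with g hg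
    exact finite_coeffSet_of_injSum_ne_top hg.ne
  set c : ℕ → ℝ := fun h => (∫⁻ g, injSum T h g ∂P).toReal with hc
  have key := abs_measureReal_sub_sum_le (P := P) (N := fun g => (coeffSet T g).ncard)
    (F := injSum T) (k := k) (d := d) (c := c) (fun h _ => measurable_injSum hT h)
    (fun h _ => hfin.mono fun g hg => injSum_eq_descFactorial hg h)
    (fun h hhd => (ENNReal.ofReal_toReal (hne h hhd)).symm) (fun h => ENNReal.toReal_nonneg)
    hA.compl (hfin.mono fun g hg => by
      rw [Set.mem_compl_iff, hAT, not_not, hasAtLeast_iff, encard_latticeOf_inter,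
        ← hg.cast_ncard_eq]
      exact_mod_cast Iff.rfl)
  rw [probReal_compl_eq_one_sub hA] at key
  have hpois := abs_poisson_sub_sum_le hv0 k d
  have hc1 : ∀ h ≤ k + 1 + d, v ^ h ≤ c h := fun h hhd => by
    rw [← ENNReal.ofReal_le_iff_le_toReal (hne h hhd), ENNReal.ofReal_pow hv0, ← hv]
    exact le_lintegral_injSum hP (by omega) hT
  have hc2 : ∀ h ≤ k + 1 + d, c h ≤ v ^ h + (v + 1) ^ h * W := fun h hhd =>
    ENNReal.toReal_le_of_le_ofReal (by positivity) (hup h hhd)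
  have hdiff : |∑ i ∈ Finset.range d, (-1 : ℝ) ^ i * (k + i).choose k *
      (c (k + 1 + i) / (k + 1 + i)!) - ∑ i ∈ Finset.range d, (-1 : ℝ) ^ i * (k + i).choose k *
      (v ^ (k + 1 + i) / (k + 1 + i)!)| ≤
      ∑ i ∈ Finset.range d, (k + i).choose k * ((v + 1) ^ (k + 1 + i) * W / (k + 1 + i)!) := by
    rw [← Finset.sum_sub_distrib]
    refine (Finset.abs_sum_le_sum_abs _ _).trans (Finset.sum_le_sum fun i hi => ?_)
    have hi' : k + 1 + i ≤ k + 1 + d := by have := Finset.mem_range.mp hi; omega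
    rw [← mul_sub, ← sub_div, abs_mul, abs_mul, abs_pow, abs_neg, abs_one, one_pow, one_mul,
      Nat.abs_cast, abs_of_nonneg (div_nonneg (sub_nonneg.mpr (hc1 _ hi')) (Nat.cast_nonneg _))]
    gcongr
    linarith [hc2 _ hi']
  have hlast : ((k + d).choose k : ℝ) * (c (k + 1 + d) / (k + 1 + d)!) ≤
      (k + d).choose k * (v ^ (k + 1 + d) / (k + 1 + d)!) +
      (k + d).choose k * ((v + 1) ^ (k + 1 + d) * W / (k + 1 + d)!) := by
    rw [← mul_add, ← add_div]
    gcongr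
    exact hc2 _ le_rfl
  rw [Finset.sum_range_succ _ d]
  rw [abs_le] at key hpois hdiff ⊢
  constructor <;> linarith [key.1, key.2, hpois.1, hpois.2, hdiff.1, hdiff.2]

end LatticeCount

section PosHalf

variable {n : ℕ} {S : Set (Fin n → ℝ)}

lemma measurableSet_posHalf (hS : MeasurableSet S) : MeasurableSet (posHalf n S) := by
  have : posHalf n S = S ∩ ⋃ i : Fin n, ({x | 0 < x i} ∩ ⋂ j : Fin n, ⋂ _ : j < i, {x | x j = 0}) := by
    ext x
    simp [posHalf]
  rw [this]
  refine hS.inter (MeasurableSet.iUnion fun i => MeasurableSet.inter ?_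
    (MeasurableSet.iInter fun j => MeasurableSet.iInter fun _ => ?_))
  · exact measurableSet_lt measurable_const (measurable_pi_apply i)
  · exact measurableSet_eq_fun (measurable_pi_apply j) measurable_const

lemma zero_notMem_posHalf : (0 : Fin n → ℝ) ∉ posHalf n S := by
  rintro ⟨-, i, hi, -⟩
  exact lt_irrefl _ hi

lemma neg_notMem_posHalf {x : Fin n → ℝ} (hx : x ∈ posHalf n S) : -x ∉ posHalf n S := by
  rintro ⟨-, i, hi, hi'⟩
  obtain ⟨-, j, hj, hj'⟩ := hx
  simp only [Pi.neg_apply, neg_eq_zero] at hi hi'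
  rcases lt_trichotomy i j with h | h | h
  · rw [hj' i h] at hi
    simp at hi
  · subst h
    linarith
  · exact hj.ne' (hi' j h)

lemma volume_posHalf (hn : n ≠ 0) (hS : MeasurableSet S) (hsym : ∀ x, x ∈ S ↔ -x ∈ S) {V : ℝ}
    (hV0 : 0 ≤ V) (hV : volume S = ENNReal.ofReal V) :
    volume (posHalf n S) = ENNReal.ofReal (V / 2) := by
  have : Nonempty (Fin n) := Fin.pos_iff_nonempty.mp (Nat.pos_of_ne_zero hn)
  have hunion : posHalf n S ∪ -posHalf n S = S \ {0} := by
    ext x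
    constructor
    · rintro (hx | hx)
      · exact ⟨hx.1, fun h => zero_notMem_posHalf (h ▸ hx)⟩
      · refine ⟨(hsym x).mpr hx.1, fun h => ?_⟩
        rw [Set.mem_singleton_iff.mp h, Set.mem_neg, neg_zero] at hx
        exact zero_notMem_posHalf hx
    · rintro ⟨hxS, hx0⟩
      have hne : ∃ i, x i ≠ 0 := by
        by_contra h
        push Not at h
        exact hx0 (funext h)
      have hmin := WellFounded.min_mem (wellFounded_lt (α := Fin n)) {i | x i ≠ 0} hne
      set i := WellFounded.min (wellFounded_lt (α := Fin n)) {i | x i ≠ 0} hne with hi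
      have hlt : ∀ j < i, x j = 0 := fun j hj => by
        by_contra hc
        exact WellFounded.not_lt_min wellFounded_lt (s := {i | x i ≠ 0}) hc hj
      rcases lt_or_gt_of_ne hmin with h | h
      · exact Or.inr ⟨(hsym x).mp hxS, i, by simpa using h, fun j hj => by simp [hlt j hj]⟩
      · exact Or.inl ⟨hxS, i, h, hlt⟩
  have hdisj : Disjoint (posHalf n S) (-posHalf n S) :=
    Set.disjoint_left.mpr fun x hx hx' => neg_notMem_posHalf hx hx'
  have h1 : volume (posHalf n S) + volume (posHalf n S) = ENNReal.ofReal V := by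
    rw [← hV, ← measure_sdiff_null (s := S) (measure_singleton (0 : Fin n → ℝ)), ← hunion,
      measure_union hdisj (measurableSet_posHalf hS).neg, Measure.measure_neg]
  have h2 : 2 * volume (posHalf n S) = 2 * ENNReal.ofReal (V / 2) := by
    rw [two_mul, h1, two_mul, ← ENNReal.ofReal_add (by positivity) (by positivity), add_halves]
  exact (ENNReal.mul_right_inj two_ne_zero ENNReal.ofNat_ne_top).mp h2

end PosHalf

section Asymptotics

lemma choose_div_factorial_le (k i : ℕ) :
    ((k + i).choose k : ℝ) / (k + 1 + i)! ≤ 1 / (k ! * (i + 1)!) := by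
  have h1 : (((k + i).choose k : ℝ) * k ! * i !) = (k + i)! := by
    have h := Nat.add_choose_mul_factorial_mul_factorial i k
    rw [add_comm i k, mul_assoc, mul_comm i !, ← mul_assoc] at h
    exact_mod_cast h
  have h2 : ((k + 1 + i)! : ℝ) = (k + i + 1) * ((k + i).choose k * k ! * i !) := by
    rw [h1, show k + 1 + i = k + i + 1 by omega, Nat.factorial_succ]
    push_cast
    ring
  have h3 : (0 : ℝ) < (k + i).choose k := by
    exact_mod_cast Nat.choose_pos (Nat.le_add_right k i)
  have h4 : ((i + 1)! : ℝ) = (i + 1) * i ! := by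
    rw [Nat.factorial_succ]
    push_cast
    ring
  rw [h2, h4, div_le_div_iff₀ (by positivity) (by positivity)]
  have h5 : (0 : ℝ) ≤ k * ((k + i).choose k * k ! * i !) := by positivity
  nlinarith

lemma twelve_mul_mul_four_pow_le {D : ℕ} (hD : 6 ≤ D) : 12 * D * 4 ^ D ≤ 9 ^ D := by
  induction D, hD using Nat.le_induction with
  | base => norm_num
  | succ D hD ih =>
    rw [pow_succ, pow_succ]
    have : 4 * (D + 1) ≤ 9 * D := by omega
    calc 12 * (D + 1) * (4 ^ D * 4) = 12 * 4 ^ D * (4 * (D + 1)) := by ring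
      _ ≤ 12 * 4 ^ D * (9 * D) := Nat.mul_le_mul_left _ this
      _ = (12 * D * 4 ^ D) * 9 := by ring
      _ ≤ 9 ^ D * 9 := Nat.mul_le_mul_right _ ih

lemma two_mul_pow_div_factorial_le {a v : ℝ} {D : ℕ} (ha : 0 < a) (hv : 0 ≤ v) (hva : 16 * v ≤ a)
    (haD : a ≤ 3 * D) (hD : 6 ≤ D) :
    2 * (v ^ D / D !) ≤ a ^ (-(1 / 2) : ℝ) * Real.exp (-v) := by
  have hD0 : (0 : ℝ) < D := by exact_mod_cast (by omega : 0 < D)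
  have hq : Real.exp 1 * Real.exp (3 / 16) * (3 / 16) ≤ 2 / 3 := by
    have h1 := Real.exp_one_lt_d9.le
    have h2 : Real.exp (3 / 16) ≤ 1 / (1 - 3 / 16) :=
      Real.exp_bound_div_one_sub_of_interval (by norm_num) (by norm_num)
    calc Real.exp 1 * Real.exp (3 / 16) * (3 / 16)
        ≤ 2.7182818286 * (1 / (1 - 3 / 16)) * (3 / 16) := by gcongr
      _ ≤ 2 / 3 := by norm_num
  have hfac : v ^ D / D ! * Real.exp v ≤ (2 / 3) ^ D := by
    have h1 : v ^ D / D ! = (v / D) ^ D * ((D : ℝ) ^ D / D !) := by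
      rw [div_pow]
      field_simp
    have h2 : (D : ℝ) ^ D / D ! ≤ Real.exp 1 ^ D := by
      rw [← Real.exp_nat_mul, mul_one]
      exact Real.pow_div_factorial_le_exp _ hD0.le _
    have h3 : v / D ≤ 3 / 16 := by
      rw [div_le_iff₀ hD0]
      linarith
    have h4 : Real.exp v ≤ Real.exp (3 / 16) ^ D := by
      rw [← Real.exp_nat_mul, Real.exp_le_exp]
      linarith
    calc v ^ D / D ! * Real.exp v
        ≤ ((3 / 16) ^ D * Real.exp 1 ^ D) * Real.exp (3 / 16) ^ D := by
          rw [h1]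
          gcongr
      _ = (Real.exp 1 * Real.exp (3 / 16) * (3 / 16)) ^ D := by
          rw [mul_pow, mul_pow]
          ring
      _ ≤ (2 / 3) ^ D := by gcongr
  have hsq : 2 * (2 / 3 : ℝ) ^ D * √a ≤ 1 := by
    rw [← abs_of_nonneg (by positivity : (0 : ℝ) ≤ 2 * (2 / 3 : ℝ) ^ D * √a), ← sq_le_one_iff_abs_le_one,
      mul_pow, mul_pow, Real.sq_sqrt ha.le, ← pow_mul, mul_comm D 2, pow_mul]
    have h1 : (12 * D * 4 ^ D : ℝ) ≤ 9 ^ D := by exact_mod_cast twelve_mul_mul_four_pow_le hD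
    have h2 : ((2 / 3 : ℝ) ^ 2) ^ D = 4 ^ D / 9 ^ D := by
      rw [← div_pow]
      norm_num
    rw [h2]
    calc (2 : ℝ) ^ 2 * ((4 : ℝ) ^ D / 9 ^ D) * a ≤ 2 ^ 2 * (4 ^ D / 9 ^ D) * (3 * D) := by gcongr
      _ = (12 * (D : ℝ) * 4 ^ D) / 9 ^ D := by ring
      _ ≤ 1 := by
        rw [div_le_one (by positivity)]
        exact h1
  have hsa : 0 < √a := Real.sqrt_pos.mpr ha
  rw [Real.rpow_neg ha.le, ← Real.sqrt_eq_rpow, Real.exp_neg, ← mul_inv, ← one_div,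
    le_div_iff₀ (by positivity)]
  calc 2 * (v ^ D / D !) * (√a * Real.exp v) = 2 * (v ^ D / D ! * Real.exp v) * √a := by ring
    _ ≤ 2 * (2 / 3) ^ D * √a := by gcongr
    _ ≤ 1 := hsq

lemma truncation_le {a v : ℝ} {k d : ℕ} (ha : 0 < a) (hv : 0 ≤ v) (hva : 16 * v ≤ a)
    (had : a ≤ 3 * d) (hd : 6 ≤ d) :
    2 * ((k + d).choose k * (v ^ (k + 1 + d) / (k + 1 + d)!)) ≤
      a ^ (-(1 / 2) : ℝ) * (Real.exp (-v) * ∑ j ∈ Finset.range (k + 1), v ^ j / j !) := by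
  have h1 := two_mul_pow_div_factorial_le (D := d + 1) ha hv hva (by push_cast; linarith) (by omega)
  have h2 : v ^ k / k ! ≤ ∑ j ∈ Finset.range (k + 1), v ^ j / j ! :=
    Finset.single_le_sum (f := fun j => v ^ j / (j ! : ℝ)) (fun j _ => by positivity)
      (Finset.self_mem_range_succ k)
  calc 2 * ((k + d).choose k * (v ^ (k + 1 + d) / (k + 1 + d)!))
      = 2 * (((k + d).choose k : ℝ) / (k + 1 + d)! * v ^ (k + 1 + d)) := by ring
    _ ≤ 2 * (1 / (k ! * (d + 1)!) * v ^ (k + 1 + d)) := by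
        exact mul_le_mul_of_nonneg_left (mul_le_mul_of_nonneg_right
          (choose_div_factorial_le k d) (by positivity)) zero_le_two
    _ = 2 * (v ^ (d + 1) / (d + 1)!) * (v ^ k / k !) := by
        rw [show k + 1 + d = (d + 1) + k by omega, pow_add]
        field_simp
    _ ≤ a ^ (-(1 / 2) : ℝ) * Real.exp (-v) * ∑ j ∈ Finset.range (k + 1), v ^ j / j ! := by
        gcongr
    _ = _ := by ring

lemma moment_error_le {M v W : ℝ} {k d : ℕ} (hv : 0 ≤ v) (hW : 0 ≤ W) (hM : (k + 1 + d : ℝ) ≤ M) :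
    ∑ i ∈ Finset.range (d + 1), (k + i).choose k * ((v + 1) ^ (k + 1 + i) * W / (k + 1 + i)!) ≤
      1 / k ! * M * W * (v + 1) ^ M := by
  have hterm : ∀ i ∈ Finset.range (d + 1),
      (k + i).choose k * ((v + 1) ^ (k + 1 + i) * W / (k + 1 + i)!) ≤ 1 / k ! * W * (v + 1) ^ M := by
    intro i hi
    have hi' : (i : ℝ) ≤ d := by exact_mod_cast Nat.lt_succ_iff.mp (Finset.mem_range.mp hi)
    have h1 : ((k + i).choose k : ℝ) / (k + 1 + i)! ≤ 1 / k ! := by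
      refine (choose_div_factorial_le k i).trans ?_
      gcongr
      have : (1 : ℝ) ≤ (i + 1)! := by exact_mod_cast Nat.one_le_iff_ne_zero.mpr (Nat.factorial_ne_zero _)
      nlinarith [(by positivity : (0 : ℝ) ≤ k !)]
    have h2 : (v + 1) ^ (k + 1 + i) ≤ (v + 1) ^ M := by
      rw [← Real.rpow_natCast]
      refine Real.rpow_le_rpow_of_exponent_le (by linarith) ?_
      push_cast
      linarith
    calc (k + i).choose k * ((v + 1) ^ (k + 1 + i) * W / (k + 1 + i)!)
        = ((k + i).choose k : ℝ) / (k + 1 + i)! * W * (v + 1) ^ (k + 1 + i) := by ring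
      _ ≤ 1 / k ! * W * (v + 1) ^ M := by gcongr
  refine (Finset.sum_le_sum hterm).trans ?_
  rw [Finset.sum_const, Finset.card_range, nsmul_eq_mul]
  have hdM : ((d + 1 : ℕ) : ℝ) ≤ M := by
    push_cast
    linarith [(Nat.cast_nonneg k : (0 : ℝ) ≤ k)]
  calc ((d + 1 : ℕ) : ℝ) * (1 / k ! * W * (v + 1) ^ M) ≤ M * (1 / k ! * W * (v + 1) ^ M) := by gcongr
    _ = _ := by ring

end Asymptotics

section Parameters

lemma three_pow_mul_youngA_pow_le {n b : ℕ} (hb : 60 * b ≤ n) :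
    3 ^ b * (youngA ^ n + 4 * (2 ^ (n - b))⁻¹) ≤ ENNReal.ofReal (5 * 0.999 ^ n) := by
  have hpow : ∀ x y : ℝ, 1 ≤ x → 0 ≤ y → y ≤ x ^ 60 → y ^ b ≤ x ^ n := fun x y hx hy hxy =>
    calc y ^ b ≤ (x ^ 60) ^ b := by gcongr
      _ = x ^ (60 * b) := (pow_mul _ _ _).symm
      _ ≤ x ^ n := pow_le_pow_right₀ hx hb
  have h3 : (3 : ℝ) ^ b ≤ 1.02 ^ n := hpow _ _ (by norm_num) (by norm_num) (by norm_num)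
  have h6 : (6 : ℝ) ^ b ≤ 1.04 ^ n := hpow _ _ (by norm_num) (by norm_num) (by norm_num)
  have hfirst : (3 : ℝ) ^ b * 0.945 ^ n ≤ 0.999 ^ n :=
    calc (3 : ℝ) ^ b * 0.945 ^ n ≤ 1.02 ^ n * 0.945 ^ n := by gcongr
      _ = (1.02 * 0.945) ^ n := (mul_pow _ _ _).symm
      _ ≤ 0.999 ^ n := by
        gcongr
        norm_num
  have hsecond : (3 : ℝ) ^ b * (2 ^ (n - b))⁻¹ ≤ 0.999 ^ n := by
    have h2 : ((2 : ℝ) ^ (n - b))⁻¹ = 2 ^ b * (1 / 2) ^ n := by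
      have h2' : (2 : ℝ) ^ n = 2 ^ (n - b) * 2 ^ b := by rw [← pow_add, Nat.sub_add_cancel (by omega)]
      rw [one_div, inv_pow, h2']
      field_simp
    calc (3 : ℝ) ^ b * (2 ^ (n - b))⁻¹ = 6 ^ b * (1 / 2) ^ n := by
          rw [h2, ← mul_assoc, ← mul_pow]
          norm_num
      _ ≤ 1.04 ^ n * (1 / 2) ^ n := by gcongr
      _ = (1.04 * (1 / 2)) ^ n := (mul_pow _ _ _).symm
      _ ≤ 0.999 ^ n := by
        gcongr
        norm_num
  have hcast : ENNReal.ofReal (3 ^ b * (0.945 ^ n + 4 * (2 ^ (n - b))⁻¹)) =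
      3 ^ b * (ENNReal.ofReal 0.945 ^ n + 4 * (2 ^ (n - b))⁻¹) := by
    rw [ENNReal.ofReal_mul (by positivity), ENNReal.ofReal_add (by positivity) (by positivity),
      ENNReal.ofReal_mul (by positivity), ENNReal.ofReal_inv_of_pos (by positivity),
      ENNReal.ofReal_pow (by positivity), ENNReal.ofReal_pow (by positivity),
      ENNReal.ofReal_pow (by positivity)]
    simp
  refine le_trans ?_ (hcast.symm.le.trans (ENNReal.ofReal_le_ofReal ?_))
  · gcongr
    exact youngA_le
  · linarith

/-- For large `n`, the number of vectors allowed and the order of truncation are small compared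
with `√n`. -/
lemma exists_forall_parameters {ε : ℝ} (hε : 0 < ε) : ∃ N : ℕ, ∀ n : ℕ, N ≤ n → ∀ k : ℕ,
    (k : ℝ) ≤ ((n : ℝ) / 2) ^ ((1 / 2 : ℝ) - ε) →
    0 < √((n : ℝ) / 2) - k ∧ ∃ d b : ℕ, √((n : ℝ) / 2) - k ≤ 3 * d ∧ 6 ≤ d ∧
      (k + 1 + d : ℝ) ≤ √((n : ℝ) / 2) ∧ k + 1 + d < n ∧ (k + 2 + d) ^ 2 ≤ 4 * b + 3 ∧
      60 * b ≤ n ∧ b + 2 ≤ n := by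
  have hhalf : Filter.Tendsto (fun n : ℕ => (n : ℝ) / 2) Filter.atTop Filter.atTop :=
    tendsto_natCast_atTop_atTop.atTop_div_const two_pos
  have hlim : Filter.Tendsto (fun n : ℕ => ((n : ℝ) / 2) ^ (-ε)) Filter.atTop (nhds 0) :=
    (tendsto_rpow_neg_atTop hε).comp hhalf
  have hev := (hlim.eventually (gt_mem_nhds (by norm_num : (0 : ℝ) < 1 / 100))).and
    (hhalf.eventually_ge_atTop (1000000 : ℝ))
  obtain ⟨N, hN⟩ := Filter.eventually_atTop.mp hev
  refine ⟨N, fun n hn k hk => ?_⟩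
  obtain ⟨h1, h2⟩ := hN n hn
  set x : ℝ := (n : ℝ) / 2 with hx
  have hx0 : 0 < x := by linarith
  set M := √x with hM
  have hMsq : M ^ 2 = x := Real.sq_sqrt hx0.le
  have hM1000 : 1000 ≤ M := Real.le_sqrt_of_sq_le (by norm_num; linarith)
  have hkM : (k : ℝ) ≤ M / 100 := by
    rw [sub_eq_add_neg, Real.rpow_add hx0, ← Real.sqrt_eq_rpow] at hk
    nlinarith
  have ha : 0 < M - k := by linarith
  have hceil := Nat.ceil_lt_add_one (a := (M - k) / 3) (by linarith)
  have hceil' := Nat.le_ceil ((M - k) / 3)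
  set d := ⌈(M - k) / 3⌉₊ with hd
  have hk0 : (0 : ℝ) ≤ k := Nat.cast_nonneg k
  have hsum : (k + 2 + d : ℝ) ≤ 0.36 * M := by linarith
  have hsq : ((k + 2 + d : ℝ)) ^ 2 ≤ 0.0648 * n := by
    calc ((k + 2 + d : ℝ)) ^ 2 ≤ (0.36 * M) ^ 2 := by gcongr
      _ = 0.1296 * M ^ 2 := by ring
      _ = 0.0648 * n := by rw [hMsq, hx]; ring
  have hnat : 15 * (k + 2 + d) ^ 2 ≤ n := by
    have : (15 * (k + 2 + d : ℝ) ^ 2) ≤ n := by nlinarith [(Nat.cast_nonneg n : (0 : ℝ) ≤ n)]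
    exact_mod_cast this
  have hd6 : 6 ≤ d := by
    have : (6 : ℝ) ≤ d := by linarith
    exact_mod_cast this
  have hlin : k + 2 + d ≤ (k + 2 + d) ^ 2 := Nat.le_self_pow two_ne_zero _
  refine ⟨ha, d, (k + 2 + d) ^ 2 / 4, by linarith, hd6, by linarith, ?_, ?_, ?_, ?_⟩ <;> omega

end Parameters

/-- **Theorem (Poisson approximation for the number of short lattice vectors).**
Fix `ε > 0`. There exists `N` (depending only on `ε`) so that for all `n ≥ N`: if
`S ⊆ ℝ^n` is Borel measurable, symmetric about the origin, of Lebesgue measure `V`,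
`k` is a positive integer with `k ≤ (n/2)^{1/2−ε}` and `8V ≤ √(n/2) − k`, and `P(S,k)`
is the `μ_n`-measure of the set of lattices having at most `k` nonzero vectors up to
sign in `S` (i.e. `|L ∩ S'| ≤ k`), then
`(1 − (√(n/2)−k)^{−1/2})·P_{V/2}(k) − E ≤ P(S,k) ≤ (1 + (√(n/2)−k)^{−1/2})·P_{V/2}(k) + E`
where `P_{V/2}(k) = e^{−V/2} Σ_{j=0}^k (V/2)^j/j!` and
`E = (12/k!)·√(n/2)·(0.999)^n·(V/2+1)^{√(n/2)}`. -/
theorem stmt1 (ε : ℝ) (hε : 0 < ε) :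
    ∃ N : ℕ, ∀ n : ℕ, N ≤ n →
      ∀ (S : Set (Fin n → ℝ)), MeasurableSet S → (∀ x, x ∈ S ↔ -x ∈ S) →
      ∀ V : ℝ, 0 ≤ V → MeasureTheory.volume S = ENNReal.ofReal V →
      ∀ k : ℕ, 1 ≤ k → (k : ℝ) ≤ ((n : ℝ) / 2) ^ ((1 / 2 : ℝ) - ε) →
        8 * V ≤ Real.sqrt ((n : ℝ) / 2) - k →
      ∀ (μ : MeasureTheory.Measure (LatSpace n)), MeasureTheory.IsProbabilityMeasure μ →
        (∀ a : SLR n, μ.map (rTranslate n a) = μ) →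
      ∀ (A : Set (LatSpace n)), MeasurableSet A →
        (∀ g : SLR n, latMk n g ∈ A ↔
          ¬ hasAtLeast (latticeOf n g ∩ posHalf n S) (k + 1)) →
      (1 - (Real.sqrt ((n : ℝ) / 2) - k) ^ (-(1 / 2) : ℝ)) *
          (Real.exp (-(V / 2)) * ∑ j ∈ Finset.range (k + 1), (V / 2) ^ j / (j)!)
        - (12 / (k)!) * Real.sqrt ((n : ℝ) / 2) * (0.999 : ℝ) ^ n *
            (V / 2 + 1) ^ (Real.sqrt ((n : ℝ) / 2))
        ≤ (μ A).toReal ∧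
      (μ A).toReal ≤
        (1 + (Real.sqrt ((n : ℝ) / 2) - k) ^ (-(1 / 2) : ℝ)) *
          (Real.exp (-(V / 2)) * ∑ j ∈ Finset.range (k + 1), (V / 2) ^ j / (j)!)
        + (12 / (k)!) * Real.sqrt ((n : ℝ) / 2) * (0.999 : ℝ) ^ n *
            (V / 2 + 1) ^ (Real.sqrt ((n : ℝ) / 2)) := by
  obtain ⟨N, hN⟩ := exists_forall_parameters hε
  refine ⟨N, fun n hn S hS hsym V hV0 hV k _ hk hVk μ hμ hinv A hA hAT => ?_⟩
  obtain ⟨ha, d, b, had, hd, hM, hdn, hb, hbn, hbn'⟩ := hN n hn k hk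
  obtain ⟨P, hP, hPμ⟩ := exists_latticeLift μ hμ hinv
  have hv : 0 ≤ V / 2 := by positivity
  have hmk : MeasurableSet (latMk n ⁻¹' A) := measurable_quotient_mk'' hA
  have := hP.prob
  have hreal : (μ A).toReal = P.real (latMk n ⁻¹' A) := by rw [measureReal_def, hPμ A hA]
  have key := abs_measureReal_sub_poisson_le hP hdn hb hbn' (measurableSet_posHalf hS) hv
    (volume_posHalf (by omega) hS hsym hV0 hV) zero_notMem_posHalf (fun x hx => neg_notMem_posHalf hx)
    (W := 5 * 0.999 ^ n) (by positivity) (three_pow_mul_youngA_pow_le hbn) hmk (fun g => hAT g)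
  have htrunc := truncation_le (k := k) ha hv (by linarith) had hd
  have herr := moment_error_le (W := 5 * 0.999 ^ n) hv (by positivity) hM
  have hE : 1 / (k ! : ℝ) * √((n : ℝ) / 2) * (5 * 0.999 ^ n) * (V / 2 + 1) ^ √((n : ℝ) / 2) ≤
      12 / (k ! : ℝ) * √((n : ℝ) / 2) * 0.999 ^ n * (V / 2 + 1) ^ √((n : ℝ) / 2) := by
    have h0 : 0 ≤ 1 / (k ! : ℝ) * √((n : ℝ) / 2) * 0.999 ^ n * (V / 2 + 1) ^ √((n : ℝ) / 2) := by
      positivity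
    rw [show (12 : ℝ) / (k ! : ℝ) = 12 * (1 / (k ! : ℝ)) by ring]
    linarith
  rw [hreal, sub_mul, add_mul, one_mul]
  rw [abs_le] at key
  constructor <;> linarith [key.1, key.2]
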